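/- Let N ≥ 3, let p, q > 0 with pq > 1, let a, b > −2, and assume the quadruple (p,q,a,b) is subcritical. If either min{p,q} < 1 or 0 ≤ a − b ≤ (N−2)(p−q), then the Hénon–Lane–Emden system (HLE) admits no positive solution that is stable outside a compact set. -/

import Mathlib

open MeasureTheory Metric Set

noncomputable section

/-- Euclidean space `ℝ^N`. -/
abbrev Euc (N : ℕ) := EuclideanSpace ℝ (Fin N)

/-- The Laplacian of a function `f : ℝ^N → ℝ`, as the sum of the pure second
partial derivatives. -/
def lap {N : ℕ} (f : Euc N → ℝ) (x : Euc N) : ℝ :=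
  ∑ i : Fin N, iteratedFDeriv ℝ 2 f x ![EuclideanSpace.single i 1, EuclideanSpace.single i 1]

/-- `(u, v)` is a solution of the Hénon–Lane–Emden system
`-Δu = |x|^a |v|^{p-1} v`, `-Δv = |x|^b |u|^{q-1} u` on `ℝ^N \ {0}`:
`u, v` are `C²` on `ℝ^N \ {0}`, continuous on `ℝ^N`, and satisfy the equations pointwise. -/
def IsHLESol {N : ℕ} (p q a b : ℝ) (u v : Euc N → ℝ) : Prop :=
  ContDiffOn ℝ 2 u {x : Euc N | x ≠ 0} ∧ ContDiffOn ℝ 2 v {x : Euc N | x ≠ 0} ∧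
  Continuous u ∧ Continuous v ∧
  (∀ x : Euc N, x ≠ 0 → -lap u x = ‖x‖ ^ a * (|v x| ^ (p - 1) * v x)) ∧
  (∀ x : Euc N, x ≠ 0 → -lap v x = ‖x‖ ^ b * (|u x| ^ (q - 1) * u x))

/-- Stability of a (positive) solution of the Hénon–Lane–Emden system on an open set `Ω`:
there exist positive `C²` functions `ξ, ζ` on `Ω` with
`-Δξ ≥ p |x|^a v^{p-1} ζ` and `-Δζ ≥ q |x|^b u^{q-1} ξ` on `Ω`. -/
def HLEStableOn {N : ℕ} (p q a b : ℝ) (u v : Euc N → ℝ) (Ω : Set (Euc N)) : Prop :=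
  ∃ ξ ζ : Euc N → ℝ, ContDiffOn ℝ 2 ξ Ω ∧ ContDiffOn ℝ 2 ζ Ω ∧
    (∀ x ∈ Ω, 0 < ξ x) ∧ (∀ x ∈ Ω, 0 < ζ x) ∧
    (∀ x ∈ Ω, p * ‖x‖ ^ a * v x ^ (p - 1) * ζ x ≤ -lap ξ x) ∧
    (∀ x ∈ Ω, q * ‖x‖ ^ b * u x ^ (q - 1) * ξ x ≤ -lap ζ x)

/-- Stability outside a compact set `K`: stability on every open set whose closure is
compact and contained in `ℝ^N \ K`. -/
def HLEStableOutside {N : ℕ} (p q a b : ℝ) (u v : Euc N → ℝ) (K : Set (Euc N)) : Prop :=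
  IsCompact K ∧
    ∀ Ω : Set (Euc N), IsOpen Ω → IsCompact (closure Ω) → closure Ω ⊆ Kᶜ →
      HLEStableOn p q a b u v Ω

/-- `(u, v)` solves the Lane–Emden system `-Δu = |v|^{p-1} v`, `-Δv = |u|^{q-1} u` on `ℝ^N`. -/
def IsLESol {N : ℕ} (p q : ℝ) (u v : Euc N → ℝ) : Prop :=
  (∀ x : Euc N, -lap u x = |v x| ^ (p - 1) * v x) ∧
  (∀ x : Euc N, -lap v x = |u x| ^ (q - 1) * u x)

/-- Stability of a (positive) solution of the Lane–Emden system on an open set `Ω`. -/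
def LEStableOn {N : ℕ} (p q : ℝ) (u v : Euc N → ℝ) (Ω : Set (Euc N)) : Prop :=
  ∃ ξ ζ : Euc N → ℝ, ContDiffOn ℝ 2 ξ Ω ∧ ContDiffOn ℝ 2 ζ Ω ∧
    (∀ x ∈ Ω, 0 < ξ x) ∧ (∀ x ∈ Ω, 0 < ζ x) ∧
    (∀ x ∈ Ω, p * v x ^ (p - 1) * ζ x ≤ -lap ξ x) ∧
    (∀ x ∈ Ω, q * u x ^ (q - 1) * ξ x ≤ -lap ζ x)

/-- A function on `ℝ^N` is polynomially bounded. -/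
def PolyBounded {N : ℕ} (w : Euc N → ℝ) : Prop :=
  ∃ K L R : ℝ, 0 < K ∧ 0 < L ∧ ∀ x : Euc N, R ≤ ‖x‖ → |w x| ≤ K * ‖x‖ ^ L

/-- The polynomial `G` from Theorem 1.4 (iii). -/
def Gpoly (p q x : ℝ) : ℝ :=
  x ^ 4 - (4 * p * q * (q + 1) / (p + 1)) * x ^ 2 +
    (2 * p * q * (q + 1) * (p + q + 2) / (p + 1) ^ 2) * x -
    p * q * (q + 1) ^ 2 / (p + 1) ^ 2

open Filter Topology

/-- The `i`-th partial derivative. -/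
def pd {N : ℕ} (i : Fin N) (f : Euc N → ℝ) (x : Euc N) : ℝ :=
  fderiv ℝ f x (EuclideanSpace.single i 1)

section PartialDerivatives

variable {N : ℕ} {f g : Euc N → ℝ} {x : Euc N} {Ω K : Set (Euc N)} (i j : Fin N)

lemma pd_mul (hf : DifferentiableAt ℝ f x) (hg : DifferentiableAt ℝ g x) :
    pd i (fun y => f y * g y) x = pd i f x * g x + f x * pd i g x := by
  simp only [pd]
  rw [fderiv_fun_mul hf hg]
  simp [mul_comm, add_comm]

lemma pd_add (hf : DifferentiableAt ℝ f x) (hg : DifferentiableAt ℝ g x) :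
    pd i (fun y => f y + g y) x = pd i f x + pd i g x := by
  simp only [pd]
  rw [fderiv_fun_add hf hg]
  simp

lemma pd_sub (hf : DifferentiableAt ℝ f x) (hg : DifferentiableAt ℝ g x) :
    pd i (fun y => f y - g y) x = pd i f x - pd i g x := by
  simp only [pd]
  rw [fderiv_fun_sub hf hg]
  simp

lemma pd_const_mul (c : ℝ) (hf : DifferentiableAt ℝ f x) :
    pd i (fun y => c * f y) x = c * pd i f x := by
  simp only [pd]
  rw [fderiv_const_mul hf]
  simp

lemma pd_comp {h : ℝ → ℝ} {h' : ℝ} (hh : HasDerivAt h h' (f x)) (hf : DifferentiableAt ℝ f x) :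
    pd i (fun y => h (f y)) x = h' * pd i f x := by
  have : fderiv ℝ (fun y => h (f y)) x = h' • fderiv ℝ f x :=
    (hh.comp_hasFDerivAt x hf.hasFDerivAt).fderiv
  simp [pd, this]

lemma pd_rpow (c : ℝ) (hf : DifferentiableAt ℝ f x) (h0 : f x ≠ 0) :
    pd i (fun y => f y ^ c) x = c * f x ^ (c - 1) * pd i f x :=
  pd_comp i (Real.hasDerivAt_rpow_const (Or.inl h0)) hf

lemma pd_congr (h : f =ᶠ[𝓝 x] g) : pd i f x = pd i g x := by
  simp only [pd, h.fderiv_eq]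

lemma pd_coord : pd i (fun y : Euc N => y j) x = if i = j then 1 else 0 := by
  have : fderiv ℝ (fun y : Euc N => y j) x = EuclideanSpace.proj j :=
    (EuclideanSpace.proj (𝕜 := ℝ) j).fderiv
  simp [pd, this, eq_comm]

lemma differentiableAt_coord : DifferentiableAt ℝ (fun y : Euc N => y j) x :=
  (EuclideanSpace.proj (𝕜 := ℝ) j).differentiableAt

lemma pd_norm_sq : pd i (fun y : Euc N => ‖y‖ ^ 2) x = 2 * x i := by
  simp only [pd]
  rw [fderiv_norm_sq_apply]
  simp [EuclideanSpace.inner_single_right]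

lemma pd_comp_smul (c : ℝ) : pd i (fun y => f (c • y)) x = c * pd i f (c • x) := by
  simp only [pd]
  rw [fderiv_comp_smul]
  simp

lemma contDiffOn_pd {n : ℕ} (hΩ : IsOpen Ω) (hf : ContDiffOn ℝ (n + 1) f Ω) :
    ContDiffOn ℝ n (pd i f) Ω :=
  (hf.fderiv_of_isOpen hΩ le_rfl).clm_apply contDiffOn_const

lemma contDiffOn_pd_one (hΩ : IsOpen Ω) (hf : ContDiffOn ℝ 2 f Ω) :
    ContDiffOn ℝ 1 (pd i f) Ω :=
  contDiffOn_pd (n := 1) i hΩ (by simpa [one_add_one_eq_two] using hf)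

lemma continuousOn_pd (hΩ : IsOpen Ω) (hf : ContDiffOn ℝ 1 f Ω) :
    ContinuousOn (pd i f) Ω :=
  (contDiffOn_pd (n := 0) i hΩ (by simpa using hf)).continuousOn

lemma diffAt_of_contDiffOn (hΩ : IsOpen Ω) (hf : ContDiffOn ℝ 1 f Ω) (hx : x ∈ Ω) :
    DifferentiableAt ℝ f x :=
  (hf.contDiffAt (hΩ.mem_nhds hx)).differentiableAt one_ne_zero

lemma lap_eq_sum (hΩ : IsOpen Ω) (hf : ContDiffOn ℝ 2 f Ω) (hx : x ∈ Ω) :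
    lap f x = ∑ i, pd i (pd i f) x := by
  simp only [lap]
  refine Finset.sum_congr rfl fun i _ => ?_
  rw [iteratedFDeriv_two_apply]
  have h1 : DifferentiableAt ℝ (fderiv ℝ f) x :=
    ((hf.fderiv_of_isOpen hΩ (m := 1) (by simp [one_add_one_eq_two])).contDiffAt
      (hΩ.mem_nhds hx)).differentiableAt one_ne_zero
  have : pd i (pd i f) x =
      fderiv ℝ (fun y => fderiv ℝ f y (EuclideanSpace.single i 1)) x
        (EuclideanSpace.single i 1) := rfl
  rw [this, fderiv_clm_apply h1 (differentiableAt_const _)]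
  simp

lemma pd_pd_comm (hΩ : IsOpen Ω) (hf : ContDiffOn ℝ 2 f Ω) (hx : x ∈ Ω) :
    pd i (pd j f) x = pd j (pd i f) x := by
  have h1 : DifferentiableAt ℝ (fderiv ℝ f) x :=
    ((hf.fderiv_of_isOpen hΩ (m := 1) (by simp [one_add_one_eq_two])).contDiffAt
      (hΩ.mem_nhds hx)).differentiableAt one_ne_zero
  have key : ∀ i j : Fin N, pd i (pd j f) x =
      fderiv ℝ (fderiv ℝ f) x (EuclideanSpace.single i 1) (EuclideanSpace.single j 1) := by
    intro i j
    have : pd i (pd j f) x =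
      fderiv ℝ (fun y => fderiv ℝ f y (EuclideanSpace.single j 1)) x
        (EuclideanSpace.single i 1) := rfl
    rw [this, fderiv_clm_apply h1 (differentiableAt_const _)]
    simp
  rw [key, key]
  exact ((hf.contDiffAt (hΩ.mem_nhds hx)).isSymmSndFDerivAt (by simp)).eq _ _

lemma lap_continuousOn (hΩ : IsOpen Ω) (hf : ContDiffOn ℝ 2 f Ω) : ContinuousOn (lap f) Ω := by
  refine ContinuousOn.congr (f := fun x => ∑ i, pd i (pd i f) x) ?_
    fun x hx => lap_eq_sum hΩ hf hx
  exact continuousOn_finsetSum _ fun i _ => continuousOn_pd i hΩ (contDiffOn_pd_one i hΩ hf)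

lemma lap_mul (hΩ : IsOpen Ω) (hf : ContDiffOn ℝ 2 f Ω) (hg : ContDiffOn ℝ 2 g Ω) (hx : x ∈ Ω) :
    lap (fun y => f y * g y) x =
      f x * lap g x + g x * lap f x + 2 * ∑ i, pd i f x * pd i g x := by
  have d : ∀ {h : Euc N → ℝ}, ContDiffOn ℝ 2 h Ω → ∀ y ∈ Ω, DifferentiableAt ℝ h y :=
    fun hh y hy => diffAt_of_contDiffOn hΩ (hh.of_le one_le_two) hy
  have d' : ∀ {h : Euc N → ℝ} (i), ContDiffOn ℝ 2 h Ω → DifferentiableAt ℝ (pd i h) x :=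
    fun i hh => diffAt_of_contDiffOn hΩ (contDiffOn_pd_one i hΩ hh) hx
  rw [lap_eq_sum hΩ (hf.mul hg) hx, lap_eq_sum hΩ hf hx, lap_eq_sum hΩ hg hx,
    Finset.mul_sum, Finset.mul_sum, Finset.mul_sum, ← Finset.sum_add_distrib,
    ← Finset.sum_add_distrib]
  refine Finset.sum_congr rfl fun i _ => ?_
  have : pd i (fun y => f y * g y) =ᶠ[𝓝 x] fun y => pd i f y * g y + f y * pd i g y := by
    filter_upwards [hΩ.mem_nhds hx] with y hy using pd_mul i (d hf y hy) (d hg y hy)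
  rw [pd_congr i this, pd_add i ((d' i hf).fun_mul (d hg x hx)) ((d hf x hx).fun_mul (d' i hg)),
    pd_mul i (d' i hf) (d hg x hx), pd_mul i (d hf x hx) (d' i hg)]
  ring

lemma lap_comp {h h' : ℝ → ℝ} {h'' : ℝ} (hΩ : IsOpen Ω) (hf : ContDiffOn ℝ 2 f Ω)
    (hhf : ContDiffOn ℝ 2 (fun y => h (f y)) Ω)
    (hh : ∀ y ∈ Ω, HasDerivAt h (h' (f y)) (f y)) (hx : x ∈ Ω)
    (hh' : HasDerivAt h' h'' (f x)) :
    lap (fun y => h (f y)) x = h' (f x) * lap f x + h'' * ∑ i, pd i f x ^ 2 := by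
  have d : ∀ y ∈ Ω, DifferentiableAt ℝ f y :=
    fun y hy => diffAt_of_contDiffOn hΩ (hf.of_le one_le_two) hy
  have d' : ∀ i, DifferentiableAt ℝ (pd i f) x :=
    fun i => diffAt_of_contDiffOn hΩ (contDiffOn_pd_one i hΩ hf) hx
  rw [lap_eq_sum hΩ hhf hx, lap_eq_sum hΩ hf hx, Finset.mul_sum, Finset.mul_sum,
    ← Finset.sum_add_distrib]
  refine Finset.sum_congr rfl fun i _ => ?_
  have e : pd i (fun y => h (f y)) =ᶠ[𝓝 x] fun y => h' (f y) * pd i f y := by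
    filter_upwards [hΩ.mem_nhds hx] with y hy using pd_comp i (hh y hy) (d y hy)
  have dd : DifferentiableAt ℝ (fun y => h' (f y)) x :=
    (hh'.comp_hasFDerivAt x (d x hx).hasFDerivAt).differentiableAt
  rw [pd_congr i e, pd_mul i dd (d' i), pd_comp i hh' (d x hx)]
  ring

lemma lap_rpow (c : ℝ) (hΩ : IsOpen Ω) (hf : ContDiffOn ℝ 2 f Ω) (hpos : ∀ y ∈ Ω, 0 < f y)
    (hx : x ∈ Ω) :
    lap (fun y => f y ^ c) x =
      c * f x ^ (c - 1) * lap f x + c * (c - 1) * f x ^ (c - 2) * ∑ i, pd i f x ^ 2 := by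
  have := lap_comp (h := fun s => s ^ c) (h' := fun s => c * s ^ (c - 1))
    (h'' := c * ((c - 1) * f x ^ (c - 1 - 1))) hΩ hf
    (hf.rpow_const_of_ne fun y hy => (hpos y hy).ne')
    (fun y hy => Real.hasDerivAt_rpow_const (Or.inl (hpos y hy).ne')) hx
    ((Real.hasDerivAt_rpow_const (Or.inl (hpos x hx).ne')).const_mul c)
  rw [this, show c - 1 - 1 = c - 2 by ring]
  ring

lemma lap_add (hΩ : IsOpen Ω) (hf : ContDiffOn ℝ 2 f Ω) (hg : ContDiffOn ℝ 2 g Ω) (hx : x ∈ Ω) :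
    lap (fun y => f y + g y) x = lap f x + lap g x := by
  rw [lap_eq_sum hΩ (hf.add hg) hx, lap_eq_sum hΩ hf hx, lap_eq_sum hΩ hg hx,
    ← Finset.sum_add_distrib]
  refine Finset.sum_congr rfl fun i _ => ?_
  have : pd i (fun y => f y + g y) =ᶠ[𝓝 x] fun y => pd i f y + pd i g y := by
    filter_upwards [hΩ.mem_nhds hx] with y hy using
      pd_add i (diffAt_of_contDiffOn hΩ (hf.of_le one_le_two) hy)
        (diffAt_of_contDiffOn hΩ (hg.of_le one_le_two) hy)
  rw [pd_congr i this, pd_add i (diffAt_of_contDiffOn hΩ (contDiffOn_pd_one i hΩ hf) hx)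
    (diffAt_of_contDiffOn hΩ (contDiffOn_pd_one i hΩ hg) hx)]

lemma pd_const (c : ℝ) : pd i (fun _ : Euc N => c) x = 0 := by
  simp [pd]

lemma lap_const (c : ℝ) : lap (fun _ : Euc N => c) x = 0 := by
  have : ∀ i : Fin N, pd i (fun _ : Euc N => c) = fun _ => 0 := fun i => by
    ext; simp [pd]
  rw [lap_eq_sum isOpen_univ contDiffOn_const (mem_univ x)]
  simp [this, pd_const]

lemma lap_const_mul (c : ℝ) (hΩ : IsOpen Ω) (hf : ContDiffOn ℝ 2 f Ω) (hx : x ∈ Ω) :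
    lap (fun y => c * f y) x = c * lap f x := by
  rw [lap_mul hΩ contDiffOn_const hf hx]
  simp [lap_const, pd_const]

lemma lap_sub (hΩ : IsOpen Ω) (hf : ContDiffOn ℝ 2 f Ω) (hg : ContDiffOn ℝ 2 g Ω) (hx : x ∈ Ω) :
    lap (fun y => f y - g y) x = lap f x - lap g x := by
  have h := lap_add hΩ hf (contDiffOn_const.mul hg : ContDiffOn ℝ 2 (fun y => (-1) * g y) Ω) hx
  rw [lap_const_mul _ hΩ hg hx] at h
  rw [sub_eq_add_neg, ← neg_one_mul, ← h]
  congr 1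
  ext y
  ring

lemma lap_norm_sq : lap (fun y : Euc N => ‖y‖ ^ 2) x = 2 * N := by
  have h : ∀ i : Fin N, pd i (fun y : Euc N => ‖y‖ ^ 2) = fun y => 2 * y i :=
    fun i => funext fun y => pd_norm_sq i
  rw [lap_eq_sum isOpen_univ (contDiff_norm_sq ℝ).contDiffOn (mem_univ x)]
  simp only [h, pd_const_mul _ _ (differentiableAt_coord _), pd_coord]
  simp [mul_comm]

lemma lap_comp_smul (c : ℝ) (hΩ : IsOpen Ω) (hf : ContDiffOn ℝ 2 f Ω) (hx : c • x ∈ Ω) :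
    lap (fun y => f (c • y)) x = c ^ 2 * lap f (c • x) := by
  have hΩ' : IsOpen ((fun y : Euc N => c • y) ⁻¹' Ω) := hΩ.preimage (continuous_const_smul c)
  have hf' : ContDiffOn ℝ 2 (fun y => f (c • y)) ((fun y : Euc N => c • y) ⁻¹' Ω) :=
    hf.comp (contDiff_const_smul c).contDiffOn fun y hy => hy
  rw [lap_eq_sum hΩ' hf' hx, lap_eq_sum hΩ hf hx, Finset.mul_sum]
  refine Finset.sum_congr rfl fun i _ => ?_
  have : pd i (fun y => f (c • y)) = fun y => c * pd i f (c • y) :=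
    funext fun y => pd_comp_smul i c
  have d : DifferentiableAt ℝ (fun y => pd i f (c • y)) x := by
    have h1 := diffAt_of_contDiffOn hΩ (contDiffOn_pd_one i hΩ hf) hx
    exact h1.comp x (differentiableAt_id.const_smul c)
  rw [this, pd_const_mul i c d, pd_comp_smul]
  ring

lemma sum_coord_sq : ∑ i, x i ^ 2 = ‖x‖ ^ 2 := (EuclideanSpace.real_norm_sq_eq x).symm

lemma pd_eq_zero_of_notMem (hK : IsClosed K) (h : ∀ y ∉ K, f y = 0) (hx : x ∉ K) :
    pd i f x = 0 := by
  have : f =ᶠ[𝓝 x] fun _ => (0 : ℝ) := by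
    filter_upwards [hK.isOpen_compl.mem_nhds hx] with y hy using h y hy
  rw [pd_congr i this, pd_const]

end PartialDerivatives

section IntegrationByParts

variable {N : ℕ} {Ω K : Set (Euc N)}

lemma contDiff_of_contDiffOn_of_eq_zero {f : Euc N → ℝ} {n : WithTop ℕ∞} (hΩ : IsOpen Ω)
    (hK : IsClosed K) (hKΩ : K ⊆ Ω) (hf : ContDiffOn ℝ n f Ω) (h0 : ∀ x ∉ K, f x = 0) :
    ContDiff ℝ n f := by
  rw [contDiff_iff_contDiffAt]
  intro x
  by_cases hx : x ∈ K
  · exact hf.contDiffAt (hΩ.mem_nhds (hKΩ hx))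
  · have : f =ᶠ[𝓝 x] fun _ => (0 : ℝ) := by
      filter_upwards [hK.isOpen_compl.mem_nhds hx] with y hy using h0 y hy
    exact contDiffAt_const.congr_of_eventuallyEq this

lemma continuous_pd {f : Euc N → ℝ} (i : Fin N) (hf : ContDiff ℝ 1 f) : Continuous (pd i f) :=
  (hf.continuous_fderiv one_ne_zero).clm_apply continuous_const

lemma integral_mul_pd {f φ : Euc N → ℝ} (i : Fin N) (hf : ContDiff ℝ 1 f) (hφ : ContDiff ℝ 1 φ)
    (hc : HasCompactSupport φ) : ∫ x, f x * pd i φ x = -∫ x, pd i f x * φ x := by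
  have hc' : HasCompactSupport (pd i φ) := hc.fderiv_apply ℝ _
  refine integral_mul_fderiv_eq_neg_fderiv_mul_of_integrable ?_ ?_ ?_ ?_ ?_
  · exact ((continuous_pd i hf).mul hφ.continuous).integrable_of_hasCompactSupport hc.mul_left
  · exact (hf.continuous.mul (continuous_pd i hφ)).integrable_of_hasCompactSupport hc'.mul_left
  · exact (hf.continuous.mul hφ.continuous).integrable_of_hasCompactSupport hc.mul_left
  · exact fun x _ => hf.differentiable one_ne_zero x
  · exact fun x _ => hφ.differentiable one_ne_zero x

lemma setIntegral_pd_eq_zero {f : Euc N → ℝ} (i : Fin N) (hΩ : IsOpen Ω) (hK : IsCompact K)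
    (hKΩ : K ⊆ Ω) (hf : ContDiffOn ℝ 1 f Ω) (h0 : ∀ x ∉ K, f x = 0) :
    ∫ x in K, pd i f x = 0 := by
  have hf' := contDiff_of_contDiffOn_of_eq_zero hΩ hK.isClosed hKΩ hf h0
  have hc : HasCompactSupport f := HasCompactSupport.intro hK h0
  have h := integral_mul_pd i (contDiff_const (c := (1 : ℝ))) hf' hc
  simp only [pd_const, zero_mul, integral_zero, neg_zero, one_mul] at h
  rw [setIntegral_eq_integral_of_forall_compl_eq_zero, h]
  exact fun x hx => pd_eq_zero_of_notMem i hK.isClosed h0 hx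

lemma integral_pd_mul_pd_comm {f φ : Euc N → ℝ} (i j : Fin N) (hf : ContDiff ℝ 1 f)
    (hφ : ContDiff ℝ 1 φ) (hcf : HasCompactSupport f) (hc : HasCompactSupport φ) :
    ∫ x, pd i φ x * pd j f x = ∫ x, pd i f x * pd j φ x := by
  obtain ⟨C, hC⟩ := ContDiff.lipschitzWith_of_hasCompactSupport hcf hf one_ne_zero
  obtain ⟨D, hD⟩ := ContDiff.lipschitzWith_of_hasCompactSupport hc hφ one_ne_zero
  set e : Euc N := EuclideanSpace.single i 1 with he
  have hle : ∀ {g : Euc N → ℝ}, ContDiff ℝ 1 g → ∀ x, lineDeriv ℝ g x e = pd i g x :=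
    fun hg x => (hg.differentiable one_ne_zero x).lineDeriv_eq_fderiv
  have hle' : ∀ {g : Euc N → ℝ}, ContDiff ℝ 1 g → ∀ x, lineDeriv ℝ g x (-e) = -pd i g x :=
    fun hg x => by rw [(hg.differentiable one_ne_zero x).lineDeriv_eq_fderiv, map_neg]; rfl
  have hcf' : HasCompactSupport (pd j f) := hcf.fderiv_apply ℝ _
  have hc' : HasCompactSupport (pd j φ) := hc.fderiv_apply ℝ _
  have h1 := hD.integral_inv_smul_sub_mul_tendsto_integral_lineDeriv_mul (μ := volume)
    ((continuous_pd j hf).integrable_of_hasCompactSupport hcf') e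
  have h2 := hC.integral_inv_smul_sub_mul_tendsto_integral_lineDeriv_mul (μ := volume)
    ((continuous_pd j hφ).integrable_of_hasCompactSupport hc') (-e)
  simp only [hle hφ] at h1
  simp only [hle' hf] at h2
  have key : ∀ t : ℝ, ∫ x, (t⁻¹ • (φ (x + t • e) - φ x)) * pd j f x =
      -∫ x, (t⁻¹ • (f (x + t • -e) - f x)) * pd j φ x := by
    intro t
    have e1 : ∫ x, φ x * pd j f x = -∫ x, f x * pd j φ x := by
      rw [integral_mul_pd j hφ hf hcf]
      simp only [mul_comm]
    have hfs : ContDiff ℝ 1 fun x => f (x + t • -e) := hf.comp (contDiff_id.add contDiff_const)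
    have hpd : ∀ x, pd j (fun x => f (x + t • -e)) x = pd j f (x + t • -e) := fun x => by
      simp only [pd, fderiv_comp_add_right]
    have e2 : ∫ x, φ (x + t • e) * pd j f x = -∫ x, f (x + t • -e) * pd j φ x := by
      rw [← integral_add_right_eq_self _ (t • -e), integral_mul_pd j hfs hφ hc, neg_neg]
      refine integral_congr_ae (Eventually.of_forall fun x => ?_)
      simp only [hpd]
      rw [mul_comm]
      congr 2
      module
    have s1 : Integrable fun x => φ (x + t • e) * pd j f x :=
      (by fun_prop (disch := exact hφ.continuous) : Continuous fun x => φ (x + t • e)).mul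
        (continuous_pd j hf) |>.integrable_of_hasCompactSupport hcf'.mul_left
    have s2 : Integrable fun x => φ x * pd j f x :=
      (hφ.continuous.mul (continuous_pd j hf)).integrable_of_hasCompactSupport hcf'.mul_left
    have s3 : Integrable fun x => f (x + t • -e) * pd j φ x :=
      (hfs.continuous.mul (continuous_pd j hφ)).integrable_of_hasCompactSupport hc'.mul_left
    have s4 : Integrable fun x => f x * pd j φ x :=
      (hf.continuous.mul (continuous_pd j hφ)).integrable_of_hasCompactSupport hc'.mul_left
    simp only [smul_eq_mul, mul_assoc, integral_const_mul, sub_mul]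
    rw [integral_sub s1 s2, integral_sub s3 s4, e1, e2]
    ring
  simp only [key] at h1
  have h3 := tendsto_nhds_unique h1 h2.neg
  simpa [integral_neg] using h3

/-- Second derivatives commute in the weak sense. -/
lemma setIntegral_pd_mul_pd_comm {f φ : Euc N → ℝ} (i j : Fin N) (hΩ : IsOpen Ω)
    (hK : IsCompact K) (hKΩ : K ⊆ Ω) (hf : ContDiffOn ℝ 1 f Ω) (hφ : ContDiffOn ℝ 1 φ Ω)
    (h0 : ∀ x ∉ K, φ x = 0) :
    ∫ x in K, pd i φ x * pd j f x = ∫ x in K, pd i f x * pd j φ x := by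
  obtain ⟨L, hL, hKL, hLΩ⟩ := exists_compact_between hK hΩ hKΩ
  obtain ⟨χ, h1, hz, -⟩ := exists_contMDiffMap_one_nhds_of_subset_interior (n := 1)
    (modelWithCornersSelf ℝ (Euc N)) hK.isClosed hKL
  have hχ : ContDiff ℝ 1 χ := χ.contMDiff.contDiff
  have hχf : ContDiff ℝ 1 fun x => χ x * f x :=
    contDiff_of_contDiffOn_of_eq_zero hΩ hL.isClosed hLΩ (hχ.contDiffOn.mul hf)
      fun x hx => by simp [hz x hx]
  have hφ' := contDiff_of_contDiffOn_of_eq_zero hΩ hK.isClosed hKΩ hφ h0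
  have h := integral_pd_mul_pd_comm i j hχf hφ'
    (HasCompactSupport.intro hL fun x hx => by simp [hz x hx]) (HasCompactSupport.intro hK h0)
  have hx0 : ∀ i, ∀ x ∉ K, pd i φ x = 0 := fun i x hx => pd_eq_zero_of_notMem i hK.isClosed h0 hx
  have hpd : ∀ i, ∀ x ∈ K, pd i (fun x => χ x * f x) x = pd i f x := fun i x hx => by
    refine pd_congr i ?_
    filter_upwards [(eventually_nhdsSet_iff_forall.1 h1) x hx] with y hy
    simp [hy]
  have e1 : ∫ x in K, pd i φ x * pd j (fun x => χ x * f x) x =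
      ∫ x, pd i φ x * pd j (fun x => χ x * f x) x :=
    setIntegral_eq_integral_of_forall_compl_eq_zero fun x hx => by rw [hx0 i x hx, zero_mul]
  have e2 : ∫ x in K, pd i (fun x => χ x * f x) x * pd j φ x =
      ∫ x, pd i (fun x => χ x * f x) x * pd j φ x :=
    setIntegral_eq_integral_of_forall_compl_eq_zero fun x hx => by rw [hx0 j x hx, mul_zero]
  rw [← e1, ← e2] at h
  have e3 : ∫ x in K, pd i φ x * pd j f x = ∫ x in K, pd i φ x * pd j (fun x => χ x * f x) x :=
    setIntegral_congr_fun hK.measurableSet fun x hx => by simp only [hpd j x hx]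
  have e4 : ∫ x in K, pd i f x * pd j φ x = ∫ x in K, pd i (fun x => χ x * f x) x * pd j φ x :=
    setIntegral_congr_fun hK.measurableSet fun x hx => by simp only [hpd i x hx]
  rw [e3, e4, h]

end IntegrationByParts

section GradientProduct

variable {N : ℕ} {f g h : Euc N → ℝ} {x : Euc N} {Ω K : Set (Euc N)}

/-- The pointwise inner product of the gradients of two functions. -/
def gdot (f g : Euc N → ℝ) (x : Euc N) : ℝ := ∑ i, pd i f x * pd i g x

lemma gdot_comm (f g : Euc N → ℝ) (x : Euc N) : gdot f g x = gdot g f x :=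
  Finset.sum_congr rfl fun _ _ => mul_comm _ _

lemma gdot_self_nonneg (f : Euc N → ℝ) (x : Euc N) : 0 ≤ gdot f f x :=
  Finset.sum_nonneg fun _ _ => mul_self_nonneg _

lemma gdot_mul (hf : DifferentiableAt ℝ f x) (hg : DifferentiableAt ℝ g x) :
    gdot (fun y => f y * g y) h x = f x * gdot g h x + g x * gdot f h x := by
  simp only [gdot, pd_mul _ hf hg, Finset.mul_sum, ← Finset.sum_add_distrib]
  exact Finset.sum_congr rfl fun _ _ => by ring

lemma gdot_comp {F : ℝ → ℝ} {F' : ℝ} (hF : HasDerivAt F F' (f x)) (hf : DifferentiableAt ℝ f x) :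
    gdot (fun y => F (f y)) h x = F' * gdot f h x := by
  simp only [gdot, pd_comp _ hF hf, Finset.mul_sum]
  exact Finset.sum_congr rfl fun _ _ => by ring

lemma gdot_rpow (c : ℝ) (hf : DifferentiableAt ℝ f x) (h0 : f x ≠ 0) :
    gdot (fun y => f y ^ c) h x = c * f x ^ (c - 1) * gdot f h x :=
  gdot_comp (F := fun t => t ^ c) (Real.hasDerivAt_rpow_const (Or.inl h0)) hf

lemma gdot_pow (n : ℕ) (hf : DifferentiableAt ℝ f x) :
    gdot (fun y => f y ^ n) h x = n * f x ^ (n - 1) * gdot f h x :=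
  gdot_comp (F := fun t => t ^ n) (hasDerivAt_pow n (f x)) hf

lemma gdot_sq_le (f g : Euc N → ℝ) (x : Euc N) :
    gdot f g x ^ 2 ≤ gdot f f x * gdot g g x := by
  have := Finset.sum_mul_sq_le_sq_mul_sq Finset.univ (fun i => pd i f x) fun i => pd i g x
  simpa only [gdot, sq] using this

lemma pd_sq_le_gdot (i : Fin N) (f : Euc N → ℝ) (x : Euc N) : pd i f x ^ 2 ≤ gdot f f x := by
  have := Finset.single_le_sum (f := fun i => pd i f x * pd i f x)
    (fun i _ => mul_self_nonneg _) (Finset.mem_univ i)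
  simpa only [gdot, sq] using this

lemma gdot_congr_left {f' : Euc N → ℝ} (h' : f =ᶠ[𝓝 x] f') : gdot f g x = gdot f' g x := by
  simp only [gdot, pd_congr _ h']

lemma gdot_continuousOn (hΩ : IsOpen Ω) (hf : ContDiffOn ℝ 1 f Ω) (hg : ContDiffOn ℝ 1 g Ω) :
    ContinuousOn (gdot f g) Ω :=
  continuousOn_finsetSum _ fun i _ => (continuousOn_pd i hΩ hf).mul (continuousOn_pd i hΩ hg)

lemma sum_pd_mul_pd (hΩ : IsOpen Ω) (hf : ContDiffOn ℝ 1 f Ω) (hg : ContDiffOn ℝ 2 g Ω)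
    (hx : x ∈ Ω) : ∑ i, pd i (fun y => f y * pd i g y) x = gdot f g x + f x * lap g x := by
  rw [lap_eq_sum hΩ hg hx, gdot, Finset.mul_sum, ← Finset.sum_add_distrib]
  refine Finset.sum_congr rfl fun i _ => ?_
  rw [pd_mul i (diffAt_of_contDiffOn hΩ hf hx)
    (diffAt_of_contDiffOn hΩ (contDiffOn_pd_one i hΩ hg) hx)]

lemma lap_mul' (hΩ : IsOpen Ω) (hf : ContDiffOn ℝ 2 f Ω) (hg : ContDiffOn ℝ 2 g Ω) (hx : x ∈ Ω) :
    lap (fun y => f y * g y) x = f x * lap g x + 2 * gdot f g x + g x * lap f x := by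
  rw [lap_mul hΩ hf hg hx]; simp only [gdot]; ring

end GradientProduct

section NullOn

variable {N : ℕ} {Ω K : Set (Euc N)} {D E A B : Euc N → ℝ}

/-- `D` is continuous on `K` with vanishing integral; typically a compactly supported divergence. -/
def NullOn (K : Set (Euc N)) (D : Euc N → ℝ) : Prop := ContinuousOn D K ∧ ∫ x in K, D x = 0

lemma NullOn.add (hK : IsCompact K) (hD : NullOn K D) (hE : NullOn K E) :
    NullOn K fun x => D x + E x :=
  ⟨hD.1.add hE.1, by
    rw [integral_add (hD.1.integrableOn_compact hK) (hE.1.integrableOn_compact hK), hD.2, hE.2,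
      add_zero]⟩

lemma NullOn.const_mul (c : ℝ) (hD : NullOn K D) : NullOn K fun x => c * D x :=
  ⟨hD.1.const_mul c, by rw [integral_const_mul, hD.2, mul_zero]⟩

lemma NullOn.sum {ι : Type*} (s : Finset ι) {D : ι → Euc N → ℝ} (hK : IsCompact K)
    (hD : ∀ i, NullOn K (D i)) : NullOn K fun x => ∑ i ∈ s, D i x :=
  ⟨continuousOn_finsetSum _ fun i _ => (hD i).1, by
    rw [integral_finsetSum _ fun i _ => (hD i).1.integrableOn_compact hK]
    exact Finset.sum_eq_zero fun i _ => (hD i).2⟩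

lemma NullOn.le (hK : IsCompact K) (hD : NullOn K D) (hA : ContinuousOn A K)
    (hB : ContinuousOn B K) (hle : ∀ x ∈ K, A x ≤ B x + D x) :
    ∫ x in K, A x ≤ ∫ x in K, B x := by
  have h := setIntegral_mono_on (hA.integrableOn_compact hK (μ := volume))
    ((hB.add hD.1).integrableOn_compact hK) hK.measurableSet hle
  have h' : ∫ x in K, (B + D) x = (∫ x in K, B x) + ∫ x in K, D x :=
    integral_add (hB.integrableOn_compact hK) (hD.1.integrableOn_compact hK)
  rw [h', hD.2, add_zero] at h
  exact h

lemma nullOn_pd {f : Euc N → ℝ} (i : Fin N) (hΩ : IsOpen Ω) (hK : IsCompact K)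
    (hKΩ : K ⊆ Ω) (hf : ContDiffOn ℝ 1 f Ω) (h0 : ∀ x ∉ K, f x = 0) : NullOn K (pd i f) :=
  ⟨(continuousOn_pd i hΩ hf).mono hKΩ, setIntegral_pd_eq_zero i hΩ hK hKΩ hf h0⟩

lemma NullOn.congr (hK : IsCompact K) (hD : NullOn K D) (h : ∀ x ∈ K, E x = D x) : NullOn K E :=
  ⟨hD.1.congr h, by rw [setIntegral_congr_fun hK.measurableSet h, hD.2]⟩

/-- The divergence of `f ∇g`, if one of the factors is supported in `K`. -/
lemma nullOn_div {f g : Euc N → ℝ} (hΩ : IsOpen Ω) (hK : IsCompact K) (hKΩ : K ⊆ Ω)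
    (hf : ContDiffOn ℝ 1 f Ω) (hg : ContDiffOn ℝ 2 g Ω)
    (h0 : (∀ x ∉ K, f x = 0) ∨ ∀ x ∉ K, g x = 0) :
    NullOn K fun x => gdot f g x + f x * lap g x := by
  refine (NullOn.sum Finset.univ hK fun i => nullOn_pd i hΩ hK hKΩ
    (hf.mul (contDiffOn_pd_one i hΩ hg)) fun x hx => ?_).congr hK
    fun x hx => (sum_pd_mul_pd hΩ hf hg (hKΩ hx)).symm
  rcases h0 with h0 | h0
  · rw [h0 x hx, zero_mul]
  · rw [pd_eq_zero_of_notMem i hK.isClosed h0 hx, mul_zero]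

lemma nullOn_comm {f φ : Euc N → ℝ} (i j : Fin N) (hΩ : IsOpen Ω)
    (hK : IsCompact K) (hKΩ : K ⊆ Ω) (hf : ContDiffOn ℝ 1 f Ω) (hφ : ContDiffOn ℝ 1 φ Ω)
    (h0 : ∀ x ∉ K, φ x = 0) :
    NullOn K fun x => pd i φ x * pd j f x - pd i f x * pd j φ x := by
  have c1 : ∀ i j {f g : Euc N → ℝ}, ContDiffOn ℝ 1 f Ω → ContDiffOn ℝ 1 g Ω →
      ContinuousOn (fun x => pd i f x * pd j g x) K := fun i j f g hf hg =>
    ((continuousOn_pd i hΩ hf).mul (continuousOn_pd j hΩ hg)).mono hKΩ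
  refine ⟨(c1 i j hφ hf).sub (c1 i j hf hφ), ?_⟩
  rw [integral_sub ((c1 i j hφ hf).integrableOn_compact hK)
    ((c1 i j hf hφ).integrableOn_compact hK),
    setIntegral_pd_mul_pd_comm i j hΩ hK hKΩ hf hφ h0, sub_self]

end NullOn

section Cutoff

variable {N : ℕ} {K : Set (Euc N)} {θ : Euc N → ℝ}

/-- A `C²` cutoff with values in `[0, 1]` supported in `K`, with controlled derivatives. -/
structure IsCutoff (K : Set (Euc N)) (θ : Euc N → ℝ) : Prop where
  contDiff : ContDiff ℝ 2 θ
  nonneg : ∀ x, 0 ≤ θ x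
  le_one : ∀ x, θ x ≤ 1
  eq_zero : ∀ x ∉ K, θ x = 0
  bound : ∃ C, 0 ≤ C ∧ ∀ x, gdot θ θ x ≤ C ∧ |lap θ x| ≤ C

lemma lap_pow {x : Euc N} (n : ℕ) (hθ : ContDiff ℝ 2 θ) :
    lap (fun y => θ y ^ (n + 2)) x =
      (n + 2) * θ x ^ (n + 1) * lap θ x + (n + 2) * (n + 1) * θ x ^ n * gdot θ θ x := by
  have h := lap_comp (f := θ) (x := x) (h := fun t => t ^ (n + 2))
    (h' := fun t => (n + 2) * t ^ (n + 1))
    (h'' := (n + 2) * ((n + 1) * θ x ^ n)) isOpen_univ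
    hθ.contDiffOn (hθ.pow _).contDiffOn (fun y _ => by simpa using hasDerivAt_pow (n + 2) (θ y))
    (mem_univ x)
    (by simpa using (hasDerivAt_pow (n + 1) (θ x)).const_mul ((n : ℝ) + 2))
  rw [h, gdot]
  simp only [sq]
  ring

lemma lap_eq_zero_of_notMem {x : Euc N} (hK : IsClosed K) (hθ : ContDiff ℝ 2 θ)
    (h : ∀ y ∉ K, θ y = 0) (hx : x ∉ K) : lap θ x = 0 := by
  rw [lap_eq_sum isOpen_univ hθ.contDiffOn (mem_univ x)]
  exact Finset.sum_eq_zero fun i _ => pd_eq_zero_of_notMem i hK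
    (fun y hy => pd_eq_zero_of_notMem i hK h hy) hx

lemma gdot_eq_zero_of_notMem {x : Euc N} {g : Euc N → ℝ} (hK : IsClosed K)
    (h : ∀ y ∉ K, θ y = 0) (hx : x ∉ K) : gdot θ g x = 0 :=
  Finset.sum_eq_zero fun i _ => by rw [pd_eq_zero_of_notMem i hK h hx, zero_mul]

lemma IsCutoff.of_isCompact (hK : IsCompact K) (hθ : ContDiff ℝ 2 θ) (h0 : ∀ x, 0 ≤ θ x)
    (h1 : ∀ x, θ x ≤ 1) (h : ∀ x ∉ K, θ x = 0) : IsCutoff K θ := by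
  refine ⟨hθ, h0, h1, h, ?_⟩
  obtain ⟨C, hC⟩ := hK.exists_bound_of_continuousOn
    ((gdot_continuousOn isOpen_univ (hθ.of_le one_le_two).contDiffOn
      (hθ.of_le one_le_two).contDiffOn).mono (subset_univ K))
  obtain ⟨D, hD⟩ := hK.exists_bound_of_continuousOn
    ((lap_continuousOn isOpen_univ hθ.contDiffOn).mono (subset_univ K))
  refine ⟨max (max C D) 0, le_max_right _ _, fun x => ?_⟩
  by_cases hx : x ∈ K
  · exact ⟨(le_abs_self _).trans ((hC x hx).trans ((le_max_left _ _).trans (le_max_left _ _))),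
      (hD x hx).trans ((le_max_right _ _).trans (le_max_left _ _))⟩
  · rw [gdot_eq_zero_of_notMem hK.isClosed h hx, lap_eq_zero_of_notMem hK.isClosed hθ h hx]
    simp

lemma IsCutoff.pow_bound (hθ : IsCutoff K θ) (n : ℕ) : ∃ C, 0 ≤ C ∧ ∀ x,
    gdot (fun y => θ y ^ (n + 1)) (fun y => θ y ^ (n + 1)) x ≤ C * (θ x ^ n) ^ 2 ∧
      |lap (fun y => θ y ^ (n + 2)) x| ≤ C * θ x ^ n := by
  obtain ⟨C, hC, h⟩ := hθ.bound
  refine ⟨(n + 2) ^ 2 * C * 2, by positivity, fun x => ?_⟩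
  obtain ⟨h1, h2⟩ := h x
  have d : DifferentiableAt ℝ θ x := hθ.contDiff.differentiable two_ne_zero x
  have t0 := hθ.nonneg x
  have t1 := hθ.le_one x
  have tn := pow_nonneg t0 n
  constructor
  · rw [gdot_pow _ d, gdot_comm, gdot_pow _ d]
    push_cast
    have e : ((n : ℝ) + 1) * θ x ^ n * (((n : ℝ) + 1) * θ x ^ n * gdot θ θ x) =
      ((n + 1) ^ 2 * gdot θ θ x) * (θ x ^ n) ^ 2 := by ring
    rw [e]
    refine mul_le_mul_of_nonneg_right ?_ (sq_nonneg _)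
    nlinarith [mul_le_mul_of_nonneg_left h1 (by positivity : (0 : ℝ) ≤ (n + 1) ^ 2),
      mul_nonneg hC (by positivity : (0 : ℝ) ≤ n), mul_nonneg hC (by positivity : (0 : ℝ) ≤ n ^ 2)]
  · rw [lap_pow n hθ.contDiff]
    have e : θ x ^ (n + 1) ≤ θ x ^ n := pow_le_pow_of_le_one t0 t1 (Nat.le_succ n)
    have g0 := gdot_self_nonneg θ x
    have e1 : |(n + 2) * θ x ^ (n + 1) * lap θ x| ≤ (n + 2) * θ x ^ n * C := by
      rw [abs_mul, abs_of_nonneg (by positivity : (0 : ℝ) ≤ (n + 2) * θ x ^ (n + 1))]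
      gcongr
    have e2 : |(n + 2) * (n + 1) * θ x ^ n * gdot θ θ x| ≤ (n + 2) * (n + 1) * θ x ^ n * C := by
      rw [abs_of_nonneg (by positivity)]
      gcongr
    refine (abs_add_le _ _).trans ((add_le_add e1 e2).trans ?_)
    have := mul_nonneg tn hC
    nlinarith [mul_nonneg this (by positivity : (0 : ℝ) ≤ n),
      mul_nonneg this (by positivity : (0 : ℝ) ≤ n ^ 2)]

/-- A closed spherical shell. -/
def shell (N : ℕ) (r s : ℝ) : Set (Euc N) := {x | r ≤ ‖x‖ ∧ ‖x‖ ≤ s}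

lemma isCompact_shell (r s : ℝ) : IsCompact (shell N r s) :=
  (isCompact_closedBall (0 : Euc N) s).of_isClosed_subset
    ((isClosed_le continuous_const continuous_norm).inter
      (isClosed_le continuous_norm continuous_const))
    fun x hx => by simpa using hx.2

lemma isOpen_ne_zero : IsOpen {x : Euc N | x ≠ 0} := isOpen_ne

lemma shell_subset_ne_zero {r s : ℝ} (hr : 0 < r) : shell N r s ⊆ {x : Euc N | x ≠ 0} :=
  fun _ hx => norm_pos_iff.1 (hr.trans_le hx.1)

/-- A radial cutoff, equal to one for `|x|² ≤ 2` and to zero for `|x|² ≥ 3`. -/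
def ballCutoff (N : ℕ) (x : Euc N) : ℝ := Real.smoothTransition (3 - ‖x‖ ^ 2)

lemma ballCutoff_contDiff : ContDiff ℝ 2 (ballCutoff N) :=
  Real.smoothTransition.contDiff.comp (contDiff_const.sub (contDiff_norm_sq ℝ))

lemma ballCutoff_eq_one {x : Euc N} (hx : ‖x‖ ^ 2 ≤ 2) : ballCutoff N x = 1 :=
  Real.smoothTransition.one_of_one_le (by linarith)

lemma ballCutoff_eq_zero {x : Euc N} (hx : 3 ≤ ‖x‖ ^ 2) : ballCutoff N x = 0 :=
  Real.smoothTransition.zero_of_nonpos (by linarith)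

lemma ballCutoff_nonneg (x : Euc N) : 0 ≤ ballCutoff N x := Real.smoothTransition.nonneg _

lemma ballCutoff_le_one (x : Euc N) : ballCutoff N x ≤ 1 := Real.smoothTransition.le_one _

/-- A radial cutoff supported in the shell `1 ≤ |x| ≤ 2`, equal to one for `2 ≤ |x|² ≤ 3`. -/
def shellCutoff (N : ℕ) (x : Euc N) : ℝ :=
  Real.smoothTransition (‖x‖ ^ 2 - 1) * Real.smoothTransition (4 - ‖x‖ ^ 2)

lemma shellCutoff_eq_one {x : Euc N} (h : 2 ≤ ‖x‖ ^ 2) (h' : ‖x‖ ^ 2 ≤ 3) :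
    shellCutoff N x = 1 := by
  rw [shellCutoff, Real.smoothTransition.one_of_one_le (by linarith),
    Real.smoothTransition.one_of_one_le (by linarith), mul_one]

lemma shellCutoff_isCutoff : IsCutoff (shell N 1 2) (shellCutoff N) := by
  refine .of_isCompact (isCompact_shell _ _)
    ((Real.smoothTransition.contDiff.comp ((contDiff_norm_sq ℝ).sub contDiff_const)).mul
      (Real.smoothTransition.contDiff.comp (contDiff_const.sub (contDiff_norm_sq ℝ))))
    (fun x => mul_nonneg (Real.smoothTransition.nonneg _) (Real.smoothTransition.nonneg _))
    (fun x => mul_le_one₀ (Real.smoothTransition.le_one _) (Real.smoothTransition.nonneg _)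
      (Real.smoothTransition.le_one _)) fun x hx => ?_
  rw [shell, mem_ofPred_eq, not_and_or, not_le, not_le] at hx
  rcases hx with hx | hx
  · rw [shellCutoff, Real.smoothTransition.zero_of_nonpos (by nlinarith [norm_nonneg x]), zero_mul]
  · rw [shellCutoff, Real.smoothTransition.zero_of_nonpos (x := 4 - _) (by nlinarith), mul_zero]

/-- The radial cutoff at scale `R`. -/
def ballCutoffAt (N : ℕ) (R : ℝ) (x : Euc N) : ℝ := ballCutoff N (R⁻¹ • x)

lemma ballCutoffAt_contDiff (R : ℝ) : ContDiff ℝ 2 (ballCutoffAt N R) :=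
  ballCutoff_contDiff.comp (contDiff_const_smul _)

lemma pd_ballCutoffAt (i : Fin N) (R : ℝ) (x : Euc N) :
    pd i (ballCutoffAt N R) x = R⁻¹ * pd i (ballCutoff N) (R⁻¹ • x) := pd_comp_smul i _

lemma lap_ballCutoffAt (R : ℝ) (x : Euc N) :
    lap (ballCutoffAt N R) x = R⁻¹ ^ 2 * lap (ballCutoff N) (R⁻¹ • x) :=
  lap_comp_smul _ isOpen_univ ballCutoff_contDiff.contDiffOn (mem_univ _)

end Cutoff

section EnergyInequalities

variable {N : ℕ} {Ω K : Set (Euc N)}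

/-- `A ≤ B` on `K` up to a function of vanishing integral. -/
def LeMod (K : Set (Euc N)) (A B : Euc N → ℝ) : Prop :=
  ∃ D, NullOn K D ∧ ∀ x ∈ K, A x ≤ B x + D x

lemma LeMod.integral_le {A B : Euc N → ℝ} (h : LeMod K A B) (hK : IsCompact K)
    (hA : ContinuousOn A K) (hB : ContinuousOn B K) : ∫ x in K, A x ≤ ∫ x in K, B x := by
  obtain ⟨D, hD, hle⟩ := h
  exact hD.le hK hA hB hle

lemma LeMod.integral_le_const {A : Euc N → ℝ} {C : ℝ} (h : LeMod K A fun _ => C)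
    (hK : IsCompact K) (hA : ContinuousOn A K) : ∫ x in K, A x ≤ C * volume.real K := by
  refine (h.integral_le hK hA continuousOn_const).trans_eq ?_
  rw [setIntegral_const, smul_eq_mul, mul_comm]

lemma gdot_quad (f g : Euc N → ℝ) (c : ℝ) (x : Euc N) :
    0 ≤ gdot f f x - 2 * c * gdot f g x + c ^ 2 * gdot g g x := by
  have : gdot f f x - 2 * c * gdot f g x + c ^ 2 * gdot g g x =
      ∑ i, (pd i f x - c * pd i g x) ^ 2 := by
    simp only [gdot, Finset.mul_sum, ← Finset.sum_sub_distrib, ← Finset.sum_add_distrib]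
    exact Finset.sum_congr rfl fun i _ => by ring
  rw [this]
  exact Finset.sum_nonneg fun i _ => sq_nonneg _

/-- Picone's inequality. -/
lemma picone {ξ φ : Euc N → ℝ} (hΩ : IsOpen Ω) (hK : IsCompact K) (hKΩ : K ⊆ Ω)
    (hξ : ContDiffOn ℝ 2 ξ Ω) (hξ0 : ∀ x ∈ Ω, 0 < ξ x) (hφ : ContDiffOn ℝ 1 φ Ω)
    (h0 : ∀ x ∉ K, φ x = 0) :
    LeMod K (fun x => -lap ξ x / ξ x * φ x ^ 2) (gdot φ φ) := by
  have hg : ContDiffOn ℝ 1 (fun x => φ x * φ x / ξ x) Ω :=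
    (hφ.mul hφ).div (hξ.of_le one_le_two) fun x hx => (hξ0 x hx).ne'
  refine ⟨_, (nullOn_div hΩ hK hKΩ hg hξ
    (Or.inl fun x hx => by simp [h0 x hx])).const_mul (-1), fun x hx => ?_⟩
  have hxΩ := hKΩ hx
  beta_reduce
  have hpos := hξ0 x hxΩ
  have dφ := diffAt_of_contDiffOn hΩ hφ hxΩ
  have dξ := diffAt_of_contDiffOn hΩ (hξ.of_le one_le_two) hxΩ
  have dg := diffAt_of_contDiffOn hΩ hg hxΩ
  have e : gdot (fun y => (φ y * φ y / ξ y) * ξ y) ξ x = gdot (fun y => φ y * φ y) ξ x := by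
    refine gdot_congr_left ?_
    filter_upwards [hΩ.mem_nhds hxΩ] with y hy
    rw [div_mul_cancel₀ _ (hξ0 y hy).ne']
  rw [gdot_mul dg dξ, gdot_mul dφ dφ] at e
  have hq := gdot_quad φ ξ (φ x / ξ x) x
  have e' : gdot (fun x => φ x * φ x / ξ x) ξ x =
      2 * (φ x / ξ x) * gdot φ ξ x - (φ x / ξ x) ^ 2 * gdot ξ ξ x := by
    field_simp at e ⊢
    linarith
  have e2 : -lap ξ x / ξ x * φ x ^ 2 = -(φ x * φ x / ξ x * lap ξ x) := by ring
  rw [e', e2]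
  linarith

lemma two_mul_le_of_sq_le {S α β s t : ℝ} (hs : 0 < s) (ht : 0 < t) (hα : 0 ≤ α) (hβ : 0 ≤ β)
    (h : S ^ 2 ≤ α * β) : 2 * S ≤ α * t / s + β * s / t := by
  have h1 : 0 ≤ α * t / s := by positivity
  have h2 : 0 ≤ β * s / t := by positivity
  have h3 : (α * t / s) * (β * s / t) = α * β := by field_simp
  nlinarith [sq_nonneg (α * t / s - β * s / t), abs_le_of_sq_le_sq' (a := 2 * S)
    (b := α * t / s + β * s / t) (by nlinarith [sq_nonneg (α * t / s - β * s / t)]) (by positivity)]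

/-- The first stability inequality. The potentials are `P` and `Q`. -/
lemma stable_ineq {ξ ζ φ P Q S : Euc N → ℝ} (hΩ : IsOpen Ω) (hK : IsCompact K) (hKΩ : K ⊆ Ω)
    (hξ : ContDiffOn ℝ 2 ξ Ω) (hζ : ContDiffOn ℝ 2 ζ Ω)
    (hξ0 : ∀ x ∈ Ω, 0 < ξ x) (hζ0 : ∀ x ∈ Ω, 0 < ζ x)
    (hP : ∀ x ∈ Ω, 0 ≤ P x) (hQ : ∀ x ∈ Ω, 0 ≤ Q x)
    (h1 : ∀ x ∈ Ω, P x * ζ x ≤ -lap ξ x) (h2 : ∀ x ∈ Ω, Q x * ξ x ≤ -lap ζ x)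
    (hS : ∀ x ∈ Ω, S x ^ 2 ≤ P x * Q x)
    (hφ : ContDiffOn ℝ 1 φ Ω) (h0 : ∀ x ∉ K, φ x = 0) :
    LeMod K (fun x => S x * φ x ^ 2) (gdot φ φ) := by
  obtain ⟨D, hD, hd⟩ := picone hΩ hK hKΩ hξ hξ0 hφ h0
  obtain ⟨E, hE, he⟩ := picone hΩ hK hKΩ hζ hζ0 hφ h0
  refine ⟨_, (hD.add hK hE).const_mul (1 / 2), fun x hx => ?_⟩
  have hxΩ := hKΩ hx
  beta_reduce
  have p1 := hξ0 x hxΩ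
  have p2 := hζ0 x hxΩ
  have a1 : P x * ζ x / ξ x * φ x ^ 2 ≤ -lap ξ x / ξ x * φ x ^ 2 := by
    gcongr
    exact h1 x hxΩ
  have a2 : Q x * ξ x / ζ x * φ x ^ 2 ≤ -lap ζ x / ζ x * φ x ^ 2 := by
    gcongr
    exact h2 x hxΩ
  have a3 := mul_le_mul_of_nonneg_right
    (two_mul_le_of_sq_le p1 p2 (hP x hxΩ) (hQ x hxΩ) (hS x hxΩ)) (sq_nonneg (φ x))
  have := hd x hx
  have := he x hx
  linarith

/-- The second stability inequality. -/
lemma stable_ineq_lap {ξ ζ φ P Q : Euc N → ℝ} (hΩ : IsOpen Ω) (hK : IsCompact K) (hKΩ : K ⊆ Ω)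
    (hξ : ContDiffOn ℝ 2 ξ Ω) (hζ : ContDiffOn ℝ 2 ζ Ω)
    (hξ0 : ∀ x ∈ Ω, 0 < ξ x) (hζ0 : ∀ x ∈ Ω, 0 < ζ x) (hP : ∀ x ∈ Ω, 0 < P x)
    (h1 : ∀ x ∈ Ω, P x * ζ x ≤ -lap ξ x) (h2 : ∀ x ∈ Ω, Q x * ξ x ≤ -lap ζ x)
    (hφ : ContDiffOn ℝ 2 φ Ω) (h0 : ∀ x ∉ K, φ x = 0) :
    LeMod K (fun x => Q x * φ x ^ 2) fun x => lap φ x ^ 2 / P x := by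
  have hg : ContDiffOn ℝ 2 (fun x => φ x * φ x / ξ x) Ω :=
    (hφ.mul hφ).div hξ fun x hx => (hξ0 x hx).ne'
  have hg0 : ∀ x ∉ K, φ x * φ x / ξ x = 0 := fun x hx => by simp [h0 x hx]
  refine ⟨_, ((nullOn_div hΩ hK hKΩ (hg.of_le one_le_two) hζ (Or.inl hg0)).const_mul (-1)).add hK
    (nullOn_div hΩ hK hKΩ (hζ.of_le one_le_two) hg (Or.inr hg0)), fun x hx => ?_⟩
  have hxΩ := hKΩ hx
  beta_reduce
  have hpos := hξ0 x hxΩ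
  have hzpos := hζ0 x hxΩ
  have hPpos := hP x hxΩ
  have dφ := diffAt_of_contDiffOn hΩ (hφ.of_le one_le_two) hxΩ
  have dξ := diffAt_of_contDiffOn hΩ (hξ.of_le one_le_two) hxΩ
  have dg := diffAt_of_contDiffOn hΩ (hg.of_le one_le_two) hxΩ
  have eq : (fun y => (φ y * φ y / ξ y) * ξ y) =ᶠ[𝓝 x] fun y => φ y * φ y := by
    filter_upwards [hΩ.mem_nhds hxΩ] with y hy
    rw [div_mul_cancel₀ _ (hξ0 y hy).ne']
  have e : gdot (fun y => (φ y * φ y / ξ y) * ξ y) ξ x = gdot (fun y => φ y * φ y) ξ x :=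
    gdot_congr_left eq
  rw [gdot_mul dg dξ, gdot_mul dφ dφ] at e
  have l : lap (fun y => (φ y * φ y / ξ y) * ξ y) x = lap (fun y => φ y * φ y) x := by
    simp only [lap, eq.iteratedFDeriv ℝ 2 |>.eq_of_nhds]
  rw [lap_mul' hΩ hg hξ hxΩ, lap_mul' hΩ hφ hφ hxΩ] at l
  rw [gdot_comm ζ]
  set G := fun x => φ x * φ x / ξ x with hG
  have hGx : φ x * φ x / ξ x = G x := rfl
  have hGe : G x * ξ x = φ x ^ 2 := by rw [← hGx]; field_simp
  have hq := gdot_quad φ ξ (φ x / ξ x) x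
  have s1 : 2 * φ x * lap φ x - G x * lap ξ x ≤ ξ x * lap G x := by
    have e3 : gdot G ξ x = 2 * (φ x / ξ x) * gdot φ ξ x - (φ x / ξ x) ^ 2 * gdot ξ ξ x := by
      field_simp at e ⊢
      linarith
    rw [hGx, e3] at l
    linarith
  have s2 := h1 x hxΩ
  have s3 := h2 x hxΩ
  have hGnn : 0 ≤ G x := by rw [← hGx]; exact div_nonneg (mul_self_nonneg _) hpos.le
  have s4 : Q x * φ x ^ 2 ≤ -lap ζ x * G x := by
    rw [← hGe]
    nlinarith
  have s5 : -(ζ x * lap G x) ≤ lap φ x ^ 2 / P x := by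
    have r1 : ζ x * (2 * φ x * lap φ x - G x * lap ξ x) / ξ x ≤ ζ x * lap G x := by
      rw [div_le_iff₀ hpos]
      nlinarith
    have r2 : ζ x * (2 * φ x * lap φ x + G x * (P x * ζ x)) / ξ x ≤
        ζ x * (2 * φ x * lap φ x - G x * lap ξ x) / ξ x := by
      gcongr
      nlinarith
    have r3 : ζ x * (2 * φ x * lap φ x + G x * (P x * ζ x)) / ξ x + lap φ x ^ 2 / P x =
        (ζ x * φ x / ξ x * P x + lap φ x) ^ 2 / P x := by
      rw [← hGx]
      field_simp
      ring
    have r4 : 0 ≤ (ζ x * φ x / ξ x * P x + lap φ x) ^ 2 / P x := by positivity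
    linarith
  rw [hGx]
  linarith

/-- Caccioppoli's inequality with a superharmonic weight. -/
lemma caccioppoli {w g ψ : Euc N → ℝ} (hΩ : IsOpen Ω) (hK : IsCompact K) (hKΩ : K ⊆ Ω)
    (hw : ContDiffOn ℝ 2 w Ω) (hw' : ∀ x ∈ Ω, lap w x ≤ 0) (hg : ContDiffOn ℝ 1 g Ω)
    (hψ : ContDiffOn ℝ 2 ψ Ω) (hψ0 : ∀ x, 0 ≤ ψ x) (h0 : ∀ x ∉ K, ψ x = 0) :
    LeMod K (fun x => ψ x * w x * gdot g g x) fun x =>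
      gdot (fun y => ψ y * w y * g y) g x - 2 * (g x * w x * gdot ψ g x) -
        1 / 2 * (w x * g x ^ 2 * lap ψ x) := by
  have hw1 := hw.of_le one_le_two
  have hψ1 := hψ.of_le one_le_two
  refine ⟨_, ((nullOn_div hΩ hK hKΩ (f := fun x => w x * (g x * g x)) (hw1.mul (hg.mul hg)) hψ
    (Or.inr h0)).const_mul (1 / 2)).add hK ((nullOn_div hΩ hK hKΩ (f := fun x => ψ x * (g x * g x))
    (hψ1.mul (hg.mul hg)) hw (Or.inl fun x hx => by simp [h0 x hx])).const_mul (-(1 / 2))),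
    fun x hx => ?_⟩
  have hxΩ := hKΩ hx
  beta_reduce
  have dw := diffAt_of_contDiffOn hΩ hw1 hxΩ
  have dψ := diffAt_of_contDiffOn hΩ hψ1 hxΩ
  have dg := diffAt_of_contDiffOn hΩ hg hxΩ
  rw [gdot_mul (f := fun y => ψ y * w y) (dψ.fun_mul dw) dg, gdot_mul dψ dw,
    gdot_mul dw (dg.fun_mul dg), gdot_mul dψ (dg.fun_mul dg), gdot_mul dg dg, gdot_mul dg dg]
  rw [gdot_comm w g, gdot_comm ψ w, gdot_comm ψ g]
  have := mul_nonneg (mul_nonneg (hψ0 x) (sq_nonneg (g x))) (neg_nonneg.2 (hw' x hxΩ))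
  linarith

end EnergyInequalities

section Young

lemma rpow_mul_pow_le {s δ : ℝ} {k k' : ℕ} (hs0 : 0 ≤ s) (hs : s < 1) (hδ : 0 < δ)
    (hk : k * s ≤ k') : ∃ C, 0 ≤ C ∧ ∀ Z θ : ℝ, 0 ≤ Z → 0 ≤ θ → θ ≤ 1 →
      Z ^ s * θ ^ k' ≤ δ * (Z * θ ^ k) + C := by
  have hs' : 0 < 1 - s := by linarith
  set T : ℝ := δ ^ (-(1 / (1 - s))) with hT
  have hT0 : 0 < T := Real.rpow_pos_of_pos hδ _
  have hT1 : T ^ (-(1 - s)) = δ := by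
    rw [hT, ← Real.rpow_mul hδ.le]
    rw [show -(1 / (1 - s)) * -(1 - s) = 1 by field_simp, Real.rpow_one]
  refine ⟨T ^ s + 1, by positivity, fun Z θ hZ h0 h1 => ?_⟩
  have key : ∀ t : ℝ, 0 ≤ t → t ^ s ≤ δ * t + T ^ s := by
    intro t ht
    rcases le_or_gt t T with h | h
    · have := Real.rpow_le_rpow ht h hs0
      nlinarith [mul_nonneg hδ.le ht]
    · have htp : 0 < t := hT0.trans h
      have e : t ^ s = t ^ (-(1 - s)) * t := by
        rw [← Real.rpow_add_one htp.ne']; congr 1; ring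
      have := Real.rpow_le_rpow_of_nonpos hT0 h.le (by linarith : -(1 - s) ≤ 0)
      rw [hT1] at this
      rw [e]
      have := mul_le_mul_of_nonneg_right this htp.le
      have := Real.rpow_nonneg hT0.le s
      linarith
  rcases h0.eq_or_lt with h | hpos
  · subst h
    rcases Nat.eq_zero_or_pos k' with hk' | hk'
    · subst hk'
      rcases Nat.eq_zero_or_pos k with hk0 | hk0
      · subst hk0
        simpa using (key Z hZ).trans (by linarith)
      · have : s = 0 := le_antisymm (by
          have : (0 : ℝ) < k := by exact_mod_cast hk0
          push_cast at hk
          nlinarith) hs0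
        subst this
        simp [hk0.ne']
    · rw [zero_pow hk'.ne', mul_zero]
      positivity
  · have e : θ ^ k' ≤ (θ ^ k) ^ s := by
      rw [← Real.rpow_natCast, ← Real.rpow_natCast, ← Real.rpow_mul h0]
      exact Real.rpow_le_rpow_of_exponent_ge hpos h1 hk
    calc Z ^ s * θ ^ k' ≤ Z ^ s * (θ ^ k) ^ s := by gcongr
      _ = (Z * θ ^ k) ^ s := (Real.mul_rpow hZ (by positivity)).symm
      _ ≤ _ := by linarith [key (Z * θ ^ k) (by positivity)]

lemma rpow_mul_rpow_le {p q c d u v : ℝ} (hp : 0 < p) (hq : 0 < q) (hc : 0 ≤ c) (hd : 0 ≤ d)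
    (hu : 0 < u) (hv : 0 < v) :
    v ^ c * u ^ d ≤ (v ^ (p + 1) + u ^ (q + 1)) ^ (c / (p + 1) + d / (q + 1)) := by
  have h1 : 0 < v ^ (p + 1) := Real.rpow_pos_of_pos hv _
  have h2 : 0 < u ^ (q + 1) := Real.rpow_pos_of_pos hu _
  rw [Real.rpow_add (by positivity)]
  have e1 : v ^ c = (v ^ (p + 1)) ^ (c / (p + 1)) := by
    rw [← Real.rpow_mul hv.le]; congr 1; field_simp
  have e2 : u ^ d = (u ^ (q + 1)) ^ (d / (q + 1)) := by
    rw [← Real.rpow_mul hu.le]; congr 1; field_simp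
  rw [e1, e2]
  gcongr <;> linarith

lemma young_uv {p q c d δ : ℝ} {k k' : ℕ} (hp : 0 < p) (hq : 0 < q) (hc : 0 ≤ c) (hd : 0 ≤ d)
    (hs : c / (p + 1) + d / (q + 1) < 1) (hδ : 0 < δ)
    (hk : k * (c / (p + 1) + d / (q + 1)) ≤ k') :
    ∃ C, 0 ≤ C ∧ ∀ u v θ : ℝ, 0 < u → 0 < v → 0 ≤ θ → θ ≤ 1 →
      v ^ c * u ^ d * θ ^ k' ≤ δ * ((v ^ (p + 1) + u ^ (q + 1)) * θ ^ k) + C := by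
  obtain ⟨C, hC, h⟩ := rpow_mul_pow_le (by positivity) hs hδ hk
  refine ⟨C, hC, fun u v θ hu hv h0 h1 => ?_⟩
  refine le_trans ?_ (h (v ^ (p + 1) + u ^ (q + 1)) θ (by positivity) h0 h1)
  exact mul_le_mul_of_nonneg_right (rpow_mul_rpow_le hp hq hc hd hu hv) (by positivity)

end Young

section System

variable {N : ℕ} {Ω K : Set (Euc N)} {A B u v θ : Euc N → ℝ} {p q : ℝ}

/-- A positive solution of `-Δu = A v^p`, `-Δv = B u^q` on the open set `Ω`. -/
structure IsSys (Ω : Set (Euc N)) (A B : Euc N → ℝ) (p q : ℝ) (u v : Euc N → ℝ) : Prop where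
  isOpen : IsOpen Ω
  cu : ContDiffOn ℝ 2 u Ω
  cv : ContDiffOn ℝ 2 v Ω
  cA : ContDiffOn ℝ 2 A Ω
  cB : ContDiffOn ℝ 2 B Ω
  u_pos : ∀ x ∈ Ω, 0 < u x
  v_pos : ∀ x ∈ Ω, 0 < v x
  A_pos : ∀ x ∈ Ω, 0 < A x
  B_pos : ∀ x ∈ Ω, 0 < B x
  lap_u : ∀ x ∈ Ω, lap u x = -(A x * v x ^ p)
  lap_v : ∀ x ∈ Ω, lap v x = -(B x * u x ^ q)

/-- Stability of a positive solution on `Ω`. -/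
def IsStab (Ω : Set (Euc N)) (A B : Euc N → ℝ) (p q : ℝ) (u v : Euc N → ℝ) : Prop :=
  ∃ ξ ζ : Euc N → ℝ, ContDiffOn ℝ 2 ξ Ω ∧ ContDiffOn ℝ 2 ζ Ω ∧
    (∀ x ∈ Ω, 0 < ξ x) ∧ (∀ x ∈ Ω, 0 < ζ x) ∧
    (∀ x ∈ Ω, p * A x * v x ^ (p - 1) * ζ x ≤ -lap ξ x) ∧
    (∀ x ∈ Ω, q * B x * u x ^ (q - 1) * ξ x ≤ -lap ζ x)

lemma exists_pos_lower_bound (hK : IsCompact K) (hc : ContinuousOn A K) (h0 : ∀ x ∈ K, 0 < A x) :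
    ∃ α, 0 < α ∧ ∀ x ∈ K, α ≤ A x := by
  rcases K.eq_empty_or_nonempty with h | h
  · exact ⟨1, one_pos, by simp [h]⟩
  · obtain ⟨y, hy, hmin⟩ := hK.exists_isMinOn h hc
    exact ⟨A y, h0 y hy, fun x hx => hmin hx⟩

lemma exists_upper_bound (hK : IsCompact K) (hc : ContinuousOn A K) :
    ∃ α, 0 ≤ α ∧ ∀ x ∈ K, |A x| ≤ α := by
  obtain ⟨C, hC⟩ := hK.exists_bound_of_continuousOn hc
  exact ⟨max C 0, le_max_right _ _, fun x hx => (hC x hx).trans (le_max_left _ _)⟩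

/-- Caccioppoli's inequality for `u`, with a superharmonic weight and a cutoff. -/
lemma IsSys.grad_le (hK : IsCompact K) (hKΩ : K ⊆ Ω) (hθ : IsCutoff K θ) (k : ℕ) :
    ∃ C, 0 ≤ C ∧ ∀ A B u v w : Euc N → ℝ, ∀ p q : ℝ, IsSys Ω A B p q u v →
      ContDiffOn ℝ 2 w Ω → (∀ x ∈ Ω, 0 < w x) → (∀ x ∈ Ω, lap w x ≤ 0) →
      LeMod K (fun x => w x * gdot u u x * θ x ^ (2 * k + 2)) fun x =>
        2 * (A x * (w x * u x * v x ^ p) * θ x ^ (2 * k + 2)) +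
          C * (w x * u x ^ 2 * θ x ^ (2 * k)) := by
  obtain ⟨C, hC, hb⟩ := hθ.pow_bound (2 * k + 1)
  obtain ⟨C', hC', hb'⟩ := hθ.pow_bound (2 * k)
  refine ⟨4 * C + C' + C', by positivity, fun A B u v w p q hs hw w0 hw' => ?_⟩
  have cθ : ContDiff ℝ 2 fun x => θ x ^ (2 * k + 2) := hθ.contDiff.pow _
  have θ0 : ∀ x ∉ K, θ x ^ (2 * k + 2) = 0 := fun x hx => by simp [hθ.eq_zero x hx]
  have cu1 := hs.cu.of_le one_le_two
  obtain ⟨D, hD, hd⟩ := caccioppoli hs.isOpen hK hKΩ hw hw' cu1 cθ.contDiffOn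
    (fun x => pow_nonneg (hθ.nonneg x) _) θ0
  refine ⟨_, (hD.add hK (nullOn_div (g := u) hs.isOpen hK hKΩ
    (((cθ.contDiffOn.of_le one_le_two).mul (hw.of_le one_le_two)).mul cu1) hs.cu
    (Or.inl fun x hx => by simp [hθ.eq_zero x hx]))).const_mul 2, fun x hx => ?_⟩
  beta_reduce
  have hxΩ := hKΩ hx
  have h := hd x hx
  have wpos := w0 x hxΩ
  have t0 := hθ.nonneg x
  have := hs.lap_u x hxΩ
  rw [this]
  have c1 := gdot_sq_le (fun x => θ x ^ (2 * k + 2)) u x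
  have c2 := (hb x).1
  have c3 := (hb' x).2
  have g0 := gdot_self_nonneg u x
  have e1 : -(4 * (u x * w x * gdot (fun x => θ x ^ (2 * k + 2)) u x)) ≤
      w x * gdot u u x * θ x ^ (2 * k + 2) + 4 * C * (w x * u x ^ 2 * θ x ^ (2 * k)) := by
    have i1 : gdot (fun x => θ x ^ (2 * k + 2)) u x ^ 2 ≤
        C * θ x ^ (2 * k) * (θ x ^ (2 * k + 2) * gdot u u x) := by
      refine c1.trans ((mul_le_mul_of_nonneg_right c2 g0).trans_eq ?_)
      ring
    have i2 := two_mul_le_of_sq_le (S := |u x * gdot (fun x => θ x ^ (2 * k + 2)) u x|)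
      (α := u x ^ 2 * (C * θ x ^ (2 * k))) (β := θ x ^ (2 * k + 2) * gdot u u x)
      (s := 1) (t := 2) one_pos two_pos (by positivity) (by positivity) (by
        rw [sq_abs, mul_pow]
        nlinarith [mul_le_mul_of_nonneg_left i1 (sq_nonneg (u x))])
    have i3 := neg_abs_le (u x * gdot (fun x => θ x ^ (2 * k + 2)) u x)
    have i4 := mul_le_mul_of_nonneg_left i2 wpos.le
    have i5 := mul_le_mul_of_nonneg_left i3 wpos.le
    linarith
  have e2 : -(w x * u x ^ 2 * lap (fun x => θ x ^ (2 * k + 2)) x) ≤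
      C' * (w x * u x ^ 2 * θ x ^ (2 * k)) := by
    have i1 := mul_le_mul_of_nonneg_left ((neg_le_abs _).trans c3)
      (by positivity : 0 ≤ w x * u x ^ 2)
    linarith
  have e3 : 0 ≤ C' * (w x * u x ^ 2 * θ x ^ (2 * k)) := by positivity
  linarith

end System

section SublinearEnergy

variable {N : ℕ} {Ω K : Set (Euc N)} {A B u v θ : Euc N → ℝ} {p q : ℝ}

/-- Testing the two equations against `vη` and `uη`. -/
lemma IsSys.cross_identity (hs : IsSys Ω A B p q u v) (hK : IsCompact K) (hKΩ : K ⊆ Ω)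
    {η : Euc N → ℝ} (hη : ContDiffOn ℝ 2 η Ω) (h0 : ∀ x ∉ K, η x = 0) :
    ∃ D, NullOn K D ∧ ∀ x ∈ K, A x * v x ^ (p + 1) * η x =
      B x * u x ^ (q + 1) * η x + 2 * (v x * gdot u η x) + u x * v x * lap η x + D x := by
  have hΩ := hs.isOpen
  have cu := hs.cu.of_le one_le_two
  have cv := hs.cv.of_le one_le_two
  have cη := hη.of_le one_le_two
  refine ⟨_, (((nullOn_div hΩ hK hKΩ (cv.mul cη) hs.cu
    (Or.inl fun x hx => by simp [h0 x hx])).const_mul (-1)).add hK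
    (nullOn_div hΩ hK hKΩ (cu.mul cη) hs.cv (Or.inl fun x hx => by simp [h0 x hx]))).add hK
    ((nullOn_div hΩ hK hKΩ (cu.mul cv) hη (Or.inr h0)).const_mul (-1)), fun x hx => ?_⟩
  have hxΩ := hKΩ hx
  have du := diffAt_of_contDiffOn hΩ cu hxΩ
  have dv := diffAt_of_contDiffOn hΩ cv hxΩ
  have dη := diffAt_of_contDiffOn hΩ cη hxΩ
  rw [hs.lap_u x hxΩ, hs.lap_v x hxΩ, gdot_mul dv dη, gdot_mul du dη, gdot_mul du dv,
    gdot_comm v u, gdot_comm η u, gdot_comm η v, Real.rpow_add_one (hs.u_pos x hxΩ).ne',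
    Real.rpow_add_one (hs.v_pos x hxΩ).ne']
  ring

/-- The stability inequality tested with `φ = uθ^m`. -/
lemma IsSys.stab_energy_le (hK : IsCompact K) (hKΩ : K ⊆ Ω) (hθ : IsCutoff K θ) (k : ℕ)
    (hA : ContinuousOn A K) (hA0 : ∀ x ∈ K, 0 < A x) (hp : 0 < p) {ε : ℝ} (hε : 0 < ε) :
    ∃ C, 0 ≤ C ∧ ∀ (B u v : Euc N → ℝ) (q : ℝ), IsSys Ω A B p q u v → IsStab Ω A B p q u v →
      LeMod K (fun x => q * (B x * u x ^ (q + 1) * θ x ^ (2 * k + 4))) fun x =>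
        (1 + ε) / p * (A x * v x ^ (p + 1) * θ x ^ (2 * k + 4)) +
        C * (v x ^ (1 - p) * u x ^ 2 * θ x ^ (2 * k) +
          v x ^ (1 - p) * gdot u u x * θ x ^ (2 * k + 2)) := by
  obtain ⟨C1, hC1, hb1⟩ := hθ.pow_bound (k + 1)
  obtain ⟨C2, hC2, hb2⟩ := hθ.pow_bound k
  obtain ⟨α, hα, hαA⟩ := exists_pos_lower_bound hK hA hA0
  refine ⟨(1 + 1 / ε) / (p * α) * (8 * C1 + 2 * C2 ^ 2), by positivity,
    fun B u v q hs ⟨ξ, ζ, hξ, hζ, hξ0, hζ0, h1, h2⟩ => ?_⟩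
  have hΩ := hs.isOpen
  have cθ : ContDiff ℝ 2 fun x => θ x ^ (k + 2) := hθ.contDiff.pow _
  obtain ⟨D, hD, hd⟩ := stable_ineq_lap hΩ hK hKΩ hξ hζ hξ0 hζ0
    (P := fun x => p * A x * v x ^ (p - 1)) (Q := fun x => q * B x * u x ^ (q - 1))
    (fun x hx => mul_pos (mul_pos hp (hs.A_pos x hx)) (Real.rpow_pos_of_pos (hs.v_pos x hx) _))
    h1 h2 (hs.cu.mul cθ.contDiffOn) (fun x hx => by simp [hθ.eq_zero x hx])
  refine ⟨D, hD, fun x hx => ?_⟩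
  have hxΩ := hKΩ hx
  have h := hd x hx
  beta_reduce at h ⊢
  rw [lap_mul' hΩ hs.cu cθ.contDiffOn hxΩ, hs.lap_u x hxΩ] at h
  have hu := hs.u_pos x hxΩ
  have hv := hs.v_pos x hxΩ
  have ha := hs.A_pos x hxΩ
  have haα := hαA x hx
  have t0 := hθ.nonneg x
  have b1 := (hb1 x).1
  have b2 := (hb2 x).2
  have G0 := gdot_self_nonneg u x
  have e1 : u x ^ (q + 1) = u x ^ (q - 1) * u x ^ 2 := by
    rw [← Real.rpow_natCast, ← Real.rpow_add hu]; congr 1; push_cast; ring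
  have e2 : v x ^ (p + 1) = (v x ^ p) ^ 2 * v x ^ (1 - p) := by
    rw [← Real.rpow_natCast, ← Real.rpow_mul hv.le, ← Real.rpow_add hv]; congr 1; push_cast; ring
  have e3 : v x ^ (p - 1) = (v x ^ (1 - p))⁻¹ := by
    rw [← Real.rpow_neg hv.le]; congr 1; ring
  rw [e1, e2]
  rw [e3] at h
  have hw : 0 < v x ^ (1 - p) := Real.rpow_pos_of_pos hv _
  have hvp : 0 < v x ^ p := Real.rpow_pos_of_pos hv _
  set w := v x ^ (1 - p)
  set vp := v x ^ p
  set L := lap (fun y => θ y ^ (k + 2)) x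
  set g := gdot u (fun y => θ y ^ (k + 2)) x with hg
  set G := gdot u u x
  have b3 : g ^ 2 ≤ G * (C1 * (θ x ^ (k + 1)) ^ 2) :=
    (gdot_sq_le u _ x).trans (mul_le_mul_of_nonneg_left b1 G0)
  have b4 : L ^ 2 ≤ (C2 * θ x ^ k) ^ 2 := sq_le_sq' (by linarith [neg_abs_le L])
    ((le_abs_self L).trans b2)
  have y1 : (2 * g + u x * L) ^ 2 ≤
      (8 * C1 + 2 * C2 ^ 2) * (u x ^ 2 * θ x ^ (2 * k) + G * θ x ^ (2 * k + 2)) := by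
    have m1 : u x ^ 2 * L ^ 2 ≤ C2 ^ 2 * (u x ^ 2 * θ x ^ (2 * k)) := by
      refine (mul_le_mul_of_nonneg_left b4 (sq_nonneg (u x))).trans_eq ?_
      ring
    have m2 : g ^ 2 ≤ C1 * (G * θ x ^ (2 * k + 2)) := b3.trans_eq (by ring)
    have m3 : 0 ≤ u x ^ 2 * θ x ^ (2 * k) := by positivity
    have m4 : 0 ≤ G * θ x ^ (2 * k + 2) := by positivity
    nlinarith [sq_nonneg (2 * g - u x * L), mul_nonneg hC1 m3, mul_nonneg (sq_nonneg C2) m4]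
  have y2 : (u x * L + 2 * g + θ x ^ (k + 2) * -(A x * vp)) ^ 2 ≤
      (1 + ε) * (A x * vp * θ x ^ (k + 2)) ^ 2 + (1 + 1 / ε) * (2 * g + u x * L) ^ 2 := by
    have m : (1 + ε) * (A x * vp * θ x ^ (k + 2)) ^ 2 + (1 + 1 / ε) * (2 * g + u x * L) ^ 2 -
      (u x * L + 2 * g + θ x ^ (k + 2) * -(A x * vp)) ^ 2 =
      (ε * (A x * vp * θ x ^ (k + 2)) + (2 * g + u x * L)) ^ 2 / ε := by
      field_simp
      ring
    have : 0 ≤ (ε * (A x * vp * θ x ^ (k + 2)) + (2 * g + u x * L)) ^ 2 / ε := by positivity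
    linarith
  have y3 : (u x * L + 2 * g + θ x ^ (k + 2) * -(A x * vp)) ^ 2 / (p * A x * w⁻¹) ≤
      (1 + ε) / p * (A x * (vp ^ 2 * w) * θ x ^ (2 * k + 4)) +
      (1 + 1 / ε) / (p * α) * (w * (2 * g + u x * L) ^ 2) := by
    have m1 : (1 + 1 / ε) / (p * A x) * (w * (2 * g + u x * L) ^ 2) ≤
        (1 + 1 / ε) / (p * α) * (w * (2 * g + u x * L) ^ 2) := by gcongr
    refine le_trans (div_le_div_of_nonneg_right y2 (by positivity)) (le_trans (le_of_eq ?_)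
      (add_le_add le_rfl m1))
    field_simp
    ring
  have y4 : (1 + 1 / ε) / (p * α) * (w * (2 * g + u x * L) ^ 2) ≤
      (1 + 1 / ε) / (p * α) * (8 * C1 + 2 * C2 ^ 2) *
        (w * u x ^ 2 * θ x ^ (2 * k) + w * G * θ x ^ (2 * k + 2)) := by
    have := mul_le_mul_of_nonneg_left y1 (by positivity : 0 ≤ (1 + 1 / ε) / (p * α) * w)
    linarith
  have y5 : q * (B x * (u x ^ (q - 1) * u x ^ 2) * θ x ^ (2 * k + 4)) =
      q * B x * u x ^ (q - 1) * (u x * θ x ^ (k + 2)) ^ 2 := by ring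
  linarith

/-- For `p ≤ 1` the power `v^(1-p)` is superharmonic. -/
lemma IsSys.lap_rpow_nonpos (hs : IsSys Ω A B p q u v) (hp : 0 ≤ p) (hp1 : p ≤ 1) :
    ∀ x ∈ Ω, lap (fun x => v x ^ (1 - p)) x ≤ 0 := fun x hx => by
  rw [lap_rpow _ hs.isOpen hs.cv hs.v_pos hx, hs.lap_v x hx]
  have h1 : 0 ≤ (1 - p) * v x ^ (1 - p - 1) * (B x * u x ^ q) :=
    mul_nonneg (mul_nonneg (by linarith) (Real.rpow_pos_of_pos (hs.v_pos x hx) _).le)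
      (mul_nonneg (hs.B_pos x hx).le (Real.rpow_pos_of_pos (hs.u_pos x hx) _).le)
  have h2 : 0 ≤ (1 - p) * p * v x ^ (1 - p - 2) * ∑ i, pd i v x ^ 2 :=
    mul_nonneg (mul_nonneg (mul_nonneg (by linarith) hp)
      (Real.rpow_pos_of_pos (hs.v_pos x hx) _).le) (Finset.sum_nonneg fun _ _ => sq_nonneg _)
  linarith

lemma exists_nat_mul_le {s : ℝ} (hs : s < 1) (c : ℝ) :
    ∃ k₀ : ℕ, ∀ k : ℕ, k₀ ≤ k → (2 * k + c) * s ≤ 2 * k := by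
  obtain ⟨k₀, hk⟩ := exists_nat_ge (c * s / (2 * (1 - s)))
  refine ⟨k₀, fun k hkk => ?_⟩
  have h1 : c * s / (2 * (1 - s)) ≤ k := hk.trans (by exact_mod_cast hkk)
  rw [div_le_iff₀ (by linarith)] at h1
  linarith

lemma absorb {p q κ ε C1 C2 E2 E3 X Y Z W T D1 D2 D3 : ℝ} (hκ : κ = (p * q - 1) / 2)
    (hε : κ / 2 = (1 + κ) * (1 - ε) - (1 + ε)) (hκ0 : 0 ≤ κ) (hp : 0 ≤ p)
    (hC1 : 0 ≤ C1) (hC2 : 0 ≤ C2) (hE2 : 0 ≤ E2) (hW : 0 ≤ W) (hT : 0 ≤ T)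
    (j1 : p * q * Y ≤ (1 + ε) * X + p * C1 * (W + Z) + p * D1)
    (j2 : X ≤ Y + ε * X + E2 * Z + C2 * T + D2) (j3 : Z ≤ E3 * (W + T) + D3) :
    κ / 2 * X + κ * Y + Z ≤
      ((p * C1 + (1 + κ) * E2 + 1) * E3 + p * C1 + (1 + κ) * C2) * (W + T) +
      (p * D1 + (1 + κ) * D2 + (p * C1 + (1 + κ) * E2 + 1) * D3) := by
  have j2' := mul_le_mul_of_nonneg_left j2 (by positivity : 0 ≤ 1 + κ)
  have j3' := mul_le_mul_of_nonneg_left j3 (by positivity : 0 ≤ p * C1 + (1 + κ) * E2 + 1)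
  have h1 : 0 ≤ p * C1 * T := by positivity
  have h2 : 0 ≤ (1 + κ) * C2 * W := by positivity
  have a1 : κ / 2 * X = ((1 + κ) * (1 - ε) - (1 + ε)) * X := by rw [hε]
  have a2 : κ * Y = (p * q - (1 + κ)) * Y := by rw [hκ]; ring
  rw [a1, a2]
  linear_combination j1 + j2' + j3' + h1 + h2

set_option maxHeartbeats 1000000 in
/-- Local energy bound for stable solutions in the case `p < 1`. -/
lemma IsSys.energy_le_of_lt_one (hK : IsCompact K) (hKΩ : K ⊆ Ω)
    (hθ : IsCutoff K θ) (hA : ContinuousOn A K)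
    (hB : ContinuousOn B K) (hA0 : ∀ x ∈ K, 0 < A x) (hB0 : ∀ x ∈ K, 0 < B x)
    (hp : 0 < p) (hq : 0 < q) (hp1 : p < 1) (hpq : 1 < p * q) :
    ∃ (k : ℕ) (C : ℝ), 0 ≤ C ∧ ∀ (u v : Euc N → ℝ), IsSys Ω A B p q u v → IsStab Ω A B p q u v →
      LeMod K (fun x => (v x ^ (p + 1) + u x ^ (q + 1)) * θ x ^ (2 * k + 4) +
        v x ^ (1 - p) * gdot u u x * θ x ^ (2 * k + 2)) fun _ => C := by
  have hs1 : (1 - p) / (p + 1) + 2 / (q + 1) < 1 := by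
    rw [div_add_div _ _ (by positivity) (by positivity), div_lt_one (by positivity)]
    nlinarith
  have hs2 : 1 / (p + 1) + 1 / (q + 1) < 1 := by
    rw [div_add_div _ _ (by positivity) (by positivity), div_lt_one (by positivity)]
    nlinarith
  obtain ⟨k1, hk1⟩ := exists_nat_mul_le hs1 4
  obtain ⟨k2, hk2⟩ := exists_nat_mul_le hs2 4
  set k := max k1 k2
  have hk1 := hk1 k (le_max_left _ _)
  have hk2 := hk2 k (le_max_right _ _)
  obtain ⟨α, hα, hαA⟩ := exists_pos_lower_bound hK hA hA0
  obtain ⟨β, hβ, hβB⟩ := exists_pos_lower_bound hK hB hB0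
  set κ : ℝ := (p * q - 1) / 2 with hκ
  have hκ0 : 0 < κ := by rw [hκ]; linarith
  set ε : ℝ := κ / (2 * (2 + κ)) with hεd
  have hε : 0 < ε := by positivity
  obtain ⟨C1, hC1, H1⟩ := IsSys.stab_energy_le hK hKΩ hθ k hA hA0 hp hε
  obtain ⟨C3, hC3, H3⟩ := IsSys.grad_le (Ω := Ω) hK hKΩ hθ k
  obtain ⟨a, ha, haA⟩ := exists_upper_bound hK hA
  obtain ⟨C2, hC2, H2⟩ := hθ.pow_bound (2 * k + 3)
  obtain ⟨C2', hC2', H2'⟩ := hθ.pow_bound (2 * k + 2)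
  -- constants of the cross estimate and of the reduction to lower order terms
  set E2 : ℝ := C2 / (ε * α) with hE2
  set E3 : ℝ := 2 * a + C3 with hE3
  set M : ℝ := (p * C1 + (1 + κ) * E2 + 1) * E3 + p * C1 + (1 + κ) * C2' with hM
  have hM0 : 0 ≤ M := by positivity
  set γ : ℝ := min α β with hγd
  have hγ : 0 < γ := lt_min hα hβ
  set δ : ℝ := κ / 8 * γ / (M + 1) with hδd
  have hδ : 0 < δ := by positivity
  obtain ⟨C4, hC4, H4⟩ := young_uv (k := 2 * k + 4) (k' := 2 * k) hp hq (by linarith : 0 ≤ 1 - p)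
    zero_le_two hs1 hδ (by push_cast; exact hk1)
  obtain ⟨C5, hC5, H5⟩ := young_uv (k := 2 * k + 4) (k' := 2 * k) hp hq zero_le_one
    zero_le_one hs2 hδ (by push_cast; exact hk2)
  set c : ℝ := 1 + 4 / (κ * γ) with hc
  refine ⟨k, c * (M * (C4 + C5)), by positivity, fun u v hs hst => ?_⟩
  obtain ⟨D1, hD1, d1⟩ := H1 B u v q hs hst
  have cw : ContDiffOn ℝ 2 (fun x => v x ^ (1 - p)) Ω :=
    hs.cv.rpow_const_of_ne fun x hx => (hs.v_pos x hx).ne'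
  have lw := hs.lap_rpow_nonpos hp.le hp1.le
  obtain ⟨D3, hD3, d3⟩ := H3 A B u v (fun x => v x ^ (1 - p)) p q hs cw
    (fun x hx => Real.rpow_pos_of_pos (hs.v_pos x hx) _) lw
  obtain ⟨D2, hD2, d2⟩ := hs.cross_identity hK hKΩ (η := fun x => θ x ^ (2 * k + 4))
    (hθ.contDiff.pow _).contDiffOn (fun x hx => by simp [hθ.eq_zero x hx])
  refine ⟨_, ((((hD1.const_mul p).add hK (hD2.const_mul (1 + κ))).add hK
    (hD3.const_mul (p * C1 + (1 + κ) * E2 + 1)))).const_mul c, fun x hx => ?_⟩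
  have hxΩ := hKΩ hx
  have d1 := d1 x hx
  have d2 := d2 x hx
  have d3 := d3 x hx
  beta_reduce at d1 d2 d3 ⊢
  have hu := hs.u_pos x hxΩ
  have hv := hs.v_pos x hxΩ
  have t0 := hθ.nonneg x
  have t1 := hθ.le_one x
  have h4 := H4 (u x) (v x) (θ x) hu hv t0 t1
  have h5 := H5 (u x) (v x) (θ x) hu hv t0 t1
  have h2 := (H2 x).1
  have h2' := (H2' x).2
  have hAx := hA0 x hx
  have hBx := hB0 x hx
  have hαx := hαA x hx
  have hβx := hβB x hx
  have hax := (le_abs_self _).trans (haA x hx)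
  have G0 := gdot_self_nonneg u x
  have gsq := gdot_sq_le u (fun x => θ x ^ (2 * k + 4)) x
  have hw : 0 < v x ^ (1 - p) := Real.rpow_pos_of_pos hv _
  have hvp : 0 < v x ^ (p + 1) := Real.rpow_pos_of_pos hv _
  have huq : 0 < u x ^ (q + 1) := Real.rpow_pos_of_pos hu _
  have ew : v x ^ (1 - p) * v x ^ p = v x := by
    rw [← Real.rpow_add hv]; simp
  have ew2 : v x ^ (p + 1) * v x ^ (1 - p) = v x ^ 2 := by
    rw [← Real.rpow_add hv, ← Real.rpow_natCast]; congr 1; push_cast; ring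
  rw [Real.rpow_two] at h4
  rw [Real.rpow_one, Real.rpow_one] at h5
  rw [show v x ^ (1 - p) * u x * v x ^ p = v x * u x by
    linear_combination u x * ew] at d3
  have hpow : θ x ^ (2 * k + 2) ≤ θ x ^ (2 * k) := pow_le_pow_of_le_one t0 t1 (by omega)
  have hT0 : 0 ≤ v x * u x * θ x ^ (2 * k) := by positivity
  have hW0 : 0 ≤ v x ^ (1 - p) * u x ^ 2 * θ x ^ (2 * k) := by positivity
  have hTpow : v x * u x * θ x ^ (2 * k + 2) ≤ v x * u x * θ x ^ (2 * k) := by gcongr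
  have i2' : u x * v x * lap (fun x => θ x ^ (2 * k + 4)) x ≤
      C2' * (v x * u x * θ x ^ (2 * k)) := by
    have m1 := mul_le_mul_of_nonneg_left ((le_abs_self _).trans h2')
      (by positivity : 0 ≤ u x * v x)
    have m2 := mul_le_mul_of_nonneg_left hTpow hC2'
    linarith
  have i3 : 2 * (A x * (v x * u x) * θ x ^ (2 * k + 2)) ≤ 2 * a * (v x * u x * θ x ^ (2 * k)) := by
    have m1 : A x * (v x * u x * θ x ^ (2 * k + 2)) ≤ a * (v x * u x * θ x ^ (2 * k)) := by
      gcongr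
    linarith
  have i2 : 2 * (v x * gdot u (fun x => θ x ^ (2 * k + 4)) x) ≤
      ε * (A x * v x ^ (p + 1) * θ x ^ (2 * k + 4)) +
      E2 * (v x ^ (1 - p) * gdot u u x * θ x ^ (2 * k + 2)) := by
    have m := two_mul_le_of_sq_le (S := v x * gdot u (fun x => θ x ^ (2 * k + 4)) x)
      (α := v x ^ (p + 1) * θ x ^ (2 * k + 4))
      (β := C2 * (v x ^ (1 - p) * gdot u u x * θ x ^ (2 * k + 2)))
      (s := 1) (t := ε * α) one_pos (by positivity) (by positivity) (by positivity) (by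
        have n1 : gdot u (fun x => θ x ^ (2 * k + 4)) x ^ 2 ≤
            gdot u u x * (C2 * (θ x ^ (2 * k + 3)) ^ 2) :=
          gsq.trans (mul_le_mul_of_nonneg_left h2 G0)
        have n2 := mul_le_mul_of_nonneg_left n1 (sq_nonneg (v x))
        rw [mul_pow]
        refine n2.trans_eq ?_
        rw [← ew2]
        ring)
    have m2 : ε * α * (v x ^ (p + 1) * θ x ^ (2 * k + 4)) ≤
        ε * A x * (v x ^ (p + 1) * θ x ^ (2 * k + 4)) := by gcongr
    have m3 : C2 * (v x ^ (1 - p) * gdot u u x * θ x ^ (2 * k + 2)) * 1 / (ε * α) =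
      E2 * (v x ^ (1 - p) * gdot u u x * θ x ^ (2 * k + 2)) := by rw [hE2]; ring
    rw [m3] at m
    linarith
  have i6 : γ * ((v x ^ (p + 1) + u x ^ (q + 1)) * θ x ^ (2 * k + 4)) ≤
      A x * v x ^ (p + 1) * θ x ^ (2 * k + 4) + B x * u x ^ (q + 1) * θ x ^ (2 * k + 4) := by
    have m1 : γ * (v x ^ (p + 1) * θ x ^ (2 * k + 4)) ≤
        A x * (v x ^ (p + 1) * θ x ^ (2 * k + 4)) := by
      gcongr; exact (min_le_left _ _).trans hαx
    have m2 : γ * (u x ^ (q + 1) * θ x ^ (2 * k + 4)) ≤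
        B x * (u x ^ (q + 1) * θ x ^ (2 * k + 4)) := by
      gcongr; exact (min_le_right _ _).trans hβx
    linarith
  set S := (v x ^ (p + 1) + u x ^ (q + 1)) * θ x ^ (2 * k + 4) with hS
  set X := A x * v x ^ (p + 1) * θ x ^ (2 * k + 4)
  set Y := B x * u x ^ (q + 1) * θ x ^ (2 * k + 4)
  set Z := v x ^ (1 - p) * gdot u u x * θ x ^ (2 * k + 2)
  set W := v x ^ (1 - p) * u x ^ 2 * θ x ^ (2 * k)
  set T := v x * u x * θ x ^ (2 * k)
  have hS0 : 0 ≤ S := by positivity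
  have hZ0 : 0 ≤ Z := by positivity
  have hX0 : 0 ≤ X := by positivity
  have hY0 : 0 ≤ Y := by positivity
  have j1 : p * q * Y ≤ (1 + ε) * X + p * C1 * (W + Z) + p * D1 x := by
    have := mul_le_mul_of_nonneg_left d1 hp.le
    have e : p * ((1 + ε) / p * X + C1 * (W + Z) + D1 x) =
      (1 + ε) * X + p * C1 * (W + Z) + p * D1 x := by field_simp
    linarith only [this, e]
  have j2 : X ≤ Y + ε * X + E2 * Z + C2' * T + D2 x := by linarith only [d2, i2, i2']
  have j3 : Z ≤ E3 * (W + T) + D3 x := by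
    have : 0 ≤ 2 * a * W := by positivity
    have : 0 ≤ C3 * T := by positivity
    rw [hE3]
    linarith only [d3, i3, this, ‹0 ≤ 2 * a * W›]
  have hκε : κ / 2 = (1 + κ) * (1 - ε) - (1 + ε) := by
    rw [hεd]; field_simp; ring
  have j4 : κ / 2 * X + κ * Y + Z ≤ M * (W + T) +
      (p * D1 x + (1 + κ) * D2 x + (p * C1 + (1 + κ) * E2 + 1) * D3 x) :=
    absorb hκ hκε hκ0.le hp.le hC1 hC2' (by positivity) hW0 hT0 j1 j2 j3
  have j5 : M * (W + T) ≤ κ / 4 * γ * S + M * (C4 + C5) := by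
    have n1 : M * δ ≤ κ / 8 * γ := by
      rw [hδd, ← mul_div_assoc, div_le_iff₀ (by positivity)]
      nlinarith [mul_pos hκ0 hγ]
    have n2 := mul_le_mul_of_nonneg_left (add_le_add h4 h5) hM0
    have n3 := mul_le_mul_of_nonneg_right n1 hS0
    linarith only [n2, n3]
  have j6 : κ / 4 * γ * S + Z ≤ M * (C4 + C5) +
      (p * D1 x + (1 + κ) * D2 x + (p * C1 + (1 + κ) * E2 + 1) * D3 x) := by
    have n1 := mul_le_mul_of_nonneg_left i6 hκ0.le
    have n2 : 0 ≤ κ * Y := by positivity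
    linarith only [n1, n2, j4, j5]
  have j7 := mul_le_mul_of_nonneg_left j6 (by positivity : 0 ≤ c)
  have j8 : S + Z ≤ c * (κ / 4 * γ * S + Z) := by
    have n1 : c * (κ / 4 * γ * S + Z) - (S + Z) = κ / 4 * γ * S + 4 / (κ * γ) * Z := by
      rw [hc]; field_simp; ring
    have n2 : 0 ≤ κ / 4 * γ * S := by positivity
    have n3 : 0 ≤ 4 / (κ * γ) * Z := by positivity
    linarith only [n1, n2, n3]
  linarith only [j7, j8]

end SublinearEnergy

section FluxBounds

variable {N : ℕ} {Ω K E : Set (Euc N)} {A B u v θ : Euc N → ℝ} {p q : ℝ}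

lemma mul_le_add_of_sq_le {s α β ε c : ℝ} (hα : 0 ≤ α) (hβ : 0 ≤ β) (hε : 0 < ε)
    (h : s ^ 2 ≤ α * β) : |c * s| ≤ ε * α + c ^ 2 / (4 * ε) * β := by
  refine abs_le_of_sq_le_sq ?_ (by positivity)
  have e : ε * α * (c ^ 2 / (4 * ε) * β) = c ^ 2 / 4 * (α * β) := by field_simp
  have := mul_le_mul_of_nonneg_left h (sq_nonneg c)
  nlinarith [sq_nonneg (ε * α - c ^ 2 / (4 * ε) * β)]

lemma LeMod.of_le {A' B' : Euc N → ℝ} (h : LeMod K A B) (hA : ∀ x ∈ K, A' x ≤ A x)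
    (hB : ∀ x ∈ K, B x ≤ B' x) : LeMod K A' B' := by
  obtain ⟨D, hD, hd⟩ := h
  exact ⟨D, hD, fun x hx => by linarith [hA x hx, hB x hx, hd x hx]⟩

lemma LeMod.add {A' B' : Euc N → ℝ} (hK : IsCompact K) (h : LeMod K A B) (h' : LeMod K A' B') :
    LeMod K (fun x => A x + A' x) fun x => B x + B' x := by
  obtain ⟨D, hD, hd⟩ := h
  obtain ⟨E, hE, he⟩ := h'
  exact ⟨_, hD.add hK hE, fun x hx => by beta_reduce; linarith [hd x hx, he x hx]⟩

lemma LeMod.const_mul {c : ℝ} (hc : 0 ≤ c) (h : LeMod K A B) :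
    LeMod K (fun x => c * A x) fun x => c * B x := by
  obtain ⟨D, hD, hd⟩ := h
  exact ⟨_, hD.const_mul c, fun x hx => by
    beta_reduce; linarith [mul_le_mul_of_nonneg_left (hd x hx) hc]⟩

lemma NullOn.zero : NullOn K fun _ => (0 : ℝ) := ⟨continuousOn_const, by simp⟩

lemma LeMod.sum {ι : Type*} (s : Finset ι) {A B : ι → Euc N → ℝ} (hK : IsCompact K)
    (h : ∀ i, LeMod K (A i) (B i)) :
    LeMod K (fun x => ∑ i ∈ s, A i x) fun x => ∑ i ∈ s, B i x := by
  choose D hD hd using h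
  exact ⟨_, NullOn.sum s hK hD, fun x hx => by
    beta_reduce
    rw [← Finset.sum_add_distrib]
    exact Finset.sum_le_sum fun i _ => hd i x hx⟩

lemma LeMod.trans {C : Euc N → ℝ} (hK : IsCompact K) (h : LeMod K A B) (h' : LeMod K B C) :
    LeMod K A C := by
  obtain ⟨D, hD, hd⟩ := h
  obtain ⟨E, hE, he⟩ := h'
  exact ⟨_, hD.add hK hE, fun x hx => by linarith [hd x hx, he x hx]⟩

lemma exists_pd_bound (hΩ : IsOpen Ω) (hK : IsCompact K) (hKΩ : K ⊆ Ω)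
    (hA : ContDiffOn ℝ 1 A Ω) : ∃ C, 0 ≤ C ∧ ∀ i, ∀ x ∈ K, |pd i A x| ≤ C := by
  choose C hC h using fun i => exists_upper_bound hK ((continuousOn_pd i hΩ hA).mono hKΩ)
  exact ⟨∑ i, C i, Finset.sum_nonneg fun i _ => hC i, fun i x hx => (h i x hx).trans
    (Finset.single_le_sum (fun i _ => hC i) (Finset.mem_univ i))⟩

lemma hessian_absorb {X Y a1 a2 a3 a4 a5 D1 D2 D3 C T Z k1 k2 k3 k4 k5 : ℝ}
    (h : X ≤ Y + D1 - 2 * a4 - 1 / 2 * a5)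
    (hY : Y = -a1 - a2 + a3 + D2 + D3)
    (h1 : |a1| ≤ 1 / 4 * X + k1 * T) (h2 : |a2| ≤ 1 * T + k2 * Z) (h3 : |a3| ≤ 1 * T + k3 * Z)
    (h4 : |2 * a4| ≤ 1 / 4 * X + k4 * Z) (h5 : |a5| ≤ k5 * Z)
    (hT : 0 ≤ T) (hZ : 0 ≤ Z) (hC : C = 2 * (k1 + 2 + k2 + k3 + k4 + k5))
    (k10 : 0 ≤ k1) (k20 : 0 ≤ k2) (k30 : 0 ≤ k3) (k40 : 0 ≤ k4) (k50 : 0 ≤ k5) :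
    X ≤ C * (T + Z) + 2 * (D1 + D2 + D3) := by
  have h1 := neg_abs_le a1
  have h2 := neg_abs_le a2
  have h3 := le_abs_self a3
  have h4 := neg_abs_le (2 * a4)
  have h5 := neg_abs_le a5
  have m1 : 0 ≤ (2 * k2 + 2 * k3 + 2 * k4 + 2 * k5) * T := by positivity
  have m2 : 0 ≤ (2 * k1 + 4 + k5) * Z := by positivity
  rw [hC]
  linear_combination 2 * h + 2 * hY + 2 * h1 + 2 * h2 + 2 * h3 + 2 * h4 + h5 + m1 + m2 +
    2 * ‹|a1| ≤ _› + 2 * ‹|a2| ≤ _› + 2 * ‹|a3| ≤ _› + 2 * ‹|2 * a4| ≤ _› + ‹|a5| ≤ _›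

set_option maxHeartbeats 1000000 in
/-- Integral bound for the second derivatives of `u` in the case `p < 1`. -/
lemma IsSys.hessian_le (hΩ : IsOpen Ω) (hK : IsCompact K) (hKΩ : K ⊆ Ω)
    (hθ : IsCutoff K θ) (hA : ContDiffOn ℝ 2 A Ω) (hp : 0 < p) (hp1 : p < 1) (k : ℕ) :
    ∃ C : ℝ, 0 ≤ C ∧ ∀ (B u v : Euc N → ℝ) (q : ℝ), IsSys Ω A B p q u v → ∀ j,
      LeMod K (fun x => θ x ^ (2 * k + 6) * v x ^ (1 - p) * gdot (pd j u) (pd j u) x)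
        fun x => C * (v x ^ (p + 1) * θ x ^ (2 * k + 4) +
          v x ^ (1 - p) * gdot u u x * θ x ^ (2 * k + 2)) := by
  have hA1 := hA.of_le one_le_two
  obtain ⟨a, ha, haA⟩ := exists_upper_bound hK (hA.continuousOn.mono hKΩ)
  obtain ⟨a', ha', haA'⟩ := exists_pd_bound hΩ hK hKΩ hA1
  obtain ⟨C1, hC1, H1⟩ := hθ.pow_bound (2 * k + 5)
  obtain ⟨C2, hC2, H2⟩ := hθ.pow_bound (2 * k + 4)
  refine ⟨2 * (a ^ 2 + 2 + a ^ 2 * C1 + a' ^ 2 + 4 * C1 + C2),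
    by positivity, fun B u v q hs j => ?_⟩
  have cw : ContDiffOn ℝ 2 (fun x => v x ^ (1 - p)) Ω :=
    hs.cv.rpow_const_of_ne fun x hx => (hs.v_pos x hx).ne'
  have cg := contDiffOn_pd_one j hΩ hs.cu
  have cψ : ContDiff ℝ 2 fun x => θ x ^ (2 * k + 6) := hθ.contDiff.pow _
  have ψ0 : ∀ x ∉ K, θ x ^ (2 * k + 6) = 0 := fun x hx => by simp [hθ.eq_zero x hx]
  have cψ1 := (cψ.of_le one_le_two).contDiffOn (s := Ω)
  have cw1 := cw.of_le one_le_two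
  have cv1 := hs.cv.of_le one_le_two
  have cf : ContDiffOn ℝ 1 (fun y => θ y ^ (2 * k + 6) * v y ^ (1 - p) * pd j u y) Ω :=
    (cψ1.mul cw1).mul cg
  obtain ⟨D1, hD1, d1⟩ := caccioppoli hs.isOpen hK hKΩ cw (hs.lap_rpow_nonpos hp.le hp1.le) cg
    cψ.contDiffOn (fun x => pow_nonneg (hθ.nonneg x) _) ψ0
  have hD2 := NullOn.sum Finset.univ hK fun i => nullOn_comm i j hΩ hK hKΩ
    (contDiffOn_pd_one i hΩ hs.cu) cf fun x hx => by simp [ψ0 x hx]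
  have hD3 := (nullOn_pd j hΩ hK hKΩ (f := fun x => A x * v x * θ x ^ (2 * k + 6) * pd j u x)
    (((hA1.mul cv1).mul cψ1).mul cg) fun x hx => by simp [ψ0 x hx]).const_mul (-(1 - p))
  refine ⟨_, ((hD1.add hK hD2).add hK hD3).const_mul 2, fun x hx => ?_⟩
  have hxΩ := hKΩ hx
  have d1 := d1 x hx
  have hv := hs.v_pos x hxΩ
  have t0 := hθ.nonneg x
  have t1 := hθ.le_one x
  have haAx := haA x hx
  have haAx' := haA' j x hx
  have dv := diffAt_of_contDiffOn hΩ cv1 hxΩ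
  have dw := diffAt_of_contDiffOn hΩ cw1 hxΩ
  have dψ := diffAt_of_contDiffOn hΩ cψ1 hxΩ
  have dg := diffAt_of_contDiffOn hΩ cg hxΩ
  have dA := diffAt_of_contDiffOn hΩ hA1 hxΩ
  have hw : 0 < v x ^ (1 - p) := Real.rpow_pos_of_pos hv _
  have hvp : 0 < v x ^ (p + 1) := Real.rpow_pos_of_pos hv _
  have ew : v x ^ p * v x ^ (1 - p) = v x := by
    rw [← Real.rpow_add hv]; simp
  have ew1 : v x ^ p * v x ^ (1 - p - 1) = 1 := by
    rw [← Real.rpow_add hv]; simp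
  have ew2 : v x ^ (p + 1) * v x ^ (1 - p) = v x ^ 2 := by
    rw [← Real.rpow_add hv, ← Real.rpow_natCast]; congr 1; push_cast; ring
  have h1 := (H1 x).1
  have h2 := (H2 x).2
  have G0 := gdot_self_nonneg u x
  have G0' := gdot_self_nonneg (pd j u) x
  have gj := pd_sq_le_gdot j u x
  have gjj := pd_sq_le_gdot j (pd j u) x
  have hψj := (pd_sq_le_gdot j (fun y => θ y ^ (2 * k + 6)) x).trans h1
  have gsq := (gdot_sq_le (fun y => θ y ^ (2 * k + 6)) (pd j u) x).trans
    (mul_le_mul_of_nonneg_right h1 G0')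
  have hp46 : θ x ^ (2 * k + 6) ≤ θ x ^ (2 * k + 4) := pow_le_pow_of_le_one t0 t1 (by omega)
  have hp26 : θ x ^ (2 * k + 6) ≤ θ x ^ (2 * k + 2) := pow_le_pow_of_le_one t0 t1 (by omega)
  have hp24 : θ x ^ (2 * k + 4) ≤ θ x ^ (2 * k + 2) := pow_le_pow_of_le_one t0 t1 (by omega)
  have hpp : (θ x ^ (2 * k + 5)) ^ 2 ≤ θ x ^ (2 * k + 2) * θ x ^ (2 * k + 4) := by
    rw [← pow_mul, ← pow_add]; exact pow_le_pow_of_le_one t0 t1 (by omega)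
  have hpp' : (θ x ^ (2 * k + 5)) ^ 2 ≤ θ x ^ (2 * k + 6) * θ x ^ (2 * k + 2) := by
    rw [← pow_mul, ← pow_add]; exact pow_le_pow_of_le_one t0 t1 (by omega)
  have key : gdot (fun y => θ y ^ (2 * k + 6) * v y ^ (1 - p) * pd j u y) (pd j u) x =
      -(p * A x * (v x * θ x ^ (2 * k + 6) * pd j (pd j u) x)) -
      p * A x * (v x * pd j (fun y => θ y ^ (2 * k + 6)) x * pd j u x) +
      (1 - p) * pd j A x * (v x * θ x ^ (2 * k + 6) * pd j u x) +
      (∑ i, (pd i (fun y => θ y ^ (2 * k + 6) * v y ^ (1 - p) * pd j u y) x * pd j (pd i u) x -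
        pd i (pd i u) x * pd j (fun y => θ y ^ (2 * k + 6) * v y ^ (1 - p) * pd j u y) x)) +
      -(1 - p) * pd j (fun x => A x * v x * θ x ^ (2 * k + 6) * pd j u x) x := by
    rw [Finset.sum_sub_distrib, ← Finset.sum_mul, ← lap_eq_sum hΩ hs.cu hxΩ, hs.lap_u x hxΩ]
    have e : ∑ i, pd i (fun y => θ y ^ (2 * k + 6) * v y ^ (1 - p) * pd j u y) x *
        pd j (pd i u) x = gdot (fun y => θ y ^ (2 * k + 6) * v y ^ (1 - p) * pd j u y)
          (pd j u) x := Finset.sum_congr rfl fun i _ => by rw [pd_pd_comm j i hΩ hs.cu hxΩ]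
    rw [e, pd_mul j (dψ.fun_mul dw) dg, pd_mul j dψ dw, pd_rpow j _ dv hv.ne',
      pd_mul j ((dA.fun_mul dv).fun_mul dψ) dg, pd_mul j (dA.fun_mul dv) dψ, pd_mul j dA dv]
    linear_combination (-A x * pd j u x * θ x ^ (2 * k + 6) * (1 - p) * pd j v x) * ew1 -
      A x * (θ x ^ (2 * k + 6) * pd j (pd j u) x + pd j u x *
        pd j (fun y => θ y ^ (2 * k + 6)) x) * ew
  beta_reduce at d1 ⊢
  set ψj := pd j (fun y => θ y ^ (2 * k + 6)) x
  set gψ := gdot (fun y => θ y ^ (2 * k + 6)) (pd j u) x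
  set g := pd j u x
  set gg := pd j (pd j u) x
  set w := v x ^ (1 - p)
  set vp := v x ^ (p + 1)
  set G := gdot u u x
  set H := gdot (pd j u) (pd j u) x
  set L := lap (fun y => θ y ^ (2 * k + 6)) x
  have pA : |p * A x| ≤ a := by
    rw [abs_mul, abs_of_pos hp]
    nlinarith [abs_nonneg (A x)]
  have pA' : |(1 - p) * pd j A x| ≤ a' := by
    rw [abs_mul, abs_of_pos (by linarith : 0 < 1 - p)]
    nlinarith [abs_nonneg (pd j A x)]
  have T0 : 0 ≤ vp * θ x ^ (2 * k + 4) := by positivity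
  have Z0 : 0 ≤ w * G * θ x ^ (2 * k + 2) := by positivity
  have X0 : 0 ≤ θ x ^ (2 * k + 6) * w * H := by positivity
  have sqle : ∀ {s t : ℝ}, |s| ≤ t → s ^ 2 ≤ t ^ 2 := fun h => by
    rw [← sq_abs]; exact pow_le_pow_left₀ (abs_nonneg _) h 2
  refine hessian_absorb (a4 := g * w * gψ) (a5 := w * g ^ 2 * L)
    (k1 := a ^ 2) (k2 := a ^ 2 * C1) (k3 := a' ^ 2) (k4 := 4 * C1) (k5 := C2)
    (T := vp * θ x ^ (2 * k + 4)) (Z := w * G * θ x ^ (2 * k + 2)) ?_ key ?_ ?_ ?_ ?_ ?_ T0 Z0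
    rfl (by positivity) (by positivity) (by positivity) (by positivity) (by positivity)
  · linarith only [d1]
  · refine (mul_le_add_of_sq_le (α := θ x ^ (2 * k + 6) * w * H) (β := vp * θ x ^ (2 * k + 4))
      (ε := 1 / 4) X0 T0 (by norm_num) ?_).trans ?_
    · calc (v x * θ x ^ (2 * k + 6) * gg) ^ 2
          = v x ^ 2 * θ x ^ (2 * k + 6) * θ x ^ (2 * k + 6) * gg ^ 2 := by ring
        _ ≤ v x ^ 2 * θ x ^ (2 * k + 6) * θ x ^ (2 * k + 4) * H := by gcongr
        _ = _ := by rw [← ew2]; ring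
    · have := mul_le_mul_of_nonneg_right (sqle pA) T0
      linarith only [this]
  · refine (mul_le_add_of_sq_le (α := vp * θ x ^ (2 * k + 4)) (β := C1 * (w * G * θ x ^ (2 * k + 2)))
      (ε := 1) T0 (by positivity) (by norm_num) ?_).trans ?_
    · calc (v x * ψj * g) ^ 2 = v x ^ 2 * ψj ^ 2 * g ^ 2 := by ring
        _ ≤ v x ^ 2 * (C1 * (θ x ^ (2 * k + 2) * θ x ^ (2 * k + 4))) * G := by
          gcongr
          exact hψj.trans (mul_le_mul_of_nonneg_left hpp hC1)
        _ = _ := by rw [← ew2]; ring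
    · have := mul_le_mul_of_nonneg_right (sqle pA) (mul_nonneg hC1 Z0)
      have : 0 ≤ a ^ 2 * (C1 * (w * G * θ x ^ (2 * k + 2))) := by positivity
      linarith only [this, ‹(p * A x) ^ 2 * _ ≤ _›]
  · refine (mul_le_add_of_sq_le (α := vp * θ x ^ (2 * k + 4)) (β := w * G * θ x ^ (2 * k + 2))
      (ε := 1) T0 Z0 (by norm_num) ?_).trans ?_
    · calc (v x * θ x ^ (2 * k + 6) * g) ^ 2
          = v x ^ 2 * (θ x ^ (2 * k + 6) * θ x ^ (2 * k + 6)) * g ^ 2 := by ring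
        _ ≤ v x ^ 2 * (θ x ^ (2 * k + 2) * θ x ^ (2 * k + 4)) * G := by gcongr
        _ = _ := by rw [← ew2]; ring
    · have := mul_le_mul_of_nonneg_right (sqle pA') Z0
      have : 0 ≤ a' ^ 2 * (w * G * θ x ^ (2 * k + 2)) := by positivity
      linarith only [this, ‹((1 - p) * pd j A x) ^ 2 * _ ≤ _›]
  · refine (mul_le_add_of_sq_le (α := θ x ^ (2 * k + 6) * w * H)
      (β := C1 * (w * G * θ x ^ (2 * k + 2)))
      (ε := 1 / 4) X0 (by positivity) (by norm_num) ?_).trans (le_of_eq (by ring))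
    calc (g * w * gψ) ^ 2 = g ^ 2 * w ^ 2 * gψ ^ 2 := by ring
        _ ≤ G * w ^ 2 * (C1 * (θ x ^ (2 * k + 6) * θ x ^ (2 * k + 2)) * H) := by
          gcongr
          exact gsq.trans (mul_le_mul_of_nonneg_right (mul_le_mul_of_nonneg_left hpp' hC1) G0')
        _ = _ := by ring
  · rw [abs_mul, abs_of_nonneg (by positivity : 0 ≤ w * g ^ 2)]
    calc w * g ^ 2 * |L| ≤ w * G * (C2 * θ x ^ (2 * k + 2)) := by
          gcongr
          exact h2.trans (mul_le_mul_of_nonneg_left hp24 hC2)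
        _ = _ := by ring

end FluxBounds

section FluxBounds

variable {N : ℕ} {Ω K E : Set (Euc N)} {A B u v θ : Euc N → ℝ} {p q : ℝ}

/-- Uniform bounds, over a class `S` of pairs, for the terms of the Pohozaev flux localized to
the set `E`. -/
def FluxBdd (K E : Set (Euc N)) (p q : ℝ) (S : (Euc N → ℝ) → (Euc N → ℝ) → Prop) : Prop :=
  (∀ χ : Euc N → ℝ, ContDiff ℝ 1 χ → (∀ x ∉ E, χ x = 0) → ∃ C : ℝ, ∀ u v, S u v →
    (∀ i j, LeMod K (fun x => χ x * (pd j u x * pd i v x)) fun _ => C) ∧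
    (∀ i, LeMod K (fun x => χ x * (v x * pd i u x)) fun _ => C) ∧
    ∀ i, LeMod K (fun x => χ x * (u x * pd i v x)) fun _ => C) ∧
  ∀ χ : Euc N → ℝ, ContinuousOn χ K → (∀ x ∉ E, χ x = 0) → ∃ C : ℝ, ∀ u v, S u v →
    LeMod K (fun x => χ x * v x ^ (p + 1)) (fun _ => C) ∧
    LeMod K (fun x => χ x * u x ^ (q + 1)) fun _ => C

lemma LeMod.of_supp {χ R En : Euc N → ℝ} {C M c c' : ℝ} (h : LeMod K En fun _ => C)
    (h0 : ∀ x ∈ K, 0 ≤ En x) (hM : ∀ x ∈ K, |χ x| ≤ M) (hM0 : 0 ≤ M) (hχ : ∀ x ∉ E, χ x = 0)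
    (hR : ∀ x ∈ K, x ∈ E → |R x| ≤ c * En x + c') (hc : 0 ≤ c) (hc' : 0 ≤ c') :
    LeMod K (fun x => χ x * R x) fun _ => M * (c * C + c') := by
  obtain ⟨D, hD, hd⟩ := h
  refine ⟨_, hD.const_mul (M * c), fun x hx => ?_⟩
  have h1 : χ x * R x ≤ M * (c * En x + c') := by
    by_cases hxE : x ∈ E
    · calc χ x * R x ≤ |χ x| * |R x| := by rw [← abs_mul]; exact le_abs_self _
        _ ≤ _ := mul_le_mul (hM x hx) (hR x hx hxE) (abs_nonneg _) hM0
    · rw [hχ x hxE, zero_mul]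
      have := h0 x hx
      positivity
  have h2 := mul_le_mul_of_nonneg_left (hd x hx) (mul_nonneg hM0 hc)
  beta_reduce
  linarith

lemma FluxBdd.of_energy (hΩ : IsOpen Ω) (hK : IsCompact K) (hKΩ : K ⊆ Ω) (hE : IsClosed E)
    (hEK : E ⊆ K) {S : (Euc N → ℝ) → (Euc N → ℝ) → Prop}
    {En : (Euc N → ℝ) → (Euc N → ℝ) → Euc N → ℝ} {c C : ℝ} (hc : 0 ≤ c)
    (hS : ∀ u v, S u v → ContDiffOn ℝ 1 u Ω ∧ ContDiffOn ℝ 1 v Ω ∧ (∀ x ∈ Ω, 0 < u x) ∧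
      ∀ x ∈ Ω, 0 < v x)
    (hEn : ∀ u v, S u v → LeMod K (En u v) (fun _ => C) ∧ (∀ x ∈ K, 0 ≤ En u v x) ∧
      ∀ x ∈ K, x ∈ E → v x ^ (p + 1) ≤ En u v x ∧ u x ^ (q + 1) ≤ En u v x ∧
        (∀ i, |v x * pd i u x| ≤ c * En u v x + c) ∧ |u x * v x| ≤ c * En u v x + c)
    (hprod : ∀ χ : Euc N → ℝ, ContDiff ℝ 1 χ → (∀ x ∉ E, χ x = 0) → ∃ C : ℝ, ∀ u v, S u v →
      ∀ i j, LeMod K (fun x => χ x * (pd j u x * pd i v x)) fun _ => C) :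
    FluxBdd K E p q S := by
  refine ⟨fun χ cχ hχ => ?_, fun χ cχ hχ => ?_⟩
  · obtain ⟨C1, h1⟩ := hprod χ cχ hχ
    obtain ⟨M, hM, hMχ⟩ := exists_upper_bound hK cχ.continuous.continuousOn
    obtain ⟨M', hM', hMχ'⟩ := exists_pd_bound isOpen_univ hK (subset_univ _) cχ.contDiffOn
    have hχ' : ∀ i, ∀ x ∉ E, pd i χ x = 0 := fun i x hx => pd_eq_zero_of_notMem i hE hχ hx
    set C2 := M * (c * C + c)
    set C3 := M * (c * C + c) + M' * (c * C + c)
    refine ⟨max C1 (max C2 C3), fun u v huv => ⟨fun i j => (h1 u v huv i j).of_le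
      (fun x _ => le_rfl) fun x _ => le_max_left _ _, fun i => ?_, fun i => ?_⟩⟩
    · obtain ⟨e1, e2, e3⟩ := hEn u v huv
      exact (e1.of_supp e2 hMχ hM hχ (fun x hx hxE => (e3 x hx hxE).2.2.1 i) hc hc).of_le
        (fun x _ => le_rfl) fun x _ => (le_max_left _ _).trans (le_max_right _ _)
    · obtain ⟨e1, e2, e3⟩ := hEn u v huv
      obtain ⟨cu, cv, -, -⟩ := hS u v huv
      have f1 := e1.of_supp e2 (χ := fun x => -χ x) (by simpa using hMχ) hM
        (by simpa using hχ) (fun x hx hxE => (e3 x hx hxE).2.2.1 i) hc hc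
      have f2 := e1.of_supp e2 (χ := fun x => -pd i χ x) (by simpa using hMχ' i) hM'
        (by simpa using hχ' i) (fun x hx hxE => (e3 x hx hxE).2.2.2) hc hc
      obtain ⟨D, hD, hd⟩ := f1.add hK f2
      refine LeMod.of_le ⟨_, hD.add hK (nullOn_pd i hΩ hK hKΩ
        (f := fun x => u x * v x * χ x) ((cu.mul cv).mul cχ.contDiffOn)
        fun x hx => by simp [hχ x fun h => hx (hEK h)]), fun x hx => ?_⟩
        (fun x _ => le_rfl) fun x _ => (le_max_right C2 C3).trans (le_max_right C1 _)
      have hd := hd x hx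
      have du := diffAt_of_contDiffOn hΩ cu (hKΩ hx)
      have dv := diffAt_of_contDiffOn hΩ cv (hKΩ hx)
      have dχ := cχ.differentiable one_ne_zero x
      beta_reduce at hd ⊢
      rw [pd_mul i (du.fun_mul dv) dχ, pd_mul i du dv]
      linear_combination hd
  · obtain ⟨M, hM, hMχ⟩ := exists_upper_bound hK cχ
    refine ⟨M * (1 * C + 0), fun u v huv => ?_⟩
    obtain ⟨e1, e2, e3⟩ := hEn u v huv
    obtain ⟨-, -, hu, hv⟩ := hS u v huv
    refine ⟨e1.of_supp e2 hMχ hM hχ (fun x hx hxE => ?_) zero_le_one le_rfl,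
      e1.of_supp e2 hMχ hM hχ (fun x hx hxE => ?_) zero_le_one le_rfl⟩
    · rw [abs_of_nonneg (Real.rpow_nonneg (hv x (hKΩ hx)).le _)]
      linarith [(e3 x hx hxE).1]
    · rw [abs_of_nonneg (Real.rpow_nonneg (hu x (hKΩ hx)).le _)]
      linarith [(e3 x hx hxE).2.1]

/-- The flux bounds for stable solutions in the case `p < 1`. -/
lemma fluxBdd_of_lt_one (hΩ : IsOpen Ω) (hK : IsCompact K) (hKΩ : K ⊆ Ω) (hE : IsClosed E)
    (hEK : E ⊆ K) (hθ : IsCutoff K θ) (hθE : ∀ x ∈ E, θ x = 1) (hA : ContDiffOn ℝ 2 A Ω)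
    (hB : ContDiffOn ℝ 2 B Ω) (hA0 : ∀ x ∈ K, 0 < A x) (hB0 : ∀ x ∈ K, 0 < B x)
    (hp : 0 < p) (hq : 0 < q) (hp1 : p < 1) (hpq : 1 < p * q) :
    FluxBdd K E p q fun u v => IsSys Ω A B p q u v ∧ IsStab Ω A B p q u v := by
  have hs2 : 1 / (p + 1) + 1 / (q + 1) < 1 := by
    rw [div_add_div _ _ (by positivity) (by positivity), div_lt_one (by positivity)]
    nlinarith
  obtain ⟨k, C1, hC1, H1⟩ := IsSys.energy_le_of_lt_one hK hKΩ hθ (hA.continuousOn.mono hKΩ)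
    (hB.continuousOn.mono hKΩ) hA0 hB0 hp hq hp1 hpq
  obtain ⟨C2, hC2, H2⟩ := IsSys.hessian_le hΩ hK hKΩ hθ hA hp hp1 k
  obtain ⟨C3, hC3, H3⟩ := young_uv (k := 0) (k' := 0) hp hq zero_le_one zero_le_one hs2 one_pos
    (by simp)
  set En : (Euc N → ℝ) → (Euc N → ℝ) → Euc N → ℝ := fun u v x =>
    ((v x ^ (p + 1) + u x ^ (q + 1)) * θ x ^ (2 * k + 4) +
        v x ^ (1 - p) * gdot u u x * θ x ^ (2 * k + 2)) +
      ∑ j, θ x ^ (2 * k + 6) * v x ^ (1 - p) * gdot (pd j u) (pd j u) x with hEn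
  have bound : ∀ u v, IsSys Ω A B p q u v → IsStab Ω A B p q u v →
      LeMod K (En u v) fun _ => C1 + ∑ _j : Fin N, C2 * C1 := fun u v hs hst => by
    have h1 := H1 u v hs hst
    refine h1.add hK (LeMod.sum Finset.univ hK fun j => (H2 B u v q hs j).trans hK
      ((h1.of_le (fun x hx => ?_) fun x _ => le_rfl).const_mul hC2))
    have hu := hs.u_pos x (hKΩ hx)
    have := mul_nonneg (Real.rpow_pos_of_pos hu (q + 1)).le (pow_nonneg (hθ.nonneg x) (2 * k + 4))
    linarith
  have nonneg : ∀ u v, IsSys Ω A B p q u v → ∀ x ∈ K, 0 ≤ En u v x := fun u v hs x hx => by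
    have hu := hs.u_pos x (hKΩ hx)
    have hv := hs.v_pos x (hKΩ hx)
    have t0 := hθ.nonneg x
    have := gdot_self_nonneg u x
    have := fun j => gdot_self_nonneg (pd j u) x
    have : 0 ≤ ∑ j, θ x ^ (2 * k + 6) * v x ^ (1 - p) * gdot (pd j u) (pd j u) x :=
      Finset.sum_nonneg fun j _ => mul_nonneg (by positivity) (this j)
    simp only [hEn]
    positivity
  -- bounds on the set where `θ = 1`
  have pw : ∀ u v, IsSys Ω A B p q u v → ∀ x ∈ K, x ∈ E →
      v x ^ (p + 1) ≤ En u v x ∧ u x ^ (q + 1) ≤ En u v x ∧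
        (∀ i, |v x * pd i u x| ≤ En u v x) ∧ |u x * v x| ≤ En u v x + C3 ∧
        ∀ i j, |v x * pd i (pd j u) x| ≤ En u v x := fun u v hs x hx hxE => by
    have hu := hs.u_pos x (hKΩ hx)
    have hv := hs.v_pos x (hKΩ hx)
    have hw : 0 < v x ^ (1 - p) := Real.rpow_pos_of_pos hv _
    have hvp : 0 < v x ^ (p + 1) := Real.rpow_pos_of_pos hv _
    have huq : 0 < u x ^ (q + 1) := Real.rpow_pos_of_pos hu _
    have g0 := gdot_self_nonneg u x
    have gj := fun j => gdot_self_nonneg (pd j u) x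
    have e : En u v x = (v x ^ (p + 1) + u x ^ (q + 1)) + v x ^ (1 - p) * gdot u u x +
        ∑ j, v x ^ (1 - p) * gdot (pd j u) (pd j u) x := by
      simp only [hEn, hθE x hxE, one_pow, mul_one, one_mul]
    have s0 : ∀ j, v x ^ (1 - p) * gdot (pd j u) (pd j u) x ≤
        ∑ j, v x ^ (1 - p) * gdot (pd j u) (pd j u) x := fun j =>
      Finset.single_le_sum (f := fun j => v x ^ (1 - p) * gdot (pd j u) (pd j u) x)
        (fun i _ => mul_nonneg hw.le (gj i)) (Finset.mem_univ j)
    have s1 : 0 ≤ ∑ j, v x ^ (1 - p) * gdot (pd j u) (pd j u) x :=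
      Finset.sum_nonneg fun j _ => mul_nonneg hw.le (gj j)
    have s2 : 0 ≤ v x ^ (1 - p) * gdot u u x := by positivity
    have ew2 : v x ^ (p + 1) * v x ^ (1 - p) = v x ^ 2 := by
      rw [← Real.rpow_add hv, ← Real.rpow_natCast]; congr 1; push_cast; ring
    have young : ∀ {d G : ℝ}, 0 ≤ G → d ^ 2 ≤ G → |v x * d| ≤ v x ^ (p + 1) + v x ^ (1 - p) * G :=
      fun {d G} hG hd => by
        have := mul_le_add_of_sq_le (s := v x * d) (c := 1) (ε := 1) hvp.le (mul_nonneg hw.le hG)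
          one_pos (by
            rw [mul_pow, ← mul_assoc, ew2]
            exact mul_le_mul_of_nonneg_left hd (sq_nonneg _))
        rw [one_mul] at this
        nlinarith [mul_nonneg hw.le hG]
    rw [e]
    refine ⟨by linarith, by linarith, fun i => ?_, ?_, fun i j => ?_⟩
    · linarith [young g0 (pd_sq_le_gdot i u x)]
    · have := H3 (u x) (v x) 1 hu hv zero_le_one le_rfl
      simp only [Real.rpow_one, one_pow, mul_one, one_mul] at this
      rw [abs_of_pos (mul_pos hu hv)]
      linarith
    · linarith [young (gj j) (pd_sq_le_gdot i (pd j u) x), s0 j]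
  refine FluxBdd.of_energy (En := En) (c := 1 + C3) hΩ hK hKΩ hE hEK (by positivity)
    (fun u v ⟨hs, _⟩ => ⟨hs.cu.of_le one_le_two, hs.cv.of_le one_le_two, hs.u_pos, hs.v_pos⟩)
    (fun u v ⟨hs, hst⟩ => ⟨bound u v hs hst, nonneg u v hs, fun x hx hxE => ?_⟩)
    fun χ cχ hχ => ?_
  · obtain ⟨a1, a2, a3, a4, -⟩ := pw u v hs x hx hxE
    have n := nonneg u v hs x hx
    have n' := mul_nonneg hC3 n
    exact ⟨a1, a2, fun i => by linarith [a3 i], by linarith⟩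
  · obtain ⟨M, hM, hMχ⟩ := exists_upper_bound hK cχ.continuous.continuousOn
    obtain ⟨M', hM', hMχ'⟩ := exists_pd_bound isOpen_univ hK (subset_univ _) cχ.contDiffOn
    have hχ' : ∀ i, ∀ x ∉ E, pd i χ x = 0 := fun i x hx => pd_eq_zero_of_notMem i hE hχ hx
    refine ⟨M * (1 * (C1 + ∑ _j : Fin N, C2 * C1) + 0) + M' * (1 * (C1 + ∑ _j : Fin N, C2 * C1) + 0),
      fun u v ⟨hs, hst⟩ i j => ?_⟩
    have e1 := bound u v hs hst
    have e2 := nonneg u v hs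
    have e3 := pw u v hs
    have f1 := e1.of_supp e2 (χ := fun x => -χ x) (R := fun x => v x * pd i (pd j u) x)
      (c := 1) (c' := 0) (by simpa using hMχ) hM (by simpa using hχ)
      (fun x hx hxE => by linarith [(e3 x hx hxE).2.2.2.2 i j]) zero_le_one le_rfl
    have f2 := e1.of_supp e2 (χ := fun x => -pd i χ x) (R := fun x => v x * pd j u x)
      (c := 1) (c' := 0) (by simpa using hMχ' i) hM'
      (by simpa using hχ' i) (fun x hx hxE => by linarith [(e3 x hx hxE).2.2.1 j])
      zero_le_one le_rfl
    obtain ⟨D, hD, hd⟩ := f1.add hK f2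
    have cv := hs.cv.of_le one_le_two
    have cu := contDiffOn_pd_one j hΩ hs.cu
    refine ⟨_, hD.add hK (nullOn_pd i hΩ hK hKΩ (f := fun x => pd j u x * v x * χ x)
      ((cu.mul cv).mul cχ.contDiffOn) fun x hx => by simp [hχ x fun h => hx (hEK h)]),
      fun x hx => ?_⟩
    have hd := hd x hx
    have du := diffAt_of_contDiffOn hΩ cu (hKΩ hx)
    have dv := diffAt_of_contDiffOn hΩ cv (hKΩ hx)
    have dχ := cχ.differentiable one_ne_zero x
    beta_reduce at hd ⊢
    rw [pd_mul i (du.fun_mul dv) dχ, pd_mul i du dv]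
    linear_combination hd

end FluxBounds

section Pohozaev

variable {N : ℕ} {Ω K E : Set (Euc N)} {A B u v f g η : Euc N → ℝ} {p q : ℝ} {x : Euc N}

/-- The radial derivative `x · ∇f`. -/
def rd (f : Euc N → ℝ) (x : Euc N) : ℝ := ∑ j, x j * pd j f x

lemma rd_mul (hf : DifferentiableAt ℝ f x) (hg : DifferentiableAt ℝ g x) :
    rd (fun y => f y * g y) x = f x * rd g x + rd f x * g x := by
  simp only [rd, Finset.mul_sum, Finset.sum_mul, ← Finset.sum_add_distrib]
  exact Finset.sum_congr rfl fun i _ => by rw [pd_mul i hf hg]; ring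

lemma rd_const_mul (c : ℝ) (hf : DifferentiableAt ℝ f x) :
    rd (fun y => c * f y) x = c * rd f x := by
  simp only [rd, Finset.mul_sum]
  exact Finset.sum_congr rfl fun i _ => by rw [pd_const_mul i c hf]; ring

lemma rd_rpow (c : ℝ) (hf : DifferentiableAt ℝ f x) (h0 : f x ≠ 0) :
    rd (fun y => f y ^ c) x = c * f x ^ (c - 1) * rd f x := by
  simp only [rd, Finset.mul_sum]
  exact Finset.sum_congr rfl fun i _ => by rw [pd_rpow i c hf h0]; ring

lemma contDiffOn_coord (j : Fin N) : ContDiffOn ℝ 1 (fun x : Euc N => x j) Ω :=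
  (EuclideanSpace.proj (𝕜 := ℝ) j).contDiff.contDiffOn

lemma rd_contDiffOn (hΩ : IsOpen Ω) (hf : ContDiffOn ℝ 2 f Ω) : ContDiffOn ℝ 1 (rd f) Ω :=
  ContDiffOn.sum fun j _ => (contDiffOn_coord j).mul (contDiffOn_pd_one j hΩ hf)

lemma gdot_contDiffOn (hΩ : IsOpen Ω) (hf : ContDiffOn ℝ 2 f Ω) (hg : ContDiffOn ℝ 2 g Ω) :
    ContDiffOn ℝ 1 (gdot f g) Ω :=
  ContDiffOn.sum fun j _ => (contDiffOn_pd_one j hΩ hf).mul (contDiffOn_pd_one j hΩ hg)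

lemma pd_sum {ι : Type*} (s : Finset ι) (i : Fin N) {F : ι → Euc N → ℝ}
    (h : ∀ j ∈ s, DifferentiableAt ℝ (F j) x) :
    pd i (fun y => ∑ j ∈ s, F j y) x = ∑ j ∈ s, pd i (F j) x := by
  simp only [pd]
  rw [fderiv_fun_sum h]
  simp

lemma pd_rd (i : Fin N) (hΩ : IsOpen Ω) (hf : ContDiffOn ℝ 2 f Ω) (hx : x ∈ Ω) :
    pd i (rd f) x = pd i f x + ∑ j, x j * pd i (pd j f) x := by
  have d : ∀ j, DifferentiableAt ℝ (pd j f) x := fun j =>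
    diffAt_of_contDiffOn hΩ (contDiffOn_pd_one j hΩ hf) hx
  unfold rd
  rw [pd_sum _ _ fun j _ => (differentiableAt_coord j).fun_mul (d j)]
  simp only [pd_mul i (differentiableAt_coord _) (d _), pd_coord, Finset.sum_add_distrib]
  simp

lemma pd_gdot (i : Fin N) (hΩ : IsOpen Ω) (hf : ContDiffOn ℝ 2 f Ω) (hg : ContDiffOn ℝ 2 g Ω)
    (hx : x ∈ Ω) :
    pd i (gdot f g) x = ∑ j, (pd j f x * pd i (pd j g) x + pd i (pd j f) x * pd j g x) := by
  have d : ∀ j {f : Euc N → ℝ}, ContDiffOn ℝ 2 f Ω → DifferentiableAt ℝ (pd j f) x :=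
    fun j _ hf => diffAt_of_contDiffOn hΩ (contDiffOn_pd_one j hΩ hf) hx
  unfold gdot
  rw [pd_sum _ _ fun j _ => (d j hf).fun_mul (d j hg)]
  exact Finset.sum_congr rfl fun j _ => (pd_mul i (d j hf) (d j hg)).trans (add_comm _ _)

lemma gdot_rd_add (hΩ : IsOpen Ω) (hf : ContDiffOn ℝ 2 f Ω) (hg : ContDiffOn ℝ 2 g Ω)
    (hx : x ∈ Ω) :
    gdot (rd f) g x + gdot (rd g) f x = 2 * gdot f g x + rd (gdot f g) x := by
  have e : ∀ {f g : Euc N → ℝ}, ContDiffOn ℝ 2 f Ω → gdot (rd f) g x = gdot f g x +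
      ∑ i, ∑ j, x i * (pd i (pd j f) x * pd j g x) := fun {f g} hf => by
    rw [Finset.sum_comm]
    simp only [gdot, ← Finset.sum_add_distrib]
    refine Finset.sum_congr rfl fun i _ => ?_
    rw [pd_rd i hΩ hf hx, add_mul, Finset.sum_mul]
    congr 1
    exact Finset.sum_congr rfl fun j _ => by rw [pd_pd_comm i j hΩ hf hx]; ring
  rw [e hf, e hg, gdot_comm g f]
  have : rd (gdot f g) x = ∑ i, ∑ j, x i * (pd i (pd j f) x * pd j g x) +
      ∑ i, ∑ j, x i * (pd i (pd j g) x * pd j f x) := by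
    simp only [rd, ← Finset.sum_add_distrib]
    refine Finset.sum_congr rfl fun i _ => ?_
    rw [pd_gdot i hΩ hf hg hx, Finset.mul_sum]
    exact Finset.sum_congr rfl fun j _ => by ring
  rw [this]
  ring

lemma nullOn_rd (hΩ : IsOpen Ω) (hK : IsCompact K) (hKΩ : K ⊆ Ω) (hf : ContDiffOn ℝ 1 f Ω)
    (h0 : ∀ x ∉ K, f x = 0) : NullOn K fun x => rd f x + N * f x := by
  refine (NullOn.sum Finset.univ hK fun i => nullOn_pd i hΩ hK hKΩ
    (f := fun x => x i * f x) ((contDiffOn_coord i).mul hf) fun x hx => by simp [h0 x hx]).congr hK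
    fun x hx => ?_
  have df := diffAt_of_contDiffOn hΩ hf (hKΩ hx)
  simp only [pd_mul _ (differentiableAt_coord _) df, pd_coord, Finset.sum_add_distrib, rd]
  simp [Finset.sum_const, add_comm]

/-- The part of the Pohozaev flux which is linear in the gradients. -/
def fluxBase (l m : ℝ) (u v η : Euc N → ℝ) (x : Euc N) : ℝ :=
  rd v x * gdot η u x + rd u x * gdot η v x - gdot u v x * rd η x + l * (v x * gdot η u x) +
    m * (u x * gdot η v x)

/-- The Pohozaev identity with cutoff `η`. -/
lemma IsSys.pohozaev {a b l m c : ℝ} (hs : IsSys Ω A B p q u v) (hK : IsCompact K) (hKΩ : K ⊆ Ω)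
    (hp : 0 < p) (hq : 0 < q)
    (hA : ∀ x ∈ Ω, rd A x = a * A x) (hB : ∀ x ∈ Ω, rd B x = b * B x)
    (hm : m = (N + b) / (q + 1)) (hl : l = N - 2 - m) (hc : c = (N + a) / (p + 1) - l)
    (hη : ContDiff ℝ 2 η) (h0 : ∀ x ∉ K, η x = 0) :
    NullOn K fun x => c * (A x * v x ^ (p + 1) * η x) + fluxBase l m u v η x +
      (A x / (p + 1) * v x ^ (p + 1) + B x / (q + 1) * u x ^ (q + 1)) * rd η x := by
  have hΩ := hs.isOpen
  have cη := (hη.of_le one_le_two).contDiffOn (s := Ω)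
  have cu := hs.cu.of_le one_le_two
  have cv := hs.cv.of_le one_le_two
  have cA := hs.cA.of_le one_le_two
  have cB := hs.cB.of_le one_le_two
  have cvp : ContDiffOn ℝ 1 (fun x => v x ^ (p + 1)) Ω :=
    cv.rpow_const_of_ne fun x hx => (hs.v_pos x hx).ne'
  have cuq : ContDiffOn ℝ 1 (fun x => u x ^ (q + 1)) Ω :=
    cu.rpow_const_of_ne fun x hx => (hs.u_pos x hx).ne'
  have cru := rd_contDiffOn hΩ hs.cu
  have crv := rd_contDiffOn hΩ hs.cv
  have cG := gdot_contDiffOn hΩ hs.cu hs.cv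
  have D1 := nullOn_div hΩ hK hKΩ (cη.mul crv) hs.cu (Or.inl fun x hx => by simp [h0 x hx])
  have D2 := nullOn_div hΩ hK hKΩ (cη.mul cru) hs.cv (Or.inl fun x hx => by simp [h0 x hx])
  have D3 := nullOn_rd hΩ hK hKΩ (f := fun x => η x * gdot u v x) (cη.mul cG)
    fun x hx => by simp [h0 x hx]
  have D4 := nullOn_rd hΩ hK hKΩ (f := fun x => η x * ((p + 1)⁻¹ * (A x * v x ^ (p + 1))))
    (cη.mul (contDiffOn_const.mul (cA.mul cvp))) fun x hx => by simp [h0 x hx]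
  have D4' := nullOn_rd hΩ hK hKΩ (f := fun x => η x * ((q + 1)⁻¹ * (B x * u x ^ (q + 1))))
    (cη.mul (contDiffOn_const.mul (cB.mul cuq))) fun x hx => by simp [h0 x hx]
  have D5 := (nullOn_div hΩ hK hKΩ (cη.mul cv) hs.cu
    (Or.inl fun x hx => by simp [h0 x hx])).const_mul l
  have D6 := (nullOn_div hΩ hK hKΩ (cη.mul cu) hs.cv
    (Or.inl fun x hx => by simp [h0 x hx])).const_mul m
  refine NullOn.congr hK ((((((D1.add hK D2).add hK (D3.const_mul (-1))).add hK D4).add hK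
    D4').add hK D5).add hK D6) fun x hx => ?_
  have hxΩ := hKΩ hx
  have dη := diffAt_of_contDiffOn hΩ cη hxΩ
  have du := diffAt_of_contDiffOn hΩ cu hxΩ
  have dv := diffAt_of_contDiffOn hΩ cv hxΩ
  have dA := diffAt_of_contDiffOn hΩ cA hxΩ
  have dB := diffAt_of_contDiffOn hΩ cB hxΩ
  have dvp := diffAt_of_contDiffOn hΩ cvp hxΩ
  have duq := diffAt_of_contDiffOn hΩ cuq hxΩ
  have dG := diffAt_of_contDiffOn hΩ cG hxΩ
  have hu := hs.u_pos x hxΩ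
  have hv := hs.v_pos x hxΩ
  have e := gdot_rd_add hΩ hs.cu hs.cv hxΩ
  rw [gdot_mul dη (diffAt_of_contDiffOn hΩ crv hxΩ), gdot_mul dη (diffAt_of_contDiffOn hΩ cru hxΩ),
    gdot_mul dη dv, gdot_mul dη du, rd_mul dη dG, rd_mul dη ((dA.fun_mul dvp).const_mul _),
    rd_mul dη ((dB.fun_mul duq).const_mul _), rd_const_mul _ (dA.fun_mul dvp),
    rd_const_mul _ (dB.fun_mul duq), rd_mul dA dvp, rd_mul dB duq, rd_rpow _ dv hv.ne',
    rd_rpow _ du hu.ne', hA x hxΩ, hB x hxΩ, hs.lap_u x hxΩ, hs.lap_v x hxΩ, gdot_comm v u,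
    add_sub_cancel_right, add_sub_cancel_right, Real.rpow_add_one hv.ne', Real.rpow_add_one hu.ne']
  have hm' : m * (q + 1) = N + b := by rw [hm]; field_simp
  have hc' : (c + l) * (p + 1) = N + a := by rw [hc]; field_simp; ring
  have hp1 : (p + 1) * (p + 1)⁻¹ = 1 := mul_inv_cancel₀ (by positivity)
  have hq1 : (q + 1) * (q + 1)⁻¹ = 1 := mul_inv_cancel₀ (by positivity)
  rw [fluxBase, div_eq_mul_inv, div_eq_mul_inv]
  linear_combination (-η x) * e - η x * gdot u v x * hl + (η x * B x * u x ^ q * u x * (q+1)⁻¹) * hm'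
    + (η x * A x * v x ^ p * v x * (p+1)⁻¹) * hc' -
    (η x * A x * v x ^ p * ((c + l) * v x + rd v x)) * hp1 -
    (η x * B x * u x ^ q * (m * u x + rd u x)) * hq1

lemma fluxBase_le {S : (Euc N → ℝ) → (Euc N → ℝ) → Prop} (hK : IsCompact K)
    (h : FluxBdd K E p q S) (l m : ℝ) (hη : ContDiff ℝ 2 η) (h0 : ∀ i, ∀ x ∉ E, pd i η x = 0) :
    ∃ C, ∀ u v, S u v → LeMod K (fluxBase l m u v η) fun _ => C := by
  have cp : ∀ i, ContDiff ℝ 1 (pd i η) := fun i =>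
    contDiffOn_univ.1 (contDiffOn_pd_one i isOpen_univ hη.contDiffOn)
  have cc : ∀ j : Fin N, ContDiff ℝ 1 fun x : Euc N => x j := fun j =>
    contDiffOn_univ.1 (contDiffOn_coord j)
  have crd : ContDiff ℝ 1 (rd η) := contDiffOn_univ.1 (rd_contDiffOn isOpen_univ hη.contDiffOn)
  have hrd : ∀ x ∉ E, rd η x = 0 := fun x hx => by simp [rd, h0 _ x hx]
  choose C1 h1 using fun i j => h.1 (fun x => x j * pd i η x) ((cc j).mul (cp i))
    (fun x hx => by simp [h0 i x hx])
  obtain ⟨C2, h2⟩ := h.1 (fun x => -rd η x) crd.neg (fun x hx => by simp [hrd x hx])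
  choose C3 h3 using fun i => h.1 (fun x => l * pd i η x) (contDiff_const.mul (cp i))
    (fun x hx => by simp [h0 i x hx])
  choose C4 h4 using fun i => h.1 (fun x => m * pd i η x) (contDiff_const.mul (cp i))
    (fun x hx => by simp [h0 i x hx])
  refine ⟨((((∑ i, ∑ j, C1 i j) + ∑ i, ∑ j, C1 i j) + ∑ _j : Fin N, C2) + ∑ i, C3 i) + ∑ i, C4 i,
    fun u v huv => ?_⟩
  refine LeMod.of_le (((((LeMod.sum Finset.univ hK fun i => LeMod.sum Finset.univ hK
    fun j => (h1 i j u v huv).1 j i).add hK (LeMod.sum Finset.univ hK fun i =>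
    LeMod.sum Finset.univ hK fun j => (h1 i j u v huv).1 i j)).add hK
    (LeMod.sum Finset.univ hK fun j => (h2 u v huv).1 j j)).add hK
    (LeMod.sum Finset.univ hK fun i => (h3 i u v huv).2.1 i)).add hK
    (LeMod.sum Finset.univ hK fun i => (h4 i u v huv).2.2 i)) (fun x hx => le_of_eq ?_)
    fun x _ => le_rfl
  have e : ∀ f g : Euc N → ℝ, rd g x * gdot η f x =
      ∑ i, ∑ j, x j * pd i η x * (pd i f x * pd j g x) := fun f g => by
    rw [rd, gdot, Finset.sum_mul_sum, Finset.sum_comm]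
    exact Finset.sum_congr rfl fun i _ => Finset.sum_congr rfl fun j _ => by ring
  have e3 : -(gdot u v x * rd η x) = ∑ j, -rd η x * (pd j u x * pd j v x) := by
    rw [gdot, ← Finset.mul_sum]
    ring
  have e' : ∀ (c : ℝ) (f g : Euc N → ℝ), c * (g x * gdot η f x) =
      ∑ i, c * pd i η x * (g x * pd i f x) := fun c f g => by
    rw [gdot, Finset.mul_sum, Finset.mul_sum]
    exact Finset.sum_congr rfl fun i _ => by ring
  rw [fluxBase, sub_eq_add_neg, e, e, e3, e', e']
  congr 4
  exact Finset.sum_congr rfl fun i _ => Finset.sum_congr rfl fun j _ => by ring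

/-- Flux bounds from an energy which controls both gradients. -/
lemma FluxBdd.of_gradient (hΩ : IsOpen Ω) (hK : IsCompact K) (hKΩ : K ⊆ Ω) (hE : IsClosed E)
    (hEK : E ⊆ K) {S : (Euc N → ℝ) → (Euc N → ℝ) → Prop}
    {En : (Euc N → ℝ) → (Euc N → ℝ) → Euc N → ℝ} {C : ℝ}
    (hS : ∀ u v, S u v → ContDiffOn ℝ 1 u Ω ∧ ContDiffOn ℝ 1 v Ω ∧ (∀ x ∈ Ω, 0 < u x) ∧
      ∀ x ∈ Ω, 0 < v x)
    (hEn : ∀ u v, S u v → LeMod K (En u v) (fun _ => C) ∧ (∀ x ∈ K, 0 ≤ En u v x) ∧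
      ∀ x ∈ K, x ∈ E → v x ^ (p + 1) ≤ En u v x ∧ u x ^ (q + 1) ≤ En u v x ∧
        gdot u u x ≤ En u v x ∧ gdot v v x ≤ En u v x ∧ u x ^ 2 ≤ En u v x ∧
        v x ^ 2 ≤ En u v x) : FluxBdd K E p q S := by
  have prod : ∀ {s t e : ℝ}, s ^ 2 ≤ e → t ^ 2 ≤ e → |s * t| ≤ e := fun {s t e} h1 h2 =>
    abs_le.2 ⟨by nlinarith [sq_nonneg (s + t)], by nlinarith [sq_nonneg (s - t)]⟩
  refine FluxBdd.of_energy (En := En) (c := 1) (C := C) hΩ hK hKΩ hE hEK zero_le_one hS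
    (fun u v huv => ?_) fun χ cχ hχ => ?_
  · obtain ⟨e1, e2, e3⟩ := hEn u v huv
    refine ⟨e1, e2, fun x hx hxE => ?_⟩
    obtain ⟨a1, a2, a3, a4, a5, a6⟩ := e3 x hx hxE
    exact ⟨a1, a2, fun i => by linarith [prod a6 ((pd_sq_le_gdot i u x).trans a3)],
      by linarith [prod a5 a6]⟩
  · obtain ⟨M, hM, hMχ⟩ := exists_upper_bound hK cχ.continuous.continuousOn
    refine ⟨M * (1 * C + 0), fun u v huv i j => ?_⟩
    obtain ⟨e1, e2, e3⟩ := hEn u v huv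
    refine e1.of_supp e2 hMχ hM hχ (fun x hx hxE => ?_) zero_le_one le_rfl
    obtain ⟨a1, a2, a3, a4, a5, a6⟩ := e3 x hx hxE
    linarith [prod ((pd_sq_le_gdot j u x).trans a3) ((pd_sq_le_gdot i v x).trans a4)]

end Pohozaev

section NormPower

variable {N : ℕ} {Ω : Set (Euc N)} {p q a b α β R : ℝ} {u v f : Euc N → ℝ} {x : Euc N}

lemma norm_rpow_eq (c : ℝ) (x : Euc N) : ‖x‖ ^ c = (‖x‖ ^ 2) ^ (c / 2) := by
  rw [← Real.rpow_natCast, ← Real.rpow_mul (norm_nonneg x)]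
  congr 1
  push_cast
  ring

lemma norm_sq_pos_of_ne (hx : x ≠ 0) : 0 < ‖x‖ ^ 2 := by
  have := norm_pos_iff.2 hx
  positivity

lemma contDiffOn_norm_rpow (c : ℝ) : ContDiffOn ℝ 2 (fun x : Euc N => ‖x‖ ^ c) {x | x ≠ 0} := by
  simp only [norm_rpow_eq c]
  exact (contDiff_norm_sq ℝ).contDiffOn.rpow_const_of_ne fun x hx => (norm_sq_pos_of_ne hx).ne'

lemma pd_norm_rpow (i : Fin N) (c : ℝ) (hx : x ≠ 0) :
    pd i (fun y : Euc N => ‖y‖ ^ c) x = c * ‖x‖ ^ (c - 2) * x i := by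
  simp only [norm_rpow_eq c]
  rw [pd_rpow i _ ((contDiff_norm_sq ℝ (n := 1)).differentiable one_ne_zero x)
    (norm_sq_pos_of_ne hx).ne', pd_norm_sq, norm_rpow_eq (c - 2), sub_div]
  norm_num
  ring

lemma norm_rpow_sub_two_mul (c : ℝ) (hx : x ≠ 0) : ‖x‖ ^ (c - 2) * ‖x‖ ^ 2 = ‖x‖ ^ c := by
  rw [← Real.rpow_natCast, ← Real.rpow_add (norm_pos_iff.2 hx)]
  congr 1
  push_cast
  ring

lemma rd_norm_rpow (c : ℝ) (hx : x ≠ 0) : rd (fun y : Euc N => ‖y‖ ^ c) x = c * ‖x‖ ^ c := by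
  simp only [rd, pd_norm_rpow _ c hx]
  rw [← norm_rpow_sub_two_mul c hx, ← sum_coord_sq, ← mul_assoc, Finset.mul_sum]
  exact Finset.sum_congr rfl fun i _ => by ring

lemma gdot_norm_rpow (c : ℝ) (f : Euc N → ℝ) (hx : x ≠ 0) :
    gdot (fun y : Euc N => ‖y‖ ^ c) f x = c * ‖x‖ ^ (c - 2) * rd f x := by
  simp only [gdot, pd_norm_rpow _ c hx, rd, Finset.mul_sum]
  exact Finset.sum_congr rfl fun i _ => by ring

lemma lap_norm_rpow (c : ℝ) (hx : x ≠ 0) :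
    lap (fun y : Euc N => ‖y‖ ^ c) x = c * (c + N - 2) * ‖x‖ ^ (c - 2) := by
  simp only [norm_rpow_eq c]
  rw [lap_rpow _ isOpen_ne_zero (contDiff_norm_sq ℝ).contDiffOn
    (fun y hy => norm_sq_pos_of_ne hy) hx, lap_norm_sq]
  have e : ∑ i : Fin N, pd i (fun y : Euc N => ‖y‖ ^ 2) x ^ 2 = 4 * ‖x‖ ^ 2 := by
    simp only [pd_norm_sq]
    rw [← sum_coord_sq, Finset.mul_sum]
    exact Finset.sum_congr rfl fun i _ => by ring
  have e2 : (‖x‖ ^ 2) ^ (c / 2 - 2) * ‖x‖ ^ 2 = (‖x‖ ^ 2) ^ (c / 2 - 1) := by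
    rw [← Real.rpow_add_one (norm_sq_pos_of_ne hx).ne']
    congr 1
    ring
  rw [e, norm_rpow_eq (c - 2), sub_div, div_self two_ne_zero]
  linear_combination (4 * (c / 2) * (c / 2 - 1)) * e2

end NormPower

section PosSol

variable {N : ℕ} {Ω Ω' : Set (Euc N)} {p q a b α β R : ℝ} {u v f : Euc N → ℝ} {x : Euc N}

/-- Positive solutions of the Hénon–Lane–Emden system. -/
structure PosSol (p q a b : ℝ) (u v : Euc N → ℝ) : Prop where
  cu : ContDiffOn ℝ 2 u {x | x ≠ 0}
  cv : ContDiffOn ℝ 2 v {x | x ≠ 0}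
  cont_u : Continuous u
  cont_v : Continuous v
  u_pos : ∀ x, 0 < u x
  v_pos : ∀ x, 0 < v x
  lap_u : ∀ x ≠ 0, lap u x = -(‖x‖ ^ a * v x ^ p)
  lap_v : ∀ x ≠ 0, lap v x = -(‖x‖ ^ b * u x ^ q)

lemma PosSol.swap (h : PosSol p q a b u v) : PosSol q p b a v u :=
  ⟨h.cv, h.cu, h.cont_v, h.cont_u, h.v_pos, h.u_pos, h.lap_v, h.lap_u⟩

lemma IsHLESol.posSol (h : IsHLESol p q a b u v) (hu : ∀ x, 0 < u x) (hv : ∀ x, 0 < v x) :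
    PosSol p q a b u v := by
  obtain ⟨cu, cv, cont_u, cont_v, hlu, hlv⟩ := h
  refine ⟨cu, cv, cont_u, cont_v, hu, hv, fun x hx => ?_, fun x hx => ?_⟩
  · have := hlu x hx
    rw [abs_of_pos (hv x), ← Real.rpow_add_one (hv x).ne', sub_add_cancel] at this
    linarith
  · have := hlv x hx
    rw [abs_of_pos (hu x), ← Real.rpow_add_one (hu x).ne', sub_add_cancel] at this
    linarith

lemma PosSol.isSys (h : PosSol p q a b u v) (hΩ : IsOpen Ω) (h0 : Ω ⊆ {x | x ≠ 0}) :
    IsSys Ω (fun x => ‖x‖ ^ a) (fun x => ‖x‖ ^ b) p q u v where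
  isOpen := hΩ
  cu := h.cu.mono h0
  cv := h.cv.mono h0
  cA := (contDiffOn_norm_rpow a).mono h0
  cB := (contDiffOn_norm_rpow b).mono h0
  u_pos _ _ := h.u_pos _
  v_pos _ _ := h.v_pos _
  A_pos _ hx := Real.rpow_pos_of_pos (norm_pos_iff.2 (h0 hx)) _
  B_pos _ hx := Real.rpow_pos_of_pos (norm_pos_iff.2 (h0 hx)) _
  lap_u x hx := h.lap_u x (h0 hx)
  lap_v x hx := h.lap_v x (h0 hx)

lemma contDiffOn_comp_smul (hR : 0 < R) (hf : ContDiffOn ℝ 2 f {x | x ≠ 0}) :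
    ContDiffOn ℝ 2 (fun x => f (R • x)) {x | x ≠ 0} :=
  hf.comp (contDiff_const_smul R).contDiffOn fun _ hx => smul_ne_zero hR.ne' hx

lemma norm_smul_rpow (hR : 0 < R) (c : ℝ) (x : Euc N) : ‖R • x‖ ^ c = R ^ c * ‖x‖ ^ c := by
  rw [norm_smul, Real.norm_of_nonneg hR.le, Real.mul_rpow hR.le (norm_nonneg _)]

lemma lap_scale_eq (hf : ContDiffOn ℝ 2 f Ω) (hΩ : IsOpen Ω) (hx : R • x ∈ Ω)
    (k : ℝ) : lap (fun y => k * f (R • y)) x = k * R ^ 2 * lap f (R • x) := by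
  have hΩ' : IsOpen ((fun y : Euc N => R • y) ⁻¹' Ω) := hΩ.preimage (continuous_const_smul R)
  have hf' : ContDiffOn ℝ 2 (fun y => f (R • y)) ((fun y : Euc N => R • y) ⁻¹' Ω) :=
    hf.comp (contDiff_const_smul R).contDiffOn fun y hy => hy
  rw [lap_const_mul k hΩ' hf' hx, lap_comp_smul R hΩ hf hx]
  ring

/-- Scaling invariance of the system. -/
lemma PosSol.scale (h : PosSol p q a b u v) (hR : 0 < R) (hα : p * β = α + 2 + a)
    (hβ : q * α = β + 2 + b) :
    PosSol p q a b (fun x => R ^ α * u (R • x)) fun x => R ^ β * v (R • x) where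
  cu := contDiffOn_const.mul (contDiffOn_comp_smul hR h.cu)
  cv := contDiffOn_const.mul (contDiffOn_comp_smul hR h.cv)
  cont_u := (h.cont_u.comp (continuous_const_smul R)).const_mul _
  cont_v := (h.cont_v.comp (continuous_const_smul R)).const_mul _
  u_pos x := mul_pos (Real.rpow_pos_of_pos hR _) (h.u_pos _)
  v_pos x := mul_pos (Real.rpow_pos_of_pos hR _) (h.v_pos _)
  lap_u x hx := by
    have hx' := smul_ne_zero hR.ne' hx
    rw [lap_scale_eq h.cu isOpen_ne_zero hx', h.lap_u _ hx', norm_smul_rpow hR,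
      Real.mul_rpow (Real.rpow_nonneg hR.le _) (h.v_pos _).le, ← Real.rpow_mul hR.le,
      mul_comm β p, hα, Real.rpow_add hR, Real.rpow_add hR, Real.rpow_two]
    ring
  lap_v x hx := by
    have hx' := smul_ne_zero hR.ne' hx
    rw [lap_scale_eq h.cv isOpen_ne_zero hx', h.lap_v _ hx', norm_smul_rpow hR,
      Real.mul_rpow (Real.rpow_nonneg hR.le _) (h.u_pos _).le, ← Real.rpow_mul hR.le,
      mul_comm α q, hβ, Real.rpow_add hR, Real.rpow_add hR, Real.rpow_two]
    ring

lemma stab_scale_aux (hR : 0 < R) (hα : p * β = α + 2 + a) {s t n l : ℝ} (hs : 0 < s)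
    (h : p * (R ^ a * n) * s ^ (p - 1) * t ≤ l) :
    p * n * (R ^ β * s) ^ (p - 1) * (R ^ β * t) ≤ R ^ α * R ^ 2 * l := by
  rw [Real.mul_rpow (Real.rpow_nonneg hR.le _) hs.le, ← Real.rpow_mul hR.le]
  have e : R ^ (β * (p - 1)) * R ^ β = R ^ α * R ^ 2 * R ^ a := by
    rw [← Real.rpow_two, ← Real.rpow_add hR, ← Real.rpow_add hR, ← Real.rpow_add hR]
    congr 1
    linarith
  have := mul_le_mul_of_nonneg_left h (by positivity : 0 ≤ R ^ α * R ^ 2)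
  linear_combination this + (p * n * s ^ (p - 1) * t) * e

/-- Scaling of the stability condition. -/
lemma HLEStableOn.scale (h : HLEStableOn p q a b u v Ω) (hΩ : IsOpen Ω) (hu : ∀ x, 0 < u x)
    (hv : ∀ x, 0 < v x) (hR : 0 < R) (hα : p * β = α + 2 + a) (hβ : q * α = β + 2 + b)
    (hΩ' : ∀ x ∈ Ω', R • x ∈ Ω) :
    IsStab Ω' (fun x => ‖x‖ ^ a) (fun x => ‖x‖ ^ b) p q (fun x => R ^ α * u (R • x))
      fun x => R ^ β * v (R • x) := by
  obtain ⟨ξ, ζ, cξ, cζ, hξ, hζ, h1, h2⟩ := h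
  refine ⟨fun x => R ^ α * ξ (R • x), fun x => R ^ β * ζ (R • x),
    contDiffOn_const.mul (cξ.comp (contDiff_const_smul R).contDiffOn hΩ'),
    contDiffOn_const.mul (cζ.comp (contDiff_const_smul R).contDiffOn hΩ'),
    fun x hx => mul_pos (Real.rpow_pos_of_pos hR _) (hξ _ (hΩ' x hx)),
    fun x hx => mul_pos (Real.rpow_pos_of_pos hR _) (hζ _ (hΩ' x hx)), fun x hx => ?_,
    fun x hx => ?_⟩
  · have := h1 _ (hΩ' x hx)
    rw [norm_smul_rpow hR] at this
    rw [lap_scale_eq cξ hΩ (hΩ' x hx), ← mul_neg]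
    exact stab_scale_aux hR hα (hv _) this
  · have := h2 _ (hΩ' x hx)
    rw [norm_smul_rpow hR] at this
    rw [lap_scale_eq cζ hΩ (hΩ' x hx), ← mul_neg]
    exact stab_scale_aux hR hβ (hu _) this

end PosSol

open Filter Topology Pointwise

section Flux

variable {N : ℕ} {Ω K E : Set (Euc N)} {A B u v f g η η' θ : Euc N → ℝ} {p q l m M : ℝ} {x : Euc N}

/-- The Pohozaev flux. -/
def flux (A B : Euc N → ℝ) (p q l m : ℝ) (u v η : Euc N → ℝ) (x : Euc N) : ℝ :=
  fluxBase l m u v η x +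
    (A x / (p + 1) * v x ^ (p + 1) + B x / (q + 1) * u x ^ (q + 1)) * rd η x

lemma flux_sub (hη : DifferentiableAt ℝ η x) (hη' : DifferentiableAt ℝ η' x) :
    flux A B p q l m u v (fun y => η y - η' y) x =
      flux A B p q l m u v η x - flux A B p q l m u v η' x := by
  have e : ∀ f : Euc N → ℝ, gdot (fun y => η y - η' y) f x = gdot η f x - gdot η' f x := fun f => by
    simp only [gdot, ← Finset.sum_sub_distrib]
    exact Finset.sum_congr rfl fun i _ => by rw [pd_sub i hη hη']; ring
  have e' : rd (fun y => η y - η' y) x = rd η x - rd η' x := by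
    simp only [rd, ← Finset.sum_sub_distrib]
    exact Finset.sum_congr rfl fun i _ => by rw [pd_sub i hη hη']; ring
  simp only [flux, fluxBase, e, e']
  ring

lemma flux_eq_zero (h : ∀ i, pd i η x = 0) : flux A B p q l m u v η x = 0 := by
  simp [flux, fluxBase, rd, gdot, h]

lemma flux_neg (hη : DifferentiableAt ℝ η x) :
    flux A B p q l m u v (fun y => -η y) x = -flux A B p q l m u v η x := by
  have := flux_sub (A := A) (B := B) (p := p) (q := q) (l := l) (m := m) (u := u) (v := v)
    (x := x) (η := fun _ => 0) (η' := η) (differentiableAt_const 0) hη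
  simp only [zero_sub] at this
  rw [this, flux_eq_zero (η := fun _ => 0) fun i => pd_const i 0, zero_sub]

lemma flux_continuousOn (hΩ : IsOpen Ω) (hKΩ : K ⊆ Ω) (cA : ContinuousOn A Ω)
    (cB : ContinuousOn B Ω) (cu : ContDiffOn ℝ 2 u Ω) (cv : ContDiffOn ℝ 2 v Ω)
    (hu : ∀ x ∈ Ω, 0 < u x) (hv : ∀ x ∈ Ω, 0 < v x) (hη : ContDiff ℝ 2 η) :
    ContinuousOn (flux A B p q l m u v η) K := by
  have ru := (rd_contDiffOn hΩ cu).continuousOn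
  have rv := (rd_contDiffOn hΩ cv).continuousOn
  have rη := (rd_contDiffOn hΩ (hη.contDiffOn (s := Ω))).continuousOn
  have gu := (gdot_contDiffOn hΩ (hη.contDiffOn (s := Ω)) cu).continuousOn
  have gv := (gdot_contDiffOn hΩ (hη.contDiffOn (s := Ω)) cv).continuousOn
  have guv := (gdot_contDiffOn hΩ cu cv).continuousOn
  have pv : ContinuousOn (fun x => v x ^ (p + 1)) Ω :=
    cv.continuousOn.rpow_const fun x hx => Or.inl (hv x hx).ne'
  have pu : ContinuousOn (fun x => u x ^ (q + 1)) Ω :=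
    cu.continuousOn.rpow_const fun x hx => Or.inl (hu x hx).ne'
  refine ContinuousOn.mono ?_ hKΩ
  exact (((((rv.mul gu).add (ru.mul gv)).sub (guv.mul rη)).add
    ((cv.continuousOn.mul gu).const_mul l)).add ((cu.continuousOn.mul gv).const_mul m)).add
    ((((cA.div_const _).mul pv).add ((cB.div_const _).mul pu)).mul rη)

lemma flux_comp_smul {δ : ℝ} {A' B' : Euc N → ℝ} (hA : A' x = δ ^ 2 * A (δ • x))
    (hB : B' x = δ ^ 2 * B (δ • x)) :
    flux A' B' p q l m (fun y => u (δ • y)) (fun y => v (δ • y)) (fun y => η (δ • y)) x =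
      δ ^ 2 * flux A B p q l m u v η (δ • x) := by
  have e : ∀ f g : Euc N → ℝ, gdot (fun y => f (δ • y)) (fun y => g (δ • y)) x =
      δ ^ 2 * gdot f g (δ • x) := fun f g => by
    simp only [gdot, pd_comp_smul, Finset.mul_sum]
    exact Finset.sum_congr rfl fun i _ => by ring
  have e' : ∀ f : Euc N → ℝ, rd (fun y => f (δ • y)) x = rd f (δ • x) := fun f => by
    simp only [rd, pd_comp_smul]
    exact Finset.sum_congr rfl fun i _ => by simp; ring
  simp only [flux, fluxBase, e, e', hA, hB]
  ring

lemma flux_le {S : (Euc N → ℝ) → (Euc N → ℝ) → Prop} (hK : IsCompact K)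
    (h : FluxBdd K E p q S) (cA : ContinuousOn A K) (cB : ContinuousOn B K) (l m : ℝ)
    (hη : ContDiff ℝ 2 η) (h0 : ∀ i, ∀ x ∉ E, pd i η x = 0) :
    ∃ C, ∀ u v, S u v → LeMod K (flux A B p q l m u v η) fun _ => C := by
  have crd : ContinuousOn (rd η) K :=
    (rd_contDiffOn isOpen_univ hη.contDiffOn).continuousOn.mono (subset_univ _)
  have hrd : ∀ x ∉ E, rd η x = 0 := fun x hx => by simp [rd, h0 _ x hx]
  obtain ⟨C1, h1⟩ := fluxBase_le hK h l m hη h0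
  obtain ⟨C2, h2⟩ := h.2 (fun x => A x / (p + 1) * rd η x) ((cA.div_const _).mul crd)
    fun x hx => by simp [hrd x hx]
  obtain ⟨C3, h3⟩ := h.2 (fun x => B x / (q + 1) * rd η x) ((cB.div_const _).mul crd)
    fun x hx => by simp [hrd x hx]
  refine ⟨C1 + (C2 + C3), fun u v huv => ((h1 u v huv).add hK ((h2 u v huv).1.add hK
    (h3 u v huv).2)).of_le (fun x _ => ?_) fun x _ => le_rfl⟩
  rw [flux]
  exact le_of_eq (by ring)

lemma IsSys.swap (h : IsSys Ω A B p q u v) : IsSys Ω B A q p v u :=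
  ⟨h.isOpen, h.cv, h.cu, h.cB, h.cA, h.v_pos, h.u_pos, h.B_pos, h.A_pos, h.lap_v, h.lap_u⟩

/-- Solutions of systems of the given form which are bounded on `K`, together with the weights. -/
def IsBddSys (Ω K : Set (Euc N)) (p q M : ℝ) (u v : Euc N → ℝ) : Prop :=
  ∃ A B, IsSys Ω A B p q u v ∧ ∀ x ∈ K, u x ≤ M ∧ v x ≤ M ∧ A x ≤ M ∧ B x ≤ M

lemma fluxBdd_of_bdd (hΩ : IsOpen Ω) (hK : IsCompact K) (hKΩ : K ⊆ Ω) (hE : IsClosed E)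
    (hEK : E ⊆ K) (hθ : IsCutoff K θ) (hθE : ∀ x ∈ E, θ x = 1) (hp : 0 < p) (hq : 0 < q)
    (hM : 0 ≤ M) : FluxBdd K E p q (IsBddSys Ω K p q M) := by
  obtain ⟨C, hC, h⟩ := IsSys.grad_le hK hKΩ hθ 0
  have hlap : ∀ x ∈ Ω, lap (fun _ : Euc N => (1 : ℝ)) x ≤ 0 := fun x _ => by rw [lap_const]
  set G : ℝ → ℝ := fun p => 2 * (M * (1 * M * M ^ p) * 1) + C * (1 * M ^ 2 * 1) with hG
  have key : ∀ {A B u v : Euc N → ℝ} {p q : ℝ}, 0 < p → IsSys Ω A B p q u v →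
      (∀ x ∈ K, u x ≤ M ∧ v x ≤ M ∧ A x ≤ M ∧ B x ≤ M) →
      LeMod K (fun x => 1 * gdot u u x * θ x ^ (2 * 0 + 2)) fun _ => G p :=
    fun {A B u v p q} hp hs hb => by
      refine (h A B u v (fun _ => 1) p q hs contDiffOn_const (fun _ _ => one_pos) hlap).of_le
        (fun x _ => le_rfl) fun x hx => ?_
      obtain ⟨b1, b2, b3, -⟩ := hb x hx
      have hu := hs.u_pos x (hKΩ hx)
      have hv := hs.v_pos x (hKΩ hx)
      have hA := hs.A_pos x (hKΩ hx)
      have t1 : θ x ^ (2 * 0 + 2) ≤ 1 := pow_le_one₀ (hθ.nonneg x) (hθ.le_one x)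
      have t2 : θ x ^ (2 * 0) ≤ 1 := pow_le_one₀ (hθ.nonneg x) (hθ.le_one x)
      have t0 := hθ.nonneg x
      simp only [hG]
      gcongr
  refine FluxBdd.of_gradient (En := fun u v x => (M ^ (p + 1) + M ^ (q + 1) + M ^ 2) +
    (1 * gdot u u x * θ x ^ (2 * 0 + 2) + 1 * gdot v v x * θ x ^ (2 * 0 + 2)))
    (C := (M ^ (p + 1) + M ^ (q + 1) + M ^ 2) + (G p + G q)) hΩ hK hKΩ hE hEK
    (fun u v ⟨A, B, hs, _⟩ => ⟨hs.cu.of_le one_le_two, hs.cv.of_le one_le_two, hs.u_pos,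
      hs.v_pos⟩) fun u v ⟨A, B, hs, hb⟩ => ?_
  have g0 := gdot_self_nonneg u
  have g1 := gdot_self_nonneg v
  have n1 : 0 ≤ M ^ (p + 1) := by positivity
  have n2 : 0 ≤ M ^ (q + 1) := by positivity
  have n3 : 0 ≤ M ^ 2 := by positivity
  refine ⟨LeMod.add hK ⟨_, NullOn.zero, fun x _ => by simp⟩ ((key hp hs hb).add hK
    (key hq hs.swap fun x hx => ⟨(hb x hx).2.1, (hb x hx).1, (hb x hx).2.2.2, (hb x hx).2.2.1⟩)),
    fun x _ => ?_, fun x hx hxE => ?_⟩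
  · have := g0 x
    have := g1 x
    have := hθ.nonneg x
    positivity
  · obtain ⟨b1, b2, -, -⟩ := hb x hx
    have hu := hs.u_pos x (hKΩ hx)
    have hv := hs.v_pos x (hKΩ hx)
    have := g0 x
    have := g1 x
    have e1 : v x ^ (p + 1) ≤ M ^ (p + 1) := by gcongr
    have e2 : u x ^ (q + 1) ≤ M ^ (q + 1) := by gcongr
    have e3 : u x ^ 2 ≤ M ^ 2 := by gcongr
    have e4 : v x ^ 2 ≤ M ^ 2 := by gcongr
    simp only [hθE x hxE, one_pow, mul_one, one_mul]
    exact ⟨by linarith, by linarith, by linarith, by linarith, by linarith, by linarith⟩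

lemma flux_le_of_bdd (hΩ : IsOpen Ω) (hK : IsCompact K) (hKΩ : K ⊆ Ω) (hE : IsClosed E)
    (hEK : E ⊆ K) (hθ : IsCutoff K θ) (hθE : ∀ x ∈ E, θ x = 1) (hp : 0 < p) (hq : 0 < q)
    (hM : 0 ≤ M) (l m : ℝ) (hη : ContDiff ℝ 2 η) (h0 : ∀ i, ∀ x ∉ E, pd i η x = 0) :
    ∃ C, ∀ A B u v, IsSys Ω A B p q u v →
      (∀ x ∈ K, u x ≤ M ∧ v x ≤ M ∧ A x ≤ M ∧ B x ≤ M) →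
      LeMod K (flux A B p q l m u v η) fun _ => C := by
  obtain ⟨C, h⟩ := fluxBase_le hK (fluxBdd_of_bdd hΩ hK hKΩ hE hEK hθ hθE hp hq hM) l m hη h0
  obtain ⟨M', hM', hb'⟩ := exists_upper_bound hK (A := rd η)
    ((rd_contDiffOn isOpen_univ hη.contDiffOn).continuousOn.mono (subset_univ _))
  refine ⟨C + (M / (p + 1) * M ^ (p + 1) + M / (q + 1) * M ^ (q + 1)) * M', fun A B u v hs hb =>
    (h u v ⟨A, B, hs, hb⟩).add hK ⟨_, NullOn.zero, fun x hx => ?_⟩⟩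
  obtain ⟨b1, b2, b3, b4⟩ := hb x hx
  have hu := hs.u_pos x (hKΩ hx)
  have hv := hs.v_pos x (hKΩ hx)
  have hA := hs.A_pos x (hKΩ hx)
  have hB := hs.B_pos x (hKΩ hx)
  rw [add_zero]
  refine (mul_le_mul_of_nonneg_left ((le_abs_self _).trans (hb' x hx)) (by positivity)).trans ?_
  beta_reduce
  gcongr

end Flux

section LocalPohozaev

variable {N : ℕ} {p q a b l m c : ℝ} {u v : Euc N → ℝ}

/-- The open neighborhood `1/2 < |x| < 3` of the shell `1 ≤ |x| ≤ 2`. -/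
def collar (N : ℕ) : Set (Euc N) := {x | 1 / 2 < ‖x‖ ∧ ‖x‖ < 3}

/-- The shell where the gradient of the cutoff lives. -/
def edge (N : ℕ) : Set (Euc N) := {x | 2 ≤ ‖x‖ ^ 2 ∧ ‖x‖ ^ 2 ≤ 3}

lemma isOpen_collar : IsOpen (collar N) :=
  (isOpen_lt continuous_const continuous_norm).inter (isOpen_lt continuous_norm continuous_const)

lemma isClosed_edge : IsClosed (edge N) :=
  (isClosed_le continuous_const (continuous_norm.pow 2)).inter
    (isClosed_le (continuous_norm.pow 2) continuous_const)

lemma collar_subset_ne_zero : collar N ⊆ {x | x ≠ 0} :=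
  fun _ hx => norm_pos_iff.1 (by linarith [hx.1])

lemma shell_subset_collar : shell N 1 2 ⊆ collar N :=
  fun _ hx => ⟨by linarith [hx.1], by linarith [hx.2]⟩

lemma edge_subset_shell : edge N ⊆ shell N 1 2 := fun x hx => by
  have := norm_nonneg x
  exact ⟨by nlinarith [hx.1], by nlinarith [hx.2]⟩

lemma shellCutoff_eq_one_of_mem_edge : ∀ x ∈ edge N, shellCutoff N x = 1 :=
  fun _ hx => shellCutoff_eq_one hx.1 hx.2

lemma pd_ballCutoff_eq_zero (i : Fin N) : ∀ x ∉ edge N, pd i (ballCutoff N) x = 0 := fun x hx => by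
  have c2 : Continuous fun y : Euc N => ‖y‖ ^ 2 := continuous_norm.pow 2
  rcases lt_or_ge (‖x‖ ^ 2) 2 with h | h
  · have : ballCutoff N =ᶠ[𝓝 x] fun _ => (1 : ℝ) := by
      filter_upwards [(isOpen_lt c2 continuous_const).mem_nhds h] with y hy
      exact ballCutoff_eq_one hy.le
    rw [pd_congr i this, pd_const]
  · have h' : 3 < ‖x‖ ^ 2 := not_le.1 fun h3 => hx ⟨h, h3⟩
    have : ballCutoff N =ᶠ[𝓝 x] fun _ => (0 : ℝ) := by
      filter_upwards [(isOpen_lt continuous_const c2).mem_nhds h'] with y hy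
      exact ballCutoff_eq_zero (le_of_lt hy)
    rw [pd_congr i this, pd_const]

lemma ballCutoffAt_nonneg (R : ℝ) (x : Euc N) : 0 ≤ ballCutoffAt N R x := ballCutoff_nonneg _

lemma ballCutoffAt_le_one (R : ℝ) (x : Euc N) : ballCutoffAt N R x ≤ 1 := ballCutoff_le_one _

lemma norm_inv_smul_sq {R : ℝ} (hR : 0 < R) (x : Euc N) :
    ‖R⁻¹ • x‖ ^ 2 = (R ^ 2)⁻¹ * ‖x‖ ^ 2 := by
  rw [norm_smul, norm_inv, Real.norm_of_nonneg hR.le, mul_pow, inv_pow]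

lemma ballCutoffAt_eq_one {R : ℝ} (hR : 0 < R) {x : Euc N} (hx : ‖x‖ ^ 2 ≤ 2 * R ^ 2) :
    ballCutoffAt N R x = 1 := by
  refine ballCutoff_eq_one ?_
  rw [norm_inv_smul_sq hR, inv_mul_le_iff₀ (by positivity)]
  linarith

lemma ballCutoffAt_eq_zero {R : ℝ} (hR : 0 < R) {x : Euc N} (hx : 3 * R ^ 2 ≤ ‖x‖ ^ 2) :
    ballCutoffAt N R x = 0 := by
  refine ballCutoff_eq_zero ?_
  rw [norm_inv_smul_sq hR, le_inv_mul_iff₀ (by positivity)]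
  linarith

lemma setIntegral_shell_smul {R : ℝ} (hR : 0 < R) (f : Euc N → ℝ) (r s : ℝ) :
    ∫ x in shell N (R * r) (R * s), f x = R ^ N * ∫ x in shell N r s, f (R • x) := by
  have e : R • shell N r s = shell N (R * r) (R * s) := by
    ext x
    rw [Set.mem_smul_set_iff_inv_smul_mem₀ hR.ne']
    simp only [shell, mem_ofPred_eq, norm_smul, norm_inv, Real.norm_of_nonneg hR.le]
    rw [inv_mul_le_iff₀ hR, le_inv_mul_iff₀ hR]
  rw [Measure.setIntegral_comp_smul_of_pos _ _ _ hR, e, finrank_euclideanSpace_fin, smul_eq_mul,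
    mul_inv_cancel_left₀ (by positivity)]

lemma PosSol.dilate (h : PosSol p q a b u v) {δ : ℝ} (hδ : 0 < δ) :
    IsSys (collar N) (fun x => δ ^ 2 * ‖δ • x‖ ^ a) (fun x => δ ^ 2 * ‖δ • x‖ ^ b) p q
      (fun x => u (δ • x)) fun x => v (δ • x) where
  isOpen := isOpen_collar
  cu := (contDiffOn_comp_smul hδ h.cu).mono collar_subset_ne_zero
  cv := (contDiffOn_comp_smul hδ h.cv).mono collar_subset_ne_zero
  cA := (contDiffOn_const.mul (contDiffOn_comp_smul hδ (contDiffOn_norm_rpow a))).mono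
    collar_subset_ne_zero
  cB := (contDiffOn_const.mul (contDiffOn_comp_smul hδ (contDiffOn_norm_rpow b))).mono
    collar_subset_ne_zero
  u_pos _ _ := h.u_pos _
  v_pos _ _ := h.v_pos _
  A_pos x hx := by
    have := norm_pos_iff.2 (smul_ne_zero hδ.ne' (collar_subset_ne_zero hx))
    positivity
  B_pos x hx := by
    have := norm_pos_iff.2 (smul_ne_zero hδ.ne' (collar_subset_ne_zero hx))
    positivity
  lap_u x hx := by
    have hx' := smul_ne_zero hδ.ne' (collar_subset_ne_zero hx)
    rw [lap_comp_smul δ isOpen_ne_zero h.cu hx', h.lap_u _ hx']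
    ring
  lap_v x hx := by
    have hx' := smul_ne_zero hδ.ne' (collar_subset_ne_zero hx)
    rw [lap_comp_smul δ isOpen_ne_zero h.cv hx', h.lap_v _ hx']
    ring

/-- The contribution of the inner cutoff to the Pohozaev identity is small. -/
lemma PosSol.setIntegral_flux_inner_le (h : PosSol p q a b u v) (hN : 3 ≤ N) (hp : 0 < p)
    (hq : 0 < q) (ha : -2 < a) (hb : -2 < b) (l m : ℝ) :
    ∃ C, 0 ≤ C ∧ ∀ δ, 0 < δ → δ ≤ 1 / 2 → ∫ x in shell N δ 2,
      flux (fun x => ‖x‖ ^ a) (fun x => ‖x‖ ^ b) p q l m u v (ballCutoffAt N δ) x ≤ C * δ := by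
  have hK := isCompact_shell (N := N) 1 2
  obtain ⟨M1, hM1, b1⟩ := exists_upper_bound (isCompact_closedBall (0 : Euc N) 1)
    h.cont_u.continuousOn
  obtain ⟨M2, hM2, b2⟩ := exists_upper_bound (isCompact_closedBall (0 : Euc N) 1)
    h.cont_v.continuousOn
  have cn : ∀ c : ℝ, ContinuousOn (fun x : Euc N => ‖x‖ ^ c) (shell N 1 2) := fun c =>
    (contDiffOn_norm_rpow c).continuousOn.mono (shell_subset_ne_zero one_pos)
  obtain ⟨M3, hM3, b3⟩ := exists_upper_bound hK (cn a)
  obtain ⟨M4, hM4, b4⟩ := exists_upper_bound hK (cn b)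
  set M := M1 + M2 + M3 + M4
  have hM : 0 ≤ M := by positivity
  obtain ⟨C, hC⟩ := flux_le_of_bdd isOpen_collar hK shell_subset_collar isClosed_edge
    edge_subset_shell shellCutoff_isCutoff shellCutoff_eq_one_of_mem_edge hp hq hM l m
    (η := ballCutoff N) ballCutoff_contDiff pd_ballCutoff_eq_zero
  refine ⟨|C| * volume.real (shell N 1 2), by positivity, fun δ hδ hδ2 => ?_⟩
  have weight : ∀ {c M' : ℝ}, -2 < c → (∀ x ∈ shell N 1 2, |‖x‖ ^ c| ≤ M') →
      ∀ x ∈ shell N 1 2, δ ^ 2 * ‖δ • x‖ ^ c ≤ M' := fun {c M'} hc hb x hx => by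
    rw [norm_smul_rpow hδ, ← mul_assoc, ← Real.rpow_two, ← Real.rpow_add hδ]
    have h1 : δ ^ (2 + c) ≤ 1 := Real.rpow_le_one hδ.le (by linarith) (by linarith)
    have h2 := (le_abs_self _).trans (hb x hx)
    have h3 : 0 ≤ ‖x‖ ^ c := by positivity
    nlinarith [Real.rpow_pos_of_pos hδ (2 + c)]
  have ball : ∀ x ∈ shell N 1 2, δ • x ∈ closedBall (0 : Euc N) 1 := fun x hx => by
    rw [mem_closedBall_zero_iff, norm_smul, Real.norm_of_nonneg hδ.le]
    nlinarith [hx.2]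
  have hs := h.dilate hδ
  have le := (hC _ _ _ _ hs fun x hx =>
    ⟨by linarith [le_abs_self (u (δ • x)), b1 _ (ball x hx)],
      by linarith [le_abs_self (v (δ • x)), b2 _ (ball x hx)],
      by linarith [weight ha b3 x hx], by linarith [weight hb b4 x hx]⟩).integral_le_const hK
    (flux_continuousOn isOpen_collar shell_subset_collar hs.cA.continuousOn hs.cB.continuousOn
      hs.cu hs.cv hs.u_pos hs.v_pos ballCutoff_contDiff)
  have sub : shell N (δ * 1) (δ * 2) ⊆ shell N δ 2 := fun x hx =>
    ⟨by linarith [hx.1], by linarith [hx.2]⟩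
  rw [setIntegral_eq_of_subset_of_forall_sdiff_eq_zero (isCompact_shell δ 2).measurableSet sub
    fun x hx => flux_eq_zero fun i => ?_, setIntegral_shell_smul hδ]
  · have e : ∀ x ∈ shell N 1 2, flux (fun x => δ ^ 2 * ‖δ • x‖ ^ a) (fun x => δ ^ 2 * ‖δ • x‖ ^ b)
        p q l m (fun x => u (δ • x)) (fun x => v (δ • x)) (ballCutoff N) x = δ ^ 2 *
        flux (fun x => ‖x‖ ^ a) (fun x => ‖x‖ ^ b) p q l m u v (ballCutoffAt N δ) (δ • x) :=
      fun x _ => by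
        rw [← flux_comp_smul (A' := fun x => δ ^ 2 * ‖δ • x‖ ^ a)
          (B' := fun x => δ ^ 2 * ‖δ • x‖ ^ b) rfl rfl]
        simp only [ballCutoffAt, inv_smul_smul₀ hδ.ne']
    rw [setIntegral_congr_fun hK.measurableSet e, integral_const_mul] at le
    have eN : δ ^ N = δ ^ 2 * (δ * δ ^ (N - 3)) := by
      rw [← pow_succ', ← pow_add]
      congr 1
      omega
    have n1 : δ ^ (N - 3) ≤ 1 := pow_le_one₀ hδ.le (by linarith)
    have n0 : 0 < δ ^ (N - 3) := by positivity
    have v0 : 0 ≤ volume.real (shell N 1 2) := measureReal_nonneg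
    set J := ∫ x in shell N 1 2, flux (fun x => ‖x‖ ^ a) (fun x => ‖x‖ ^ b) p q l m u v
      (ballCutoffAt N δ) (δ • x)
    have le' : δ ^ 2 * J ≤ |C| * volume.real (shell N 1 2) :=
      le.trans (mul_le_mul_of_nonneg_right (le_abs_self C) v0)
    calc δ ^ N * J = δ * δ ^ (N - 3) * (δ ^ 2 * J) := by rw [eN]; ring
      _ ≤ δ * δ ^ (N - 3) * (|C| * volume.real (shell N 1 2)) :=
          mul_le_mul_of_nonneg_left le' (by positivity)
      _ ≤ δ * 1 * (|C| * volume.real (shell N 1 2)) := by gcongr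
      _ = _ := by ring
  · rw [pd_ballCutoffAt, pd_ballCutoff_eq_zero, mul_zero]
    intro hE
    have := edge_subset_shell hE
    rw [shell, mem_ofPred_eq, norm_smul, norm_inv, Real.norm_of_nonneg hδ.le, inv_mul_le_iff₀ hδ,
      le_inv_mul_iff₀ hδ] at this
    exact hx.2 this

/-- A uniform bound for the energy near the origin in terms of the flux. -/
lemma energy_le_of_fluxBdd {S : (Euc N → ℝ) → (Euc N → ℝ) → Prop}
    (hF : FluxBdd (shell N 1 2) (edge N) p q S) (hS : ∀ u v, S u v → PosSol p q a b u v)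
    (hN : 3 ≤ N) (hp : 0 < p) (hq : 0 < q) (ha : -2 < a) (hb : -2 < b)
    (hm : m = (N + b) / (q + 1)) (hl : l = N - 2 - m) (hc : c = (N + a) / (p + 1) - l)
    (hc0 : 0 < c) :
    ∃ C, ∀ u v, S u v → ∀ ρ, 0 < ρ → ρ ≤ 1 →
      c * ∫ x in shell N ρ 1, ‖x‖ ^ a * v x ^ (p + 1) ≤ C := by
  have hK := isCompact_shell (N := N) 1 2
  have cn : ∀ c : ℝ, ContinuousOn (fun x : Euc N => ‖x‖ ^ c) (shell N 1 2) := fun c =>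
    (contDiffOn_norm_rpow c).continuousOn.mono (shell_subset_ne_zero one_pos)
  have dΘ : ∀ x, DifferentiableAt ℝ (ballCutoff N) x := fun x =>
    (ballCutoff_contDiff.differentiable two_ne_zero) x
  obtain ⟨C, hC⟩ := flux_le hK hF (cn a) (cn b) l m (η := fun x => -ballCutoff N x)
    ballCutoff_contDiff.neg fun i x hx => by
      have := pd_const_mul i (-1) (dΘ x)
      simp only [neg_mul, one_mul] at this
      rw [this, pd_ballCutoff_eq_zero i x hx, neg_zero]
  refine ⟨C * volume.real (shell N 1 2), fun u v huv ρ hρ hρ1 => ?_⟩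
  have h := hS u v huv
  obtain ⟨C', hC', inner⟩ := h.setIntegral_flux_inner_le hN hp hq ha hb l m
  have hs := h.isSys isOpen_ne_zero subset_rfl
  have claim : ∀ δ, 0 < δ → δ ≤ ρ / 2 → c * ∫ x in shell N ρ 1, ‖x‖ ^ a * v x ^ (p + 1) ≤
      C * volume.real (shell N 1 2) + C' * δ := fun δ hδ hδρ => by
    have hKδ := isCompact_shell (N := N) δ 2
    have sub := shell_subset_ne_zero (N := N) (s := 2) hδ
    have cΘ := ballCutoffAt_contDiff (N := N) δ
    have dΘδ : ∀ x, DifferentiableAt ℝ (ballCutoffAt N δ) x := fun x =>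
      (cΘ.differentiable two_ne_zero) x
    have pos : ∀ x : Euc N, 0 ≤ ballCutoff N x - ballCutoffAt N δ x := fun x => by
      rcases le_total (‖x‖ ^ 2) 2 with hx | hx
      · rw [ballCutoff_eq_one hx]
        linarith [ballCutoffAt_le_one δ x]
      · rw [ballCutoffAt_eq_zero hδ (by nlinarith), sub_zero]
        exact ballCutoff_nonneg x
    have poh := hs.pohozaev (l := l) (m := m) (c := c) hKδ sub hp hq
      (fun x hx => rd_norm_rpow a hx) (fun x hx => rd_norm_rpow b hx) hm hl hc
      (η := fun x => ballCutoff N x - ballCutoffAt N δ x) (ballCutoff_contDiff.sub cΘ)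
      fun x hx => by
        rcases lt_or_ge ‖x‖ δ with h1 | h1
        · have := norm_nonneg x
          rw [ballCutoffAt_eq_one hδ (by nlinarith), ballCutoff_eq_one (by nlinarith), sub_self]
        · have h2 : 2 < ‖x‖ := not_le.1 fun h2 => hx ⟨h1, h2⟩
          have : ballCutoff N x = 0 := ballCutoff_eq_zero (by nlinarith)
          linarith [pos x, ballCutoffAt_nonneg δ x]
    have cf : ∀ {η : Euc N → ℝ}, ContDiff ℝ 2 η → ContinuousOn (flux (fun x => ‖x‖ ^ a)
        (fun x => ‖x‖ ^ b) p q l m u v η) (shell N δ 2) := fun {η} hη =>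
      flux_continuousOn isOpen_ne_zero sub hs.cA.continuousOn hs.cB.continuousOn hs.cu hs.cv
        hs.u_pos hs.v_pos hη
    have cvp : ContinuousOn (fun x => ‖x‖ ^ a * v x ^ (p + 1)) (shell N δ 2) :=
      (hs.cA.continuousOn.mono sub).mul (h.cont_v.continuousOn.rpow_const
        fun x _ => Or.inl (h.v_pos x).ne')
    have cE : ContinuousOn (fun x => ‖x‖ ^ a * v x ^ (p + 1) *
        (ballCutoff N x - ballCutoffAt N δ x)) (shell N δ 2) :=
      cvp.mul (ballCutoff_contDiff.sub cΘ).continuous.continuousOn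
    have e := poh.2
    rw [setIntegral_congr_fun (g := fun x => (c * (‖x‖ ^ a * v x ^ (p + 1) *
      (ballCutoff N x - ballCutoffAt N δ x)) - flux (fun x => ‖x‖ ^ a) (fun x => ‖x‖ ^ b) p q l m
      u v (fun x => -ballCutoff N x) x) - flux (fun x => ‖x‖ ^ a) (fun x => ‖x‖ ^ b) p q l m
      u v (ballCutoffAt N δ) x) hKδ.measurableSet fun x _ => by
        beta_reduce
        have := flux_sub (A := fun x => ‖x‖ ^ a) (B := fun x => ‖x‖ ^ b) (p := p) (q := q)
          (l := l) (m := m) (u := u) (v := v) (dΘ x) (dΘδ x)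
        rw [flux_neg (dΘ x)]
        simp only [flux] at this ⊢
        linear_combination this,
      integral_sub (((cE.const_mul c).fun_sub (cf ballCutoff_contDiff.neg)).integrableOn_compact hKδ)
        ((cf cΘ).integrableOn_compact hKδ),
      integral_sub ((cE.const_mul c).integrableOn_compact hKδ)
        ((cf ballCutoff_contDiff.neg).integrableOn_compact hKδ), integral_const_mul] at e
    have s12 : shell N 1 2 ⊆ shell N δ 2 := fun x hx => ⟨by linarith [hx.1], hx.2⟩
    have le1 := (hC u v huv).integral_le_const hK ((cf ballCutoff_contDiff.neg).mono s12)
    rw [← setIntegral_eq_of_subset_of_forall_sdiff_eq_zero hKδ.measurableSet s12 fun x hx => by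
      rw [flux_neg (dΘ x), flux_eq_zero fun i => pd_ballCutoff_eq_zero i x fun h =>
        hx.2 (edge_subset_shell h), neg_zero]] at le1
    have le2 := inner δ hδ (by linarith)
    have s1 : shell N ρ 1 ⊆ shell N δ 2 := fun x hx => ⟨by linarith [hx.1], by linarith [hx.2]⟩
    have le3 : ∫ x in shell N ρ 1, ‖x‖ ^ a * v x ^ (p + 1) ≤ ∫ x in shell N δ 2,
        ‖x‖ ^ a * v x ^ (p + 1) * (ballCutoff N x - ballCutoffAt N δ x) := by
      rw [setIntegral_congr_fun (g := fun x => ‖x‖ ^ a * v x ^ (p + 1) *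
        (ballCutoff N x - ballCutoffAt N δ x)) (isCompact_shell ρ 1).measurableSet fun x hx => ?_]
      · refine setIntegral_mono_set (cE.integrableOn_compact hKδ) ?_ s1.eventuallyLE
        filter_upwards with x
        have := h.v_pos x
        have := pos x
        simp only [Pi.zero_apply]
        positivity
      · have h1 := hx.1
        have h2 := hx.2
        beta_reduce
        rw [ballCutoffAt_eq_zero hδ (by nlinarith), ballCutoff_eq_one
          (by nlinarith [norm_nonneg x]), sub_zero, mul_one]
    have le4 := mul_le_mul_of_nonneg_left le3 hc0.le
    linarith
  have lim : Tendsto (fun δ => C * volume.real (shell N 1 2) + C' * δ) (𝓝[>] 0)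
      (𝓝 (C * volume.real (shell N 1 2))) := by
    have : Tendsto (fun δ : ℝ => C * volume.real (shell N 1 2) + C' * δ) (𝓝 0)
        (𝓝 (C * volume.real (shell N 1 2) + C' * 0)) :=
      Continuous.tendsto (by fun_prop) 0
    rw [mul_zero, add_zero] at this
    exact this.mono_left nhdsWithin_le_nhds
  exact ge_of_tendsto lim (by
    filter_upwards [Ioc_mem_nhdsGT (half_pos hρ)] with δ hδ using claim δ hδ.1 hδ.2)

end LocalPohozaev

section Integral

variable {N : ℕ} {Ω K : Set (Euc N)} {A B u v w f η θ : Euc N → ℝ} {p q : ℝ} {x : Euc N}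

lemma LeMod.of_sub_le {A' B' : Euc N → ℝ} (h : LeMod K A B)
    (h' : ∀ x ∈ K, A' x - B' x ≤ A x - B x) : LeMod K A' B' := by
  obtain ⟨D, hD, hd⟩ := h
  exact ⟨D, hD, fun x hx => by linarith [h' x hx, hd x hx]⟩

/-- Green's second identity for a function supported in `K`. -/
lemma nullOn_green (hΩ : IsOpen Ω) (hK : IsCompact K) (hKΩ : K ⊆ Ω) (hη : ContDiffOn ℝ 2 η Ω)
    (hf : ContDiffOn ℝ 2 f Ω) (h0 : ∀ x ∉ K, η x = 0) :
    NullOn K fun x => η x * lap f x - f x * lap η x :=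
  ((nullOn_div hΩ hK hKΩ (hη.of_le one_le_two) hf (Or.inl h0)).add hK
    ((nullOn_div hΩ hK hKΩ (hf.of_le one_le_two) hη (Or.inr h0)).const_mul (-1))).congr hK
    fun x _ => by rw [gdot_comm f η]; ring

lemma superharmonic_le (hΩ : IsOpen Ω) (hK : IsCompact K) (hKΩ : K ⊆ Ω) (hθ : IsCutoff K θ)
    (k : ℕ) : ∃ C, 0 ≤ C ∧ ∀ (f g : Euc N → ℝ), ContDiffOn ℝ 2 f Ω → (∀ x ∈ Ω, 0 < f x) →
      (∀ x ∈ Ω, lap f x = -g x) →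
      LeMod K (fun x => g x * θ x ^ (k + 2)) fun x => C * (f x * θ x ^ k) := by
  obtain ⟨C, hC, h⟩ := hθ.pow_bound k
  refine ⟨C, hC, fun f g cf hf hg => ⟨_, (nullOn_green hΩ hK hKΩ
    (hθ.contDiff.pow (k + 2)).contDiffOn cf fun x hx => ?_).const_mul (-1), fun x hx => ?_⟩⟩
  · rw [hθ.eq_zero x hx, zero_pow (by omega)]
  · have h1 := (neg_abs_le _).trans' (neg_le_neg (h x).2)
    have h2 := mul_le_mul_of_nonneg_left h1 (hf x (hKΩ hx)).le
    beta_reduce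
    rw [hg x (hKΩ hx)]
    linarith

lemma integral_le_aux {α γ C1 C2 C3 δ V P s t a' b' : ℝ} (hα : 0 < α) (hγ : 0 < γ) (hC1 : 0 ≤ C1)
    (hC2 : 0 ≤ C2) (hδ0 : 0 < δ) (hδ : δ * (2 * (C1 * C2 + 1)) = α * γ) (hV : 0 ≤ V)
    (j1 : α * V ≤ a') (j2 : γ * P ≤ b') (j3 : s ≤ 1 + P) (j4 : t ≤ δ * V + C3) :
    t - (C3 + δ * (2 * (C1 * γ + C1 * C2 * C3) / (α * γ))) ≤
      δ * (2 / (α * γ)) * (γ * a' + C1 * b') -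
        δ * (2 / (α * γ)) * (γ * (C1 * s) + C1 * (C2 * t)) := by
  have k1 := mul_le_mul_of_nonneg_left j1 hγ.le
  have k2 := mul_le_mul_of_nonneg_left j2 hC1
  have k3 := mul_le_mul_of_nonneg_left j3 (mul_nonneg hγ.le hC1)
  have k4 := mul_le_mul_of_nonneg_left j4 (mul_nonneg hC1 hC2)
  have k5 := mul_nonneg hδ0.le hV
  have k6 : α * γ / 2 * V - (C1 * γ + C1 * C2 * C3) ≤
      γ * a' + C1 * b' - (γ * (C1 * s) + C1 * (C2 * t)) := by
    have : α * γ / 2 * V = δ * V * (C1 * C2 + 1) := by rw [← hδ]; ring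
    have : α * γ * V = 2 * (δ * V * (C1 * C2 + 1)) := by rw [← hδ]; ring
    linarith
  have k7 := mul_le_mul_of_nonneg_left k6 (by positivity : 0 ≤ δ * (2 / (α * γ)))
  have e : δ * (2 / (α * γ)) * (α * γ / 2 * V - (C1 * γ + C1 * C2 * C3)) =
      δ * V - δ * (2 * (C1 * γ + C1 * C2 * C3) / (α * γ)) := by field_simp
  rw [e] at k7
  linarith

/-- A uniform integral estimate for solutions. -/
lemma IsSys.integral_le (hΩ : IsOpen Ω) (hK : IsCompact K) (hKΩ : K ⊆ Ω) (hθ : IsCutoff K θ)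
    (hA : ContinuousOn A Ω) (hB : ContinuousOn B Ω) (hA0 : ∀ x ∈ Ω, 0 < A x)
    (hB0 : ∀ x ∈ Ω, 0 < B x) (hp : 1 < p) (hq : 1 ≤ q) :
    ∃ (k : ℕ) (C : ℝ), ∀ u v, IsSys Ω A B p q u v →
      LeMod K (fun x => v x * θ x ^ k) fun _ => C := by
  obtain ⟨α, hα, hαA⟩ := exists_pos_lower_bound hK (hA.mono hKΩ) fun x hx => hA0 x (hKΩ hx)
  obtain ⟨γ, hγ, hγB⟩ := exists_pos_lower_bound hK (hB.mono hKΩ) fun x hx => hB0 x (hKΩ hx)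
  have hp1 : 1 / p < 1 := (div_lt_one (by linarith)).2 hp
  obtain ⟨n, hn⟩ := exists_nat_mul_le hp1 4
  obtain ⟨C1, hC1, h1⟩ := superharmonic_le hΩ hK hKΩ hθ (2 * n + 2)
  obtain ⟨C2, hC2, h2⟩ := superharmonic_le hΩ hK hKΩ hθ (2 * n)
  set δ := α * γ / (2 * (C1 * C2 + 1)) with hδ
  have hδ0 : 0 < δ := by positivity
  have hδ' : δ * (2 * (C1 * C2 + 1)) = α * γ := by rw [hδ]; field_simp
  obtain ⟨C3, hC3, h3⟩ := rpow_mul_pow_le (s := 1 / p) (δ := δ) (k := 2 * n + 4) (k' := 2 * n)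
    (by positivity) hp1 hδ0 (by push_cast; exact hn n le_rfl)
  refine ⟨2 * n, C3 + δ * (2 * (C1 * γ + C1 * C2 * C3) / (α * γ)), fun u v hs => ?_⟩
  have i1 := h1 u _ hs.cu hs.u_pos hs.lap_u
  have i2 := h2 v _ hs.cv hs.v_pos hs.lap_v
  refine (((i1.const_mul hγ.le).add hK (i2.const_mul hC1)).const_mul
    (c := δ * (2 / (α * γ))) (by positivity)).of_sub_le fun x hx => ?_
  have hu := hs.u_pos x (hKΩ hx)
  have hv := hs.v_pos x (hKΩ hx)
  have t0 := hθ.nonneg x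
  have tp := pow_le_one₀ t0 (hθ.le_one x) (n := 2 * n + 2)
  have hvp : 0 < v x ^ p := Real.rpow_pos_of_pos hv _
  have huq : 0 < u x ^ q := Real.rpow_pos_of_pos hu _
  have j1 : α * (v x ^ p * θ x ^ (2 * n + 2 + 2)) ≤ A x * v x ^ p * θ x ^ (2 * n + 2 + 2) := by
    rw [mul_assoc (A x)]
    exact mul_le_mul_of_nonneg_right (hαA x hx) (by positivity)
  have j2 : γ * (u x ^ q * θ x ^ (2 * n + 2)) ≤ B x * u x ^ q * θ x ^ (2 * n + 2) := by
    rw [mul_assoc (B x)]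
    exact mul_le_mul_of_nonneg_right (hγB x hx) (by positivity)
  have j3 : u x * θ x ^ (2 * n + 2) ≤ 1 + u x ^ q * θ x ^ (2 * n + 2) := by
    have : u x ≤ 1 + u x ^ q := by
      rcases le_total (u x) 1 with h | h
      · linarith
      · linarith [Real.self_le_rpow_of_one_le h hq]
    have := mul_le_mul_of_nonneg_right this (pow_nonneg t0 (2 * n + 2))
    linarith
  have j4 := h3 (v x ^ p) (θ x) hvp.le t0 (hθ.le_one x)
  rw [← Real.rpow_mul hv.le, mul_one_div_cancel (by linarith), Real.rpow_one] at j4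
  exact integral_le_aux hα hγ hC1 hC2 hδ0 hδ' (by positivity) j1 j2 j3 j4

end Integral

section Hinge

/-- A convex `C²` function which vanishes on the negative axis and is below the positive part. -/
def hinge (t : ℝ) : ℝ := ∫ s in (0 : ℝ)..t, Real.smoothTransition s

lemma hasDerivAt_hinge (t : ℝ) : HasDerivAt hinge (Real.smoothTransition t) t :=
  intervalIntegral.integral_hasDerivAt_right
    (Real.smoothTransition.continuous.intervalIntegrable _ _)
    (Real.smoothTransition.continuous.stronglyMeasurableAtFilter _ _)
    Real.smoothTransition.continuous.continuousAt

lemma contDiff_hinge : ContDiff ℝ 2 hinge := by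
  have : deriv hinge = Real.smoothTransition := funext fun t => (hasDerivAt_hinge t).deriv
  rw [show (2 : WithTop ℕ∞) = 1 + 1 by norm_num, contDiff_succ_iff_deriv]
  refine ⟨fun t => (hasDerivAt_hinge t).differentiableAt, by simp, ?_⟩
  rw [this]
  exact Real.smoothTransition.contDiff

lemma hinge_of_nonpos {t : ℝ} (ht : t ≤ 0) : hinge t = 0 := by
  rw [hinge, intervalIntegral.integral_congr (g := fun _ => 0) fun s hs => ?_]
  · simp
  · rw [uIcc_of_ge ht] at hs
    exact Real.smoothTransition.zero_of_nonpos hs.2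

lemma hinge_pos {t : ℝ} (ht : 0 < t) : 0 < hinge t :=
  intervalIntegral.intervalIntegral_pos_of_pos_on
    (Real.smoothTransition.continuous.intervalIntegrable _ _)
    (fun _ hs => Real.smoothTransition.pos_of_pos hs.1) ht

lemma hinge_nonneg (t : ℝ) : 0 ≤ hinge t := by
  rcases le_or_gt t 0 with ht | ht
  · exact (hinge_of_nonpos ht).ge
  · exact (hinge_pos ht).le

lemma hinge_le {t s : ℝ} (hs : 0 ≤ s) (hts : t ≤ s) : hinge t ≤ s := by
  rcases le_or_gt t 0 with ht | ht
  · rwa [hinge_of_nonpos ht]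
  · refine (intervalIntegral.integral_mono_on ht.le
      (Real.smoothTransition.continuous.intervalIntegrable _ _) (_root_.intervalIntegrable_const
        (c := (1 : ℝ))) fun s _ => Real.smoothTransition.le_one s).trans ?_
    simpa using hts

lemma monotone_smoothTransition : Monotone Real.smoothTransition := fun x y hxy => by
  have h1 : expNegInvGlue x ≤ expNegInvGlue y := expNegInvGlue.monotone hxy
  have h2 : expNegInvGlue (1 - y) ≤ expNegInvGlue (1 - x) := expNegInvGlue.monotone (by linarith)
  rw [Real.smoothTransition, Real.smoothTransition, div_le_div_iff₀
    (Real.smoothTransition.pos_denom x) (Real.smoothTransition.pos_denom y)]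
  have := mul_le_mul h1 h2 (expNegInvGlue.nonneg _) (expNegInvGlue.nonneg _)
  linarith

variable {N : ℕ} {Ω : Set (Euc N)} {w : Euc N → ℝ} {x : Euc N}

lemma lap_hinge_nonneg (hΩ : IsOpen Ω) (hw : ContDiffOn ℝ 2 w Ω) (hx : x ∈ Ω)
    (h : 0 ≤ w x → 0 ≤ lap w x) : 0 ≤ lap (fun y => hinge (w y)) x := by
  have d : DifferentiableAt ℝ Real.smoothTransition (w x) :=
    (Real.smoothTransition.contDiff (n := 1)).differentiable one_ne_zero _
  rw [lap_comp (h' := Real.smoothTransition) hΩ hw (contDiff_hinge.comp_contDiffOn hw)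
    (fun y _ => hasDerivAt_hinge _) hx d.hasDerivAt]
  have h1 : 0 ≤ deriv Real.smoothTransition (w x) := monotone_smoothTransition.deriv_nonneg
  have h2 : 0 ≤ Real.smoothTransition (w x) * lap w x := by
    rcases le_or_gt 0 (w x) with h' | h'
    · exact mul_nonneg (Real.smoothTransition.nonneg _) (h h')
    · rw [Real.smoothTransition.zero_of_nonpos h'.le, zero_mul]
  have h3 : 0 ≤ ∑ i, pd i w x ^ 2 := Finset.sum_nonneg fun i _ => sq_nonneg _
  positivity

end Hinge

section Liouville

variable {N : ℕ} {v Ψ f g : Euc N → ℝ} {m R : ℝ} {x : Euc N}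

lemma rd_sq_le (f : Euc N → ℝ) (x : Euc N) : rd f x ^ 2 ≤ ‖x‖ ^ 2 * gdot f f x := by
  have := Finset.sum_mul_sq_le_sq_mul_sq Finset.univ (fun i => x i) fun i => pd i f x
  rw [sum_coord_sq] at this
  simpa only [rd, gdot, sq] using this

/-- A superharmonic function with the decay of the fundamental solution. -/
def bump (m : ℝ) (x : Euc N) : ℝ := (1 + ‖x‖ ^ 2) ^ (-m)

lemma contDiff_one_add_norm_sq : ContDiff ℝ 2 fun x : Euc N => 1 + ‖x‖ ^ 2 :=
  contDiff_const.add (contDiff_norm_sq ℝ)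

lemma pd_one_add_norm_sq (i : Fin N) (x : Euc N) :
    pd i (fun x : Euc N => 1 + ‖x‖ ^ 2) x = 2 * x i := by
  rw [pd_add i (differentiableAt_const _)
    ((contDiff_norm_sq ℝ (n := 1)).differentiable one_ne_zero x), pd_const, pd_norm_sq, zero_add]

lemma contDiff_bump : ContDiff ℝ 2 (bump m : Euc N → ℝ) :=
  contDiff_one_add_norm_sq.rpow_const_of_ne fun x => by positivity

lemma bump_pos (x : Euc N) : 0 < bump m x := Real.rpow_pos_of_pos (by positivity) _

lemma gdot_bump (g : Euc N → ℝ) (x : Euc N) :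
    gdot (bump m) g x = -(2 * m * (1 + ‖x‖ ^ 2)⁻¹ * bump m x * rd g x) := by
  have h : (0 : ℝ) < 1 + ‖x‖ ^ 2 := by positivity
  have e : gdot (bump m) g x = -m * (1 + ‖x‖ ^ 2) ^ (-m - 1) *
      gdot (fun x : Euc N => 1 + ‖x‖ ^ 2) g x :=
    gdot_rpow (-m) (contDiff_one_add_norm_sq.differentiable two_ne_zero x) h.ne'
  have e' : gdot (fun x : Euc N => 1 + ‖x‖ ^ 2) g x = 2 * rd g x := by
    simp only [gdot, pd_one_add_norm_sq, rd, Finset.mul_sum, mul_assoc]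
  rw [e, e', Real.rpow_sub_one h.ne', bump]
  ring

lemma lap_bump (hm : (N : ℝ) = 2 * m + 2) (x : Euc N) :
    lap (bump m) x = -(4 * m * (m + 1) * (1 + ‖x‖ ^ 2) ^ (-m - 2)) := by
  have h : (0 : ℝ) < 1 + ‖x‖ ^ 2 := by positivity
  have e : lap (bump m) x = _ := lap_rpow (-m) isOpen_univ contDiff_one_add_norm_sq.contDiffOn
    (fun y _ => by positivity) (mem_univ x)
  have e1 : ∑ i : Fin N, pd i (fun y : Euc N => 1 + ‖y‖ ^ 2) x ^ 2 = 4 * ‖x‖ ^ 2 := by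
    simp only [pd_one_add_norm_sq]
    rw [← sum_coord_sq, Finset.mul_sum]
    exact Finset.sum_congr rfl fun i _ => by ring
  have e2 : lap (fun y : Euc N => 1 + ‖y‖ ^ 2) x = 2 * N := by
    rw [lap_add isOpen_univ contDiffOn_const (contDiff_norm_sq ℝ).contDiffOn (mem_univ x),
      lap_const, lap_norm_sq, zero_add]
  have e3 : (1 + ‖x‖ ^ 2) ^ (-m - 1) = (1 + ‖x‖ ^ 2) ^ (-m - 2) * (1 + ‖x‖ ^ 2) := by
    rw [← Real.rpow_add_one h.ne']
    congr 1
    ring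
  rw [e, e1, e2, e3, hm]
  ring

/-- The error caused by the cutoff at radius `R`. -/
def cutErr (N : ℕ) (m R : ℝ) (x : Euc N) : ℝ :=
  2 * gdot (bump m) (ballCutoffAt N R) x + bump m x * lap (ballCutoffAt N R) x

lemma lap_bump_mul (x : Euc N) :
    lap (fun y => bump m y * ballCutoffAt N R y) x =
      cutErr N m R x + ballCutoffAt N R x * lap (bump m) x := by
  rw [lap_mul' isOpen_univ contDiff_bump.contDiffOn (ballCutoffAt_contDiff R).contDiffOn
    (mem_univ x), cutErr]
  ring

lemma cutErr_continuous : Continuous (cutErr N m R) := by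
  have h1 := (gdot_contDiffOn isOpen_univ (contDiff_bump (N := N) (m := m)).contDiffOn
    (ballCutoffAt_contDiff R).contDiffOn).continuousOn
  have h2 := lap_continuousOn isOpen_univ (ballCutoffAt_contDiff (N := N) R).contDiffOn
  rw [← continuousOn_univ]
  exact (h1.const_mul 2).add (contDiff_bump.continuous.continuousOn.mul h2)

lemma rd_ballCutoffAt (hR : 0 < R) (y : Euc N) :
    rd (ballCutoffAt N R) (R • y) = rd (ballCutoff N) y := by
  simp only [rd, pd_ballCutoffAt, inv_smul_smul₀ hR.ne']
  refine Finset.sum_congr rfl fun i _ => ?_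
  simp only [PiLp.smul_apply, smul_eq_mul]
  field_simp

lemma lap_ballCutoff_eq_zero : ∀ y ∉ edge N, lap (ballCutoff N) y = 0 := fun y hy => by
  rw [lap_eq_sum isOpen_univ ballCutoff_contDiff.contDiffOn (mem_univ y)]
  exact Finset.sum_eq_zero fun i _ =>
    pd_eq_zero_of_notMem i isClosed_edge (pd_ballCutoff_eq_zero i) hy

lemma cutErr_eq_zero (hR : 0 < R) : ∀ y ∉ edge N, cutErr N m R (R • y) = 0 := fun y hy => by
  rw [cutErr, gdot_bump, rd_ballCutoffAt hR, lap_ballCutoffAt, inv_smul_smul₀ hR.ne',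
    lap_ballCutoff_eq_zero y hy]
  simp [rd, pd_ballCutoff_eq_zero _ y hy]

lemma cutErr_le (hm : 0 < m) : ∃ C, 0 ≤ C ∧ ∀ R, 0 < R → ∀ y ∈ edge N,
    |cutErr N m R (R • y)| ≤ C * (R⁻¹ ^ 2 * bump m (R • y)) := by
  have hK := isCompact_shell (N := N) 1 2
  obtain ⟨C1, hC1, h1⟩ := exists_upper_bound hK (A := rd (ballCutoff N))
    ((rd_contDiffOn isOpen_univ ballCutoff_contDiff.contDiffOn).continuousOn.mono (subset_univ _))
  obtain ⟨C2, hC2, h2⟩ := exists_upper_bound hK (A := lap (ballCutoff N))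
    ((lap_continuousOn isOpen_univ ballCutoff_contDiff.contDiffOn).mono (subset_univ _))
  refine ⟨4 * m * C1 + C2, by positivity, fun R hR y hy => ?_⟩
  have b := bump_pos (m := m) (R • y)
  have hy' := edge_subset_shell hy
  rw [cutErr, gdot_bump, rd_ballCutoffAt hR, lap_ballCutoffAt, inv_smul_smul₀ hR.ne']
  have i1 : (1 + ‖R • y‖ ^ 2)⁻¹ ≤ R⁻¹ ^ 2 := by
    rw [inv_pow]
    refine inv_anti₀ (by positivity) ?_
    rw [norm_smul, mul_pow, Real.norm_of_nonneg hR.le]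
    nlinarith [hy'.1, hy.1, sq_nonneg R]
  have i0 : 0 < (1 + ‖R • y‖ ^ 2)⁻¹ := by positivity
  have j1 : |2 * -(2 * m * (1 + ‖R • y‖ ^ 2)⁻¹ * bump m (R • y) * rd (ballCutoff N) y)| ≤
      2 * (2 * m * R⁻¹ ^ 2 * bump m (R • y) * C1) := by
    rw [abs_mul, abs_neg, abs_mul, abs_of_pos (show (0 : ℝ) < 2 by norm_num),
      abs_of_nonneg (show 0 ≤ 2 * m * (1 + ‖R • y‖ ^ 2)⁻¹ * bump m (R • y) by positivity)]
    have := h1 y hy'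
    gcongr
  have j2 : |bump m (R • y) * (R⁻¹ ^ 2 * lap (ballCutoff N) y)| ≤
      bump m (R • y) * (R⁻¹ ^ 2 * C2) := by
    rw [abs_mul, abs_mul, abs_of_pos b, abs_of_nonneg (by positivity : 0 ≤ R⁻¹ ^ 2)]
    have := h2 y hy'
    gcongr
  refine (abs_add_le _ _).trans ((add_le_add j1 j2).trans_eq ?_)
  ring

end Liouville

section Liouville

variable {N : ℕ} {v Ψ f g : Euc N → ℝ} {m R : ℝ} {x : Euc N}

lemma setIntegral_cutErr_le (hm : 0 < m) : ∃ C, 0 ≤ C ∧ ∀ (Ψ v : Euc N → ℝ), (∀ x, 0 ≤ Ψ x) →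
    (∀ x, Ψ x ≤ v x) → Continuous v → ∀ R T, 0 < R → 0 ≤ T →
    (∀ y ∈ edge N, bump m (R • y) ≤ T) →
    |∫ x in shell N (R * 1) (R * 2), Ψ x * cutErr N m R x| ≤
      C * (R ^ N * (R⁻¹ ^ 2 * T)) * ∫ y in edge N, v (R • y) := by
  obtain ⟨C, hC, h⟩ := cutErr_le (N := N) hm
  refine ⟨C, hC, fun Ψ v h0 hv cv R T hR hT hb => ?_⟩
  have hE : IsCompact (edge N) := (isCompact_shell 1 2).of_isClosed_subset isClosed_edge
    edge_subset_shell
  have cvR : ContinuousOn (fun y => C * (R⁻¹ ^ 2 * T) * v (R • y)) (edge N) :=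
    ((cv.comp (continuous_const_smul R)).const_mul _).continuousOn
  rw [setIntegral_shell_smul hR, setIntegral_eq_of_subset_of_forall_sdiff_eq_zero
    (isCompact_shell 1 2).measurableSet edge_subset_shell
    fun y hy => by rw [cutErr_eq_zero hR y hy.2, mul_zero], abs_mul, abs_of_pos (pow_pos hR N)]
  have := norm_integral_le_of_norm_le (cvR.integrableOn_compact (μ := volume) hE)
    (f := fun y => Ψ (R • y) * cutErr N m R (R • y)) (by
      filter_upwards [ae_restrict_mem hE.measurableSet] with y hy
      rw [Real.norm_eq_abs, abs_mul, abs_of_nonneg (h0 _), mul_comm]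
      refine mul_le_mul ((h R hR y hy).trans ?_) (hv _) (h0 _) (by positivity)
      have := hb y hy
      gcongr)
  rw [integral_const_mul, Real.norm_eq_abs] at this
  calc _ ≤ R ^ N * (C * (R⁻¹ ^ 2 * T) * ∫ y in edge N, v (R • y)) := by gcongr
    _ = _ := by ring

/-- A nonnegative subharmonic function outside the origin, bounded near the origin and with
vanishing averages at infinity, is zero. -/
lemma eq_zero_of_subharmonic (hN : 3 ≤ N) (cΨ : ContDiffOn ℝ 2 Ψ {x | x ≠ 0})
    (h0 : ∀ x, 0 ≤ Ψ x) (hv : ∀ x, Ψ x ≤ v x) (cv : Continuous v)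
    (hlap : ∀ x ≠ 0, 0 ≤ lap Ψ x)
    (hlim : Tendsto (fun R : ℝ => ∫ y in edge N, v (R • y)) atTop (𝓝 0)) :
    ∀ x ≠ 0, Ψ x = 0 := by
  by_contra! hne
  obtain ⟨x₀, hx₀, hΨ⟩ := hne
  have hΨ0 : 0 < Ψ x₀ := lt_of_le_of_ne (h0 x₀) hΨ.symm
  obtain ⟨m, hm⟩ : ∃ m : ℝ, (N : ℝ) = 2 * m + 2 := ⟨((N : ℝ) - 2) / 2, by ring⟩
  have hm0 : 0 < m := by
    have : (3 : ℝ) ≤ N := by exact_mod_cast hN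
    linarith
  obtain ⟨C, hC, err⟩ := setIntegral_cutErr_le (N := N) hm0
  have hE : IsCompact (edge N) := (isCompact_shell 1 2).of_isClosed_subset isClosed_edge
    edge_subset_shell
  have hr : 0 < ‖x₀‖ := norm_pos_iff.2 hx₀
  have lb : ∀ x : Euc N, 0 < -lap (bump m) x := fun x => by
    rw [lap_bump hm, neg_neg]
    positivity
  have clb : Continuous fun x : Euc N => -lap (bump m) x := by
    rw [← continuousOn_univ]
    exact (lap_continuousOn isOpen_univ contDiff_bump.contDiffOn).neg
  have hB := isCompact_shell (N := N) (‖x₀‖ / 2) (2 * ‖x₀‖)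
  have cB : ContinuousOn (fun x => Ψ x * -lap (bump m) x) {x | x ≠ 0} :=
    cΨ.continuousOn.mul clb.continuousOn
  set c₀ := ∫ x in shell N (‖x₀‖ / 2) (2 * ‖x₀‖), Ψ x * -lap (bump m) x with hc₀
  have hc0 : 0 < c₀ := by
    rw [hc₀, setIntegral_pos_iff_support_of_nonneg_ae
      (by filter_upwards with x using mul_nonneg (h0 x) (lb x).le)
      ((cB.mono (shell_subset_ne_zero (half_pos hr))).integrableOn_compact hB)]
    refine Measure.measure_pos_of_mem_nhds volume (x := x₀) ?_
    have n1 : ∀ᶠ x in 𝓝 x₀, 0 < Ψ x :=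
      (cΨ.continuousOn.continuousAt (isOpen_ne_zero.mem_nhds hx₀)).eventually_const_lt hΨ0
    have n2 : ∀ᶠ x in 𝓝 x₀, ‖x₀‖ / 2 < ‖x‖ :=
      continuous_norm.continuousAt.eventually_const_lt (by linarith)
    have n3 : ∀ᶠ x in 𝓝 x₀, ‖x‖ < 2 * ‖x₀‖ :=
      continuous_norm.continuousAt.eventually_lt_const (by linarith)
    filter_upwards [n1, n2, n3] with x h1 h2 h3
    exact ⟨(mul_pos h1 (lb x)).ne', h2.le, h3.le⟩
  obtain ⟨M, hM, hMb⟩ := exists_upper_bound (isCompact_closedBall (0 : Euc N) 2) cv.continuousOn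
  have key : ∀ R ≥ 2 * ‖x₀‖, ∀ ε, 0 < ε → ε ≤ ‖x₀‖ / 4 → ε ≤ 1 →
      c₀ ≤ C * (∫ y in edge N, v (R • y)) + C * (M * volume.real (edge N)) * ε := by
    intro R hR ε hε hε4 hε1
    have hR0 : 0 < R := by linarith
    have hK := isCompact_shell (N := N) ε (2 * R)
    have hKU : shell N ε (2 * R) ⊆ {x | x ≠ 0} := shell_subset_ne_zero hε
    have cR := ballCutoffAt_contDiff (N := N) R
    have cε := ballCutoffAt_contDiff (N := N) ε
    have pos : ∀ x : Euc N, 0 ≤ ballCutoffAt N R x - ballCutoffAt N ε x := fun x => by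
      rcases le_total (‖x‖ ^ 2) (2 * R ^ 2) with hx | hx
      · rw [ballCutoffAt_eq_one hR0 hx]
        linarith [ballCutoffAt_le_one ε x]
      · rw [ballCutoffAt_eq_zero hε (by nlinarith), sub_zero]
        exact ballCutoffAt_nonneg R x
    have green := nullOn_green isOpen_ne_zero hK hKU
      (η := fun x => bump m x * ballCutoffAt N R x - bump m x * ballCutoffAt N ε x)
      ((contDiff_bump.mul cR).sub (contDiff_bump.mul cε)).contDiffOn cΨ fun x hx => by
        rw [← mul_sub]
        refine mul_eq_zero_of_right _ ?_
        rcases lt_or_ge ‖x‖ ε with h1 | h1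
        · have := norm_nonneg x
          rw [ballCutoffAt_eq_one hε (by nlinarith), ballCutoffAt_eq_one hR0 (by nlinarith),
            sub_self]
        · have h2 : 2 * R < ‖x‖ := not_le.1 fun h2 => hx ⟨h1, h2⟩
          rw [ballCutoffAt_eq_zero hε (by nlinarith), ballCutoffAt_eq_zero hR0 (by nlinarith),
            sub_self]
    have cΨK := cΨ.continuousOn.mono hKU
    have c1 : ContinuousOn (fun x => Ψ x * -lap (bump m) x *
        (ballCutoffAt N R x - ballCutoffAt N ε x)) (shell N ε (2 * R)) :=
      (cB.mono hKU).mul (cR.sub cε).continuous.continuousOn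
    have c2 : ContinuousOn (fun x => Ψ x * cutErr N m R x) (shell N ε (2 * R)) :=
      cΨK.mul cutErr_continuous.continuousOn
    have c3 : ContinuousOn (fun x => Ψ x * cutErr N m ε x) (shell N ε (2 * R)) :=
      cΨK.mul cutErr_continuous.continuousOn
    have le1 := green.le hK c1 (c2.fun_sub c3) fun x hx => by
      rw [lap_sub isOpen_univ (contDiff_bump.mul cR).contDiffOn (contDiff_bump.mul cε).contDiffOn
        (mem_univ x), lap_bump_mul, lap_bump_mul]
      have := mul_nonneg (mul_nonneg (bump_pos (m := m) x).le (pos x)) (hlap x (hKU hx))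
      linarith
    rw [integral_sub (c2.integrableOn_compact hK) (c3.integrableOn_compact hK)] at le1
    have s1 : shell N (‖x₀‖ / 2) (2 * ‖x₀‖) ⊆ shell N ε (2 * R) := fun x hx =>
      ⟨by linarith [hx.1], by linarith [hx.2]⟩
    have le2 : c₀ ≤ ∫ x in shell N ε (2 * R), Ψ x * -lap (bump m) x *
        (ballCutoffAt N R x - ballCutoffAt N ε x) := by
      rw [hc₀, setIntegral_congr_fun (g := fun x => Ψ x * -lap (bump m) x *
        (ballCutoffAt N R x - ballCutoffAt N ε x)) hB.measurableSet fun x hx => ?_]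
      · refine setIntegral_mono_set (c1.integrableOn_compact hK) ?_ s1.eventuallyLE
        filter_upwards with x using mul_nonneg (mul_nonneg (h0 x) (lb x).le) (pos x)
      · have h1 := hx.1
        have h2 := hx.2
        beta_reduce
        rw [ballCutoffAt_eq_zero hε (by nlinarith), ballCutoffAt_eq_one hR0
          (by nlinarith [norm_nonneg x]), sub_zero, mul_one]
    have restrict : ∀ r, 0 < r → shell N (r * 1) (r * 2) ⊆ shell N ε (2 * R) →
        ∫ x in shell N ε (2 * R), Ψ x * cutErr N m r x =
          ∫ x in shell N (r * 1) (r * 2), Ψ x * cutErr N m r x := fun r hr hs => by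
      refine setIntegral_eq_of_subset_of_forall_sdiff_eq_zero hK.measurableSet hs fun x hx => ?_
      have : x = r • (r⁻¹ • x) := (smul_inv_smul₀ hr.ne' x).symm
      rw [this, cutErr_eq_zero hr _ fun hE => hx.2 ?_, mul_zero]
      have := edge_subset_shell hE
      rw [shell, mem_ofPred_eq, norm_smul, norm_inv, Real.norm_of_nonneg hr.le,
        inv_mul_le_iff₀ hr, le_inv_mul_iff₀ hr] at this
      exact this
    rw [restrict R hR0 fun x hx => ⟨by linarith [hx.1], by linarith [hx.2]⟩,
      restrict ε hε fun x hx => ⟨by linarith [hx.1], by linarith [hx.2]⟩] at le1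
    have eR := err Ψ v h0 hv cv R ((R ^ 2) ^ (-m)) hR0 (by positivity) fun y hy => by
      refine Real.rpow_le_rpow_of_nonpos (by positivity) ?_ (by linarith)
      rw [norm_smul, mul_pow, Real.norm_of_nonneg hR0.le]
      nlinarith [hy.1, sq_nonneg R]
    have powR : R ^ N * (R⁻¹ ^ 2 * (R ^ 2) ^ (-m)) = 1 := by
      rw [← Real.rpow_natCast R N, hm, Real.rpow_add hR0, Real.rpow_two, inv_pow,
        Real.rpow_neg (by positivity), ← Real.rpow_natCast R 2, ← Real.rpow_mul hR0.le]
      have := Real.rpow_pos_of_pos hR0 (2 * m)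
      push_cast
      field_simp
    have eε := err Ψ v h0 hv cv ε 1 hε zero_le_one fun y _ =>
      Real.rpow_le_one_of_one_le_of_nonpos (by nlinarith [sq_nonneg ‖ε • y‖]) (by linarith)
    rw [powR] at eR
    have powε : ε ^ N * (ε⁻¹ ^ 2 * 1) ≤ ε := by
      have e : ε ^ N = ε ^ 2 * (ε * ε ^ (N - 3)) := by
        rw [← pow_succ', ← pow_add]
        congr 1
        omega
      have n1 : ε ^ (N - 3) ≤ 1 := pow_le_one₀ hε.le hε1
      rw [e]
      field_simp
      exact n1
    have Jε : ∫ y in edge N, v (ε • y) ≤ M * volume.real (edge N) := by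
      refine (setIntegral_mono_on ((cv.comp (continuous_const_smul ε)).continuousOn.integrableOn_compact
        hE) (integrableOn_const hE.measure_lt_top.ne) hE.measurableSet fun y hy =>
        (le_abs_self _).trans (hMb _ ?_)).trans_eq ?_
      · have := (edge_subset_shell hy).2
        rw [mem_closedBall_zero_iff, norm_smul, Real.norm_of_nonneg hε.le]
        nlinarith [norm_nonneg y]
      · rw [setIntegral_const, smul_eq_mul, mul_comm]
    have Jε0 : 0 ≤ ∫ y in edge N, v (ε • y) := setIntegral_nonneg hE.measurableSet
      fun y _ => (h0 _).trans (hv _)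
    have eε' : C * (ε ^ N * (ε⁻¹ ^ 2 * 1)) * ∫ y in edge N, v (ε • y) ≤
        C * ε * (M * volume.real (edge N)) := by gcongr
    linarith [le_abs_self (∫ x in shell N (R * 1) (R * 2), Ψ x * cutErr N m R x),
      neg_abs_le (∫ x in shell N (ε * 1) (ε * 2), Ψ x * cutErr N m ε x)]
  have key2 : ∀ R ≥ 2 * ‖x₀‖, c₀ ≤ C * ∫ y in edge N, v (R • y) := fun R hR => by
    have lim : Tendsto (fun ε => C * (∫ y in edge N, v (R • y)) +
        C * (M * volume.real (edge N)) * ε) (𝓝[>] 0) (𝓝 (C * ∫ y in edge N, v (R • y))) := by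
      have : Tendsto (fun ε : ℝ => C * (∫ y in edge N, v (R • y)) +
        C * (M * volume.real (edge N)) * ε) (𝓝 0) (𝓝 (C * (∫ y in edge N, v (R • y)) +
        C * (M * volume.real (edge N)) * 0)) := Continuous.tendsto (by fun_prop) 0
      rw [mul_zero, add_zero] at this
      exact this.mono_left nhdsWithin_le_nhds
    refine ge_of_tendsto lim ?_
    filter_upwards [Ioc_mem_nhdsGT (show 0 < ‖x₀‖ / 4 by positivity),
      Ioc_mem_nhdsGT one_pos] with ε h1 h2 using key R hR ε h1.1 h1.2 h2.2
  have := ge_of_tendsto (hlim.const_mul C) (by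
    filter_upwards [eventually_ge_atTop (2 * ‖x₀‖)] with R hR using key2 R hR)
  linarith

end Liouville

section Comparison

variable {N : ℕ} {u v : Euc N → ℝ} {p q a b κ σ : ℝ} {x : Euc N}

lemma weighted_quad_le {n r G t z : ℝ} (hσ : 0 < σ) (hσ1 : σ ≤ 1) (hκ : 0 ≤ κ)
    (hκσ : κ ≤ (1 - σ) * n) (h : t ^ 2 ≤ r ^ 2 * G) :
    σ * (σ - 1) * (r ^ 2 * G) + 2 * (-κ * σ * (z * t)) + -κ * (-κ + n) * z ^ 2 ≤ 0 := by
  rcases hσ1.eq_or_lt with rfl | h1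
  · have : κ = 0 := by linarith
    simp [this]
  · have h2 : 0 ≤ σ * (1 - σ) * (r ^ 2 * G - t ^ 2) :=
      mul_nonneg (mul_nonneg hσ.le (by linarith)) (by linarith)
    have h3 : (1 - σ) * (-(σ * (1 - σ)) * t ^ 2 - 2 * (κ * σ * (z * t)) - κ * (n - κ) * z ^ 2) =
        -(σ * ((1 - σ) * t + κ * z) ^ 2) - κ * z ^ 2 * ((1 - σ) * n - κ) := by ring
    have h4 : 0 ≤ κ * z ^ 2 * ((1 - σ) * n - κ) :=
      mul_nonneg (mul_nonneg hκ (sq_nonneg z)) (by linarith)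
    have h5 : 0 ≤ σ * ((1 - σ) * t + κ * z) ^ 2 := mul_nonneg hσ.le (sq_nonneg _)
    have h6 : -(σ * (1 - σ)) * t ^ 2 - 2 * (κ * σ * (z * t)) - κ * (n - κ) * z ^ 2 ≤ 0 := by
      by_contra! hc
      have := mul_pos (sub_pos.2 h1) hc
      linarith
    linarith

lemma lap_norm_rpow_mul_rpow_le (hu : ContDiffOn ℝ 2 u {x | x ≠ 0}) (hu0 : ∀ y, 0 < u y)
    (hσ : 0 < σ) (hσ1 : σ ≤ 1) (hκ : 0 ≤ κ) (hκσ : κ ≤ (1 - σ) * ((N : ℝ) - 2)) (hx : x ≠ 0) :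
    lap (fun y => ‖y‖ ^ (-κ) * u y ^ σ) x ≤ σ * (‖x‖ ^ (-κ) * u x ^ (σ - 1)) * lap u x := by
  have du := diffAt_of_contDiffOn isOpen_ne_zero (hu.of_le one_le_two) hx
  rw [lap_mul' isOpen_ne_zero (contDiffOn_norm_rpow _)
    (hu.rpow_const_of_ne fun y _ => (hu0 y).ne') hx, lap_rpow _ isOpen_ne_zero hu
    (fun y _ => hu0 y) hx, gdot_norm_rpow _ _ hx, rd_rpow _ du (hu0 x).ne', lap_norm_rpow _ hx,
    ← norm_rpow_sub_two_mul (-κ) hx]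
  have e1 : ∑ i, pd i u x ^ 2 = gdot u u x := Finset.sum_congr rfl fun i _ => sq _
  have e2 : u x ^ (σ - 1) = u x ^ (σ - 2) * u x := by
    rw [← Real.rpow_add_one (hu0 x).ne']; congr 1; ring
  have e3 : u x ^ σ = u x ^ (σ - 2) * u x ^ 2 := by
    rw [← Real.rpow_natCast (u x) 2, ← Real.rpow_add (hu0 x)]; congr 1; push_cast; ring
  rw [e1, e2, e3]
  have h := weighted_quad_le (z := u x) hσ hσ1 hκ hκσ (rd_sq_le u x)
  have hpos : 0 ≤ ‖x‖ ^ (-κ - 2) * u x ^ (σ - 2) :=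
    mul_nonneg (Real.rpow_nonneg (norm_nonneg x) _) (Real.rpow_nonneg (hu0 x).le _)
  have := mul_nonpos_of_nonneg_of_nonpos hpos h
  linarith

/-- Averages of the second component over dilated shells decay. -/
lemma PosSol.tendsto_setIntegral_edge {α β : ℝ} (h : PosSol p q a b u v) (hp : 1 < p) (hq : 1 ≤ q)
    (hα : p * β = α + 2 + a) (hβ : q * α = β + 2 + b) (hβ0 : 0 < β) :
    Tendsto (fun R : ℝ => ∫ y in edge N, v (R • y)) atTop (𝓝 0) := by
  have hne : ∀ x ∈ collar N, x ≠ 0 := collar_subset_ne_zero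
  have hw : ∀ c : ℝ, ContinuousOn (fun x : Euc N => ‖x‖ ^ c) (collar N) := fun c =>
    (contDiffOn_norm_rpow c).continuousOn.mono hne
  have hw0 : ∀ c : ℝ, ∀ x ∈ collar N, 0 < ‖x‖ ^ c := fun c x hx =>
    Real.rpow_pos_of_pos (norm_pos_iff.2 (hne x hx)) c
  have hK := isCompact_shell (N := N) 1 2
  have hE : IsCompact (edge N) := hK.of_isClosed_subset isClosed_edge edge_subset_shell
  obtain ⟨k, C, hC⟩ := IsSys.integral_le (N := N) isOpen_collar hK shell_subset_collar
    shellCutoff_isCutoff (hw a) (hw b) (hw0 a) (hw0 b) hp hq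
  have bound : ∀ R > 0, ∫ y in edge N, v (R • y) ≤ C * volume.real (shell N 1 2) * R ^ (-β) := by
    intro R hR
    have hs := h.scale hR hα hβ
    have i1 := (hC _ _ (hs.isSys isOpen_collar hne)).integral_le_const hK
      ((hs.cont_v.mul ((shellCutoff_isCutoff (N := N)).contDiff.continuous.pow k)).continuousOn)
    have i2 : ∫ y in edge N, R ^ β * v (R • y) ≤
        ∫ y in shell N 1 2, R ^ β * v (R • y) * shellCutoff N y ^ k := by
      rw [setIntegral_congr_fun (g := fun y => R ^ β * v (R • y) * shellCutoff N y ^ k)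
        hE.measurableSet fun y hy => by
          beta_reduce
          rw [shellCutoff_eq_one_of_mem_edge y hy, one_pow, mul_one]]
      refine setIntegral_mono_set ((hs.cont_v.mul
        ((shellCutoff_isCutoff (N := N)).contDiff.continuous.pow k)).continuousOn.integrableOn_compact
        hK) ?_ edge_subset_shell.eventuallyLE
      filter_upwards with y
      exact mul_nonneg (hs.v_pos y).le (pow_nonneg (shellCutoff_isCutoff.nonneg y) k)
    rw [integral_const_mul] at i2
    rw [Real.rpow_neg hR.le, ← div_eq_mul_inv, le_div_iff₀ (Real.rpow_pos_of_pos hR β), mul_comm]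
    exact i2.trans i1
  have lim : Tendsto (fun R : ℝ => C * volume.real (shell N 1 2) * R ^ (-β)) atTop (𝓝 0) := by
    simpa using (tendsto_rpow_neg_atTop hβ0).const_mul (C * volume.real (shell N 1 2))
  refine tendsto_of_tendsto_of_tendsto_of_le_of_le' tendsto_const_nhds lim ?_ ?_
  · filter_upwards with R using setIntegral_nonneg hE.measurableSet fun y _ => (h.v_pos _).le
  · filter_upwards [eventually_gt_atTop 0] with R hR using bound R hR

/-- The pointwise comparison of the two components of a solution. -/
lemma PosSol.comparison {α β : ℝ} (h : PosSol p q a b u v) (hN : 3 ≤ N) (hp : 1 < p) (hq : 1 ≤ q)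
    (hqp : q ≤ p) (hab : b ≤ a) (hab' : a - b ≤ ((N : ℝ) - 2) * (p - q))
    (hα : p * β = α + 2 + a) (hβ : q * α = β + 2 + b) (hβ0 : 0 < β) (hx : x ≠ 0) :
    (q + 1) * (‖x‖ ^ a * v x ^ (p + 1)) ≤ (p + 1) * (‖x‖ ^ b * u x ^ (q + 1)) := by
  set σ := (q + 1) / (p + 1) with hσd
  set κ := (a - b) / (p + 1) with hκd
  have hp1 : 0 < p + 1 := by linarith
  have hσ : 0 < σ := by positivity
  have hσ1 : σ ≤ 1 := (div_le_one hp1).2 (by linarith)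
  have hκ : 0 ≤ κ := div_nonneg (by linarith) hp1.le
  have hσp : σ * (p + 1) = q + 1 := div_mul_cancel₀ _ hp1.ne'
  have hκp : κ * (p + 1) = a - b := div_mul_cancel₀ _ hp1.ne'
  have hκσ : κ ≤ (1 - σ) * ((N : ℝ) - 2) := by
    rw [hκd, div_le_iff₀ hp1]
    have : (1 - σ) * ((N : ℝ) - 2) * (p + 1) = ((N : ℝ) - 2) * (p + 1 - σ * (p + 1)) := by ring
    rw [this, hσp]
    linarith
  set s := σ ^ (-(1 / (p + 1))) with hs
  have hs0 : 0 < s := Real.rpow_pos_of_pos hσ _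
  have hsp : s ^ (p + 1) = σ⁻¹ := by
    rw [hs, ← Real.rpow_mul hσ.le, ← Real.rpow_neg_one]
    congr 1
    field_simp
  have key : ∀ y : Euc N, y ≠ 0 → (s * (‖y‖ ^ (-κ) * u y ^ σ)) ^ (p + 1) =
      σ⁻¹ * (‖y‖ ^ (b - a) * u y ^ (q + 1)) := fun y hy => by
    have hy0 := norm_pos_iff.2 hy
    have hu := h.u_pos y
    rw [Real.mul_rpow hs0.le (by positivity), Real.mul_rpow (by positivity)
      (Real.rpow_nonneg (h.u_pos y).le _), hsp, ← Real.rpow_mul hy0.le,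
      ← Real.rpow_mul (h.u_pos y).le, hσp, neg_mul, hκp, neg_sub]
  set w : Euc N → ℝ := fun y => v y - s * (‖y‖ ^ (-κ) * u y ^ σ) with hw
  have cz : ContDiffOn ℝ 2 (fun y => ‖y‖ ^ (-κ) * u y ^ σ) {x | x ≠ 0} :=
    (contDiffOn_norm_rpow _).mul (h.cu.rpow_const_of_ne fun y _ => (h.u_pos y).ne')
  have cw : ContDiffOn ℝ 2 w {x | x ≠ 0} := h.cv.sub (contDiffOn_const.mul cz)
  have hz : ∀ y : Euc N, 0 ≤ s * (‖y‖ ^ (-κ) * u y ^ σ) := fun y =>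
    mul_nonneg hs0.le (mul_nonneg (Real.rpow_nonneg (norm_nonneg _) _)
      (Real.rpow_nonneg (h.u_pos y).le _))
  have hlap : ∀ y : Euc N, y ≠ 0 → 0 ≤ w y → 0 ≤ lap w y := fun y hy hwy => by
    have hy0 := norm_pos_iff.2 hy
    have hu := h.u_pos y
    have l1 := lap_norm_rpow_mul_rpow_le h.cu h.u_pos hσ hσ1 hκ hκσ hy
    rw [h.lap_u y hy] at l1
    rw [hw, lap_sub isOpen_ne_zero h.cv (contDiffOn_const.mul cz) hy,
      lap_const_mul s isOpen_ne_zero cz hy, h.lap_v y hy]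
    have hz0 : 0 < s * (‖y‖ ^ (-κ) * u y ^ σ) := by positivity
    have l2 : (s * (‖y‖ ^ (-κ) * u y ^ σ)) ^ p ≤ v y ^ p :=
      Real.rpow_le_rpow hz0.le (by simpa [hw] using hwy) (by linarith)
    have e1 : s * σ * (‖y‖ ^ (-κ) * u y ^ (σ - 1)) * ‖y‖ ^ a *
        (s * (‖y‖ ^ (-κ) * u y ^ σ)) ^ p = ‖y‖ ^ b * u y ^ q := by
      have e2 : u y ^ (σ - 1) = u y ^ σ * (u y)⁻¹ := by
        rw [Real.rpow_sub_one hu.ne', div_eq_mul_inv]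
      have e3 : ‖y‖ ^ b = ‖y‖ ^ a * ‖y‖ ^ (b - a) := by rw [← Real.rpow_add hy0]; congr 1; ring
      have e4 : u y ^ (q + 1) = u y ^ q * u y := Real.rpow_add_one hu.ne' q
      have k := key y hy
      rw [Real.rpow_add_one hz0.ne', e4] at k
      rw [e2, e3]
      calc _ = σ * (u y)⁻¹ * ‖y‖ ^ a * ((s * (‖y‖ ^ (-κ) * u y ^ σ)) ^ p *
            (s * (‖y‖ ^ (-κ) * u y ^ σ))) := by ring
        _ = _ := by rw [k]; field_simp
    have l3 : s * (σ * (‖y‖ ^ (-κ) * u y ^ (σ - 1)) * -(‖y‖ ^ a * v y ^ p)) ≤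
        -(‖y‖ ^ b * u y ^ q) := by
      rw [← e1]
      have := mul_le_mul_of_nonneg_left l2
        (by positivity : 0 ≤ s * σ * (‖y‖ ^ (-κ) * u y ^ (σ - 1)) * ‖y‖ ^ a)
      linarith
    have := mul_le_mul_of_nonneg_left l1 hs0.le
    linarith
  have zero := eq_zero_of_subharmonic hN (Ψ := fun y => hinge (w y)) (v := v)
    (contDiff_hinge.comp_contDiffOn cw) (fun y => hinge_nonneg _)
    (fun y => hinge_le (h.v_pos y).le (by simpa [hw] using hz y)) h.cont_v
    (fun y hy => lap_hinge_nonneg isOpen_ne_zero cw hy (hlap y hy))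
    (h.tendsto_setIntegral_edge hp hq hα hβ hβ0) x hx
  have hwx : v x ≤ s * (‖x‖ ^ (-κ) * u x ^ σ) := by
    by_contra! hc
    exact (hinge_pos (t := w x) (by simpa [hw] using hc)).ne' zero
  have := Real.rpow_le_rpow (h.v_pos x).le hwx hp1.le
  rw [key x hx] at this
  have hx0 := norm_pos_iff.2 hx
  have e3 : ‖x‖ ^ b = ‖x‖ ^ a * ‖x‖ ^ (b - a) := by rw [← Real.rpow_add hx0]; congr 1; ring
  have h1 := mul_le_mul_of_nonneg_left this (by positivity : 0 ≤ σ * (p + 1) * ‖x‖ ^ a)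
  calc _ = σ * (p + 1) * ‖x‖ ^ a * v x ^ (p + 1) := by rw [hσp]; ring
    _ ≤ _ := h1
    _ = _ := by rw [e3]; field_simp

end Comparison

section ComparisonEnergy

variable {N : ℕ} {Ω K E : Set (Euc N)} {A B u v θ : Euc N → ℝ} {p q : ℝ} {x : Euc N}

/-- Stable solutions whose components are comparable. -/
def IsComparable (Ω : Set (Euc N)) (A B : Euc N → ℝ) (p q : ℝ) (u v : Euc N → ℝ) : Prop :=
  IsSys Ω A B p q u v ∧ IsStab Ω A B p q u v ∧
    ∀ x ∈ Ω, (q + 1) * (A x * v x ^ (p + 1)) ≤ (p + 1) * (B x * u x ^ (q + 1))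

lemma rpow_le_one_add_rpow {t c d : ℝ} (ht : 0 ≤ t) (hc : 0 ≤ c) (hcd : c ≤ d) :
    t ^ c ≤ 1 + t ^ d := by
  rcases le_total t 1 with h | h
  · linarith [Real.rpow_le_one ht h hc, Real.rpow_nonneg ht d]
  · linarith [Real.rpow_le_rpow_of_exponent_le h hcd]

lemma IsComparable.stab_le (hΩ : IsOpen Ω) (hK : IsCompact K) (hKΩ : K ⊆ Ω) (hθ : IsCutoff K θ)
    (hp : 1 < p) (hq : 1 ≤ q) (k : ℕ) :
    ∃ C, 0 ≤ C ∧ ∀ A B u v, IsComparable Ω A B p q u v →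
      LeMod K (fun x => A x * (u x * v x ^ p) * θ x ^ (2 * k + 2)) fun x =>
        C * (u x ^ 2 * θ x ^ (2 * k)) := by
  obtain ⟨C1, hC1, hb⟩ := hθ.pow_bound k
  set σ := (q + 1) / (p + 1) with hσ
  have hσ0 : 0 < σ := by positivity
  set τ := √(p * q * σ) with hτd
  have hτ2 : τ ^ 2 = p * q * σ := Real.sq_sqrt (by positivity)
  have hτ : 1 < τ := by
    rw [hτd, Real.lt_sqrt zero_le_one, hσ, one_pow, ← mul_div_assoc, lt_div_iff₀ (by linarith)]
    have h1 : p ≤ p * q := le_mul_of_one_le_right (by linarith) hq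
    have h2 : p * q ≤ p * q * q := le_mul_of_one_le_right (by positivity) hq
    linarith
  have hτ0 : 0 < τ - 1 := by linarith
  refine ⟨(τ - 1)⁻¹ * C1, by positivity,
    fun A B u v ⟨hs, ⟨ξ, ζ, hξ, hζ, hξ0, hζ0, h1, h2⟩, hc⟩ => ?_⟩
  have cθ : ContDiff ℝ 2 fun x => θ x ^ (k + 1) := hθ.contDiff.pow _
  have cu1 := hs.cu.of_le one_le_two
  have cθ1 : ContDiffOn ℝ 1 (fun x => θ x ^ (k + 1)) Ω := cθ.contDiffOn.of_le one_le_two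
  have z : ∀ x ∉ K, θ x ^ (k + 1) = 0 := fun x hx => by simp [hθ.eq_zero x hx]
  obtain ⟨D, hD, hd⟩ := stable_ineq hΩ hK hKΩ hξ hζ hξ0 hζ0
    (P := fun x => p * A x * v x ^ (p - 1)) (Q := fun x => q * B x * u x ^ (q - 1))
    (S := fun x => τ * (A x * v x ^ p / u x)) (φ := fun x => u x * θ x ^ (k + 1))
    (fun x hx => by
      have := hs.A_pos x hx
      have := Real.rpow_pos_of_pos (hs.v_pos x hx) (p - 1)
      positivity)
    (fun x hx => by
      have := hs.B_pos x hx
      have := Real.rpow_pos_of_pos (hs.u_pos x hx) (q - 1)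
      positivity) h1 h2
    (fun x hx => by
      have ha := hs.A_pos x hx
      have hu := hs.u_pos x hx
      have hv := hs.v_pos x hx
      have e1 : u x ^ (q - 1) = u x ^ (q + 1) / u x ^ 2 := by
        rw [← Real.rpow_natCast, ← Real.rpow_sub hu]; congr 1; push_cast; ring
      have e2 : v x ^ (p - 1) * v x ^ (p + 1) = (v x ^ p) ^ 2 := by
        rw [← Real.rpow_natCast, ← Real.rpow_add hv, ← Real.rpow_mul hv.le]
        congr 1; push_cast; ring
      have h3 : σ * (A x * v x ^ (p + 1)) ≤ B x * u x ^ (q + 1) := by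
        have := hc x hx
        rw [hσ, div_mul_eq_mul_div, div_le_iff₀ (by linarith)]
        linarith
      have hw : 0 < v x ^ (p - 1) := Real.rpow_pos_of_pos hv _
      have h4 := mul_le_mul_of_nonneg_left h3
        (by positivity : 0 ≤ p * q * (A x * v x ^ (p - 1)) / u x ^ 2)
      rw [e1]
      calc _ = τ ^ 2 * A x ^ 2 * (v x ^ p) ^ 2 / u x ^ 2 := by ring
        _ = p * q * (A x * v x ^ (p - 1)) / u x ^ 2 * (σ * (A x * v x ^ (p + 1))) := by
          rw [hτ2, ← e2]; ring
        _ ≤ _ := h4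
        _ = _ := by ring)
    (cu1.mul cθ1) (fun x hx => by simp [hθ.eq_zero x hx])
  have nd := nullOn_div hΩ hK hKΩ (f := fun x => u x * (θ x ^ (k + 1) * θ x ^ (k + 1)))
    (cu1.mul (cθ1.mul cθ1)) hs.cu (Or.inl fun x hx => by rw [z x hx]; simp)
  have main : LeMod K (fun x => (τ - 1) * (A x * (u x * v x ^ p) * θ x ^ (2 * k + 2)))
      fun x => C1 * (u x ^ 2 * θ x ^ (2 * k)) := by
    refine ⟨_, hD.add hK nd, fun x hx => ?_⟩
    have hxΩ := hKΩ hx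
    have h := hd x hx
    have hu := hs.u_pos x hxΩ
    beta_reduce at h ⊢
    have du := diffAt_of_contDiffOn hΩ cu1 hxΩ
    have dθ := diffAt_of_contDiffOn hΩ cθ1 hxΩ
    rw [gdot_mul du dθ, gdot_comm u, gdot_comm (fun y => θ y ^ (k + 1)), gdot_mul du dθ,
      gdot_mul du dθ, gdot_comm (fun y => θ y ^ (k + 1)) u] at h
    rw [gdot_mul du (dθ.fun_mul dθ), gdot_mul dθ dθ, gdot_comm (fun y => θ y ^ (k + 1)) u,
      hs.lap_u x hxΩ]
    have b := mul_le_mul_of_nonneg_left (hb x).1 (sq_nonneg (u x))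
    have e : τ * (A x * v x ^ p / u x) * (u x * θ x ^ (k + 1)) ^ 2 =
        τ * (A x * (u x * v x ^ p) * θ x ^ (2 * k + 2)) := by
      field_simp
      ring
    rw [e] at h
    have e2 : θ x ^ (2 * k + 2) = θ x ^ (k + 1) * θ x ^ (k + 1) := by ring
    have e3 : θ x ^ (2 * k) = (θ x ^ k) ^ 2 := by ring
    rw [e2] at h ⊢
    rw [e3]
    linarith
  refine (main.const_mul (inv_nonneg.2 hτ0.le)).of_le (fun x _ => ?_) fun x _ => ?_
  · rw [inv_mul_cancel_left₀ hτ0.ne']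
  · rw [mul_assoc]

lemma IsComparable.grad_le (hΩ : IsOpen Ω) (hK : IsCompact K) (hKΩ : K ⊆ Ω) (hθ : IsCutoff K θ)
    (hp : 1 < p) (hq : 1 ≤ q) (k : ℕ) :
    ∃ C, 0 ≤ C ∧ ∀ A B u v, IsComparable Ω A B p q u v →
      LeMod K (fun x => gdot u u x * θ x ^ (2 * k + 2)) fun x =>
        C * (u x ^ 2 * θ x ^ (2 * k)) := by
  obtain ⟨C1, hC1, h1⟩ := IsSys.grad_le (Ω := Ω) hK hKΩ hθ k
  obtain ⟨C2, hC2, h2⟩ := IsComparable.stab_le hΩ hK hKΩ hθ hp hq k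
  refine ⟨C1 + 2 * C2, by positivity, fun A B u v h => ?_⟩
  have i1 := h1 A B u v (fun _ => 1) p q h.1 contDiffOn_const (fun _ _ => one_pos)
    fun x _ => by rw [lap_const]
  exact (i1.add hK ((h2 A B u v h).const_mul zero_le_two)).of_sub_le fun x _ => by
    linarith

lemma IsComparable.rpow_le (hK : IsCompact K) (hKΩ : K ⊆ Ω) (hA : ContinuousOn A K)
    (hB : ContinuousOn B K) (hA0 : ∀ x ∈ K, 0 < A x) (hp : 0 < p) (hq : 0 < q) :
    ∃ M, 0 < M ∧ ∀ u v, IsComparable Ω A B p q u v → ∀ x ∈ K,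
      v x ^ (p + 1) ≤ M * (v x ^ p * u x ^ ((q + 1) / (p + 1))) := by
  obtain ⟨α, hα, hαA⟩ := exists_pos_lower_bound hK hA hA0
  obtain ⟨β, hβ, hβB⟩ := exists_upper_bound hK hB
  refine ⟨((p + 1) * (β + 1) / ((q + 1) * α)) ^ (1 / (p + 1)), by positivity,
    fun u v ⟨hs, _, hc⟩ x hx => ?_⟩
  have hu := hs.u_pos x (hKΩ hx)
  have hv := hs.v_pos x (hKΩ hx)
  have h := hc x (hKΩ hx)
  have hW : 0 < v x ^ (p + 1) := Real.rpow_pos_of_pos hv _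
  have hZ : 0 < u x ^ (q + 1) := Real.rpow_pos_of_pos hu _
  have h1 : α * v x ^ (p + 1) ≤ A x * v x ^ (p + 1) :=
    mul_le_mul_of_nonneg_right (hαA x hx) hW.le
  have h2 : B x * u x ^ (q + 1) ≤ (β + 1) * u x ^ (q + 1) :=
    mul_le_mul_of_nonneg_right (by linarith [hβB x hx, le_abs_self (B x)]) hZ.le
  have h3 : v x ^ (p + 1) ≤ (p + 1) * (β + 1) / ((q + 1) * α) * u x ^ (q + 1) := by
    rw [div_mul_eq_mul_div, le_div_iff₀ (by positivity)]
    have := mul_le_mul_of_nonneg_left h1 (by positivity : 0 ≤ q + 1)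
    have := mul_le_mul_of_nonneg_left h2 (by positivity : 0 ≤ p + 1)
    linarith
  have h4 := Real.rpow_le_rpow hW.le h3 (by positivity : 0 ≤ 1 / (p + 1))
  rw [← Real.rpow_mul hv.le, mul_one_div_cancel (by positivity), Real.rpow_one,
    Real.mul_rpow (by positivity) hZ.le, ← Real.rpow_mul hu.le, mul_one_div] at h4
  rw [Real.rpow_add_one hv.ne']
  have := mul_le_mul_of_nonneg_left h4 (Real.rpow_pos_of_pos hv p).le
  linarith

lemma comparable_absorb {M W X Y Z F C1 C2 C4 α δ δ1 δ2 : ℝ} (hM : 0 < M) (hα : 0 < α)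
    (hC1 : 0 ≤ C1) (hC4 : 0 ≤ C4) (hδ : 0 < δ) (hδ1 : δ1 = δ * α / (2 * M * (C4 + 1)))
    (hδ2 : δ2 = 1 / (2 * (M * C1 + 1))) (hW : 0 ≤ W) (hZ : 0 ≤ Z)
    (h1 : W ≤ M * (δ1 * X + C1 * Y)) (h2 : Y ≤ δ2 * W + C2) (h3 : α * X ≤ F)  :
    W - (δ * Z + (δ + 2 * (M * C1 * C2))) ≤
      δ / (C4 + 1) * F - δ / (C4 + 1) * (C4 * (1 + Z)) := by
  have k1 := mul_le_mul_of_nonneg_left h2 (by positivity : 0 ≤ 2 * (M * C1))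
  have k2 := mul_le_mul_of_nonneg_left h3 (by positivity : 0 ≤ δ / (C4 + 1))
  have e1 : 2 * (M * C1) * (δ2 * W) ≤ W := by
    have : 2 * (M * C1) * (δ2 * W) = M * C1 / (M * C1 + 1) * W := by rw [hδ2]; field_simp
    rw [this]
    refine mul_le_of_le_one_left hW ((div_le_one (by positivity)).2 (by linarith))
  have e2 : 2 * (M * (δ1 * X)) = δ / (C4 + 1) * (α * X) := by rw [hδ1]; field_simp
  have e3 : δ / (C4 + 1) * (C4 * (1 + Z)) ≤ δ * (1 + Z) := by
    have : δ / (C4 + 1) * (C4 * (1 + Z)) = C4 / (C4 + 1) * (δ * (1 + Z)) := by ring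
    rw [this]
    exact mul_le_of_le_one_left (by positivity) ((div_le_one (by positivity)).2 (by linarith))
  linarith

lemma IsComparable.rpow_integral_le_of_lt (hΩ : IsOpen Ω) (hK : IsCompact K) (hKΩ : K ⊆ Ω)
    (hθ : IsCutoff K θ) (hA : ContinuousOn A K) (hB : ContinuousOn B K) (hA0 : ∀ x ∈ K, 0 < A x)
    (hp : 1 < p) (hq : 1 ≤ q) (hqp : q < p) :
    ∃ k₀ : ℕ, ∀ k ≥ k₀, ∀ δ > 0, ∃ C, 0 ≤ C ∧ ∀ u v, IsComparable Ω A B p q u v →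
      LeMod K (fun x => v x ^ (p + 1) * θ x ^ (2 * k + 4)) fun x =>
        δ * (u x ^ (q + 1) * θ x ^ (2 * k + 4)) + C := by
  obtain ⟨α, hα, hαA⟩ := exists_pos_lower_bound hK hA hA0
  obtain ⟨M, hM, hMb⟩ := IsComparable.rpow_le hK hKΩ hA hB hA0 (by linarith : 0 < p)
    (by linarith : 0 < q)
  have hσ1 : (q + 1) / (p + 1) < 1 := (div_lt_one (by linarith)).2 (by linarith)
  have hs1 : p / (p + 1) < 1 := (div_lt_one (by linarith)).2 (by linarith)
  obtain ⟨n, hn⟩ := exists_nat_mul_le hσ1 2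
  have hn := hn n le_rfl
  obtain ⟨r₀, hr₀⟩ := exists_nat_mul_le hs1 (2 * n + 4)
  refine ⟨n + r₀, fun k hk δ hδ => ?_⟩
  obtain ⟨t, rfl⟩ := Nat.exists_eq_add_of_le hk
  have hr := hr₀ (r₀ + t) (Nat.le_add_right _ _)
  obtain ⟨C4, hC4, h4⟩ := IsComparable.stab_le hΩ hK hKΩ hθ hp hq (n + r₀ + t + 2)
  set δ1 := δ * α / (2 * M * (C4 + 1)) with hδ1
  obtain ⟨C1, hC1, h1⟩ := rpow_mul_pow_le (k := 2 * n + 2) (k' := 2 * n) (δ := δ1)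
    (by positivity) hσ1 (by positivity) (by push_cast; exact hn)
  set δ2 := 1 / (2 * (M * C1 + 1)) with hδ2
  obtain ⟨C2, hC2, h2⟩ := rpow_mul_pow_le (k := 2 * (n + r₀ + t) + 4) (k' := 2 * (r₀ + t) + 4)
    (δ := δ2) (by positivity) hs1 (by positivity) (by push_cast at hr ⊢; linarith)
  refine ⟨δ + 2 * (M * C1 * C2), by positivity, fun u v h => ?_⟩
  have i4 := ((h4 A B u v h).trans hK (B := _) (C := fun x => C4 * (1 + u x ^ (q + 1) *
    θ x ^ (2 * (n + r₀ + t) + 4))) ⟨_, NullOn.zero, fun x hx => by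
      have hu := h.1.u_pos x (hKΩ hx)
      have t0 := hθ.nonneg x
      have t1 := pow_le_one₀ t0 (hθ.le_one x) (n := 2 * (n + r₀ + t) + 4)
      have := rpow_le_one_add_rpow hu.le zero_le_two (by linarith : 2 ≤ q + 1)
      rw [Real.rpow_two] at this
      have := mul_le_mul_of_nonneg_right this (pow_nonneg t0 (2 * (n + r₀ + t) + 4))
      have e : 2 * (n + r₀ + t + 2) = 2 * (n + r₀ + t) + 4 := by ring
      rw [add_zero, e]
      refine mul_le_mul_of_nonneg_left ?_ hC4
      linarith⟩).const_mul (by positivity : 0 ≤ δ / (C4 + 1))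
  refine i4.of_sub_le fun x hx => ?_
  have hu := h.1.u_pos x (hKΩ hx)
  have hv := h.1.v_pos x (hKΩ hx)
  have t0 := hθ.nonneg x
  have t1 := hθ.le_one x
  have hvp : 0 < v x ^ p := Real.rpow_pos_of_pos hv _
  have hW : 0 < v x ^ (p + 1) := Real.rpow_pos_of_pos hv _
  have hZ : 0 < u x ^ (q + 1) := Real.rpow_pos_of_pos hu _
  have j1 := h1 (u x) (θ x) hu.le t0 t1
  have j2 := h2 (v x ^ (p + 1)) (θ x) hW.le t0 t1
  rw [← Real.rpow_mul hv.le, mul_div_cancel₀ _ (by linarith : p + 1 ≠ 0)] at j2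
  have j3 := mul_le_mul_of_nonneg_right (hMb u v h x hx) (pow_nonneg t0 (2 * (n + r₀ + t) + 4))
  have j5 := mul_le_mul_of_nonneg_left j1
    (by positivity : 0 ≤ M * (v x ^ p * θ x ^ (2 * (r₀ + t) + 4)))
  refine comparable_absorb (X := v x ^ p * u x * θ x ^ (2 * (n + r₀ + t) + 6))
    (Y := v x ^ p * θ x ^ (2 * (r₀ + t) + 4)) hM hα hC1 hC4 hδ hδ1 hδ2 (by positivity)
    (by positivity) ?_ j2 ?_
  · have e1 : θ x ^ (2 * (n + r₀ + t) + 4) = θ x ^ (2 * n) * θ x ^ (2 * (r₀ + t) + 4) := by ring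
    have e2 : θ x ^ (2 * (n + r₀ + t) + 6) = θ x ^ (2 * n + 2) * θ x ^ (2 * (r₀ + t) + 4) := by
      ring
    rw [e1] at j3 ⊢
    rw [e2]
    linarith
  · have := mul_le_mul_of_nonneg_right (hαA x hx)
      (by positivity : 0 ≤ u x * v x ^ p * θ x ^ (2 * (n + r₀ + t) + 6))
    have e : 2 * (n + r₀ + t + 2) + 2 = 2 * (n + r₀ + t) + 6 := by ring
    rw [e]
    linarith

lemma IsComparable.rpow_integral_le_of_eq (hΩ : IsOpen Ω) (hK : IsCompact K) (hKΩ : K ⊆ Ω)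
    (hθ : IsCutoff K θ) (hA : ContinuousOn A K) (hB : ContinuousOn B K) (hA0 : ∀ x ∈ K, 0 < A x)
    (hp : 1 < p) :
    ∃ k₀ : ℕ, ∀ k ≥ k₀, ∀ δ > 0, ∃ C, 0 ≤ C ∧ ∀ u v, IsComparable Ω A B p p u v →
      LeMod K (fun x => v x ^ (p + 1) * θ x ^ (2 * k + 4)) fun x =>
        δ * (u x ^ (p + 1) * θ x ^ (2 * k + 4)) + C := by
  obtain ⟨α, hα, hαA⟩ := exists_pos_lower_bound hK hA hA0
  obtain ⟨M, hM, hMb⟩ := IsComparable.rpow_le hK hKΩ hA hB hA0 (by linarith : 0 < p)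
    (by linarith : 0 < p)
  have hs1 : 2 / (p + 1) < 1 := (div_lt_one (by linarith)).2 (by linarith)
  obtain ⟨k₀, hk₀⟩ := exists_nat_mul_le hs1 4
  refine ⟨k₀, fun k hk δ hδ => ?_⟩
  obtain ⟨C4, hC4, h4⟩ := IsComparable.stab_le hΩ hK hKΩ hθ hp hp.le (k + 1)
  obtain ⟨C1, hC1, h1⟩ := rpow_mul_pow_le (k := 2 * k + 4) (k' := 2 * (k + 1))
    (δ := δ * α / (M * (C4 + 1))) (by positivity) hs1 (by positivity)
    (by have := hk₀ k hk; push_cast; linarith)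
  refine ⟨M / α * (C4 * C1), by positivity, fun u v h => ?_⟩
  refine ((h4 A B u v h).const_mul (by positivity : 0 ≤ M / α)).of_le (fun x hx => ?_)
    fun x hx => ?_
  · have hu := h.1.u_pos x (hKΩ hx)
    have hv := h.1.v_pos x (hKΩ hx)
    have hvp : 0 < v x ^ p := Real.rpow_pos_of_pos hv _
    have t0 := hθ.nonneg x
    have j3 := mul_le_mul_of_nonneg_right (hMb u v h x hx) (pow_nonneg t0 (2 * k + 4))
    rw [div_self (by linarith), Real.rpow_one] at j3
    have := mul_le_mul_of_nonneg_right (hαA x hx)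
      (by positivity : 0 ≤ M / α * (u x * v x ^ p * θ x ^ (2 * k + 4)))
    have e : α * (M / α * (u x * v x ^ p * θ x ^ (2 * k + 4))) =
      M * (v x ^ p * u x) * θ x ^ (2 * k + 4) := by field_simp
    have e2 : 2 * (k + 1) + 2 = 2 * k + 4 := by ring
    rw [e2]
    linarith
  · have hu := h.1.u_pos x (hKΩ hx)
    have hZ : 0 < u x ^ (p + 1) := Real.rpow_pos_of_pos hu _
    have t0 := hθ.nonneg x
    have j := h1 (u x ^ (p + 1)) (θ x) hZ.le t0 (hθ.le_one x)
    rw [← Real.rpow_mul hu.le, mul_div_cancel₀ _ (by linarith : p + 1 ≠ 0), Real.rpow_two] at j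
    have j2 := mul_le_mul_of_nonneg_left j (by positivity : 0 ≤ M / α * C4)
    have e : M / α * C4 * (δ * α / (M * (C4 + 1)) * (u x ^ (p + 1) * θ x ^ (2 * k + 4))) =
        C4 / (C4 + 1) * (δ * (u x ^ (p + 1) * θ x ^ (2 * k + 4))) := by field_simp
    have e2 : C4 / (C4 + 1) * (δ * (u x ^ (p + 1) * θ x ^ (2 * k + 4))) ≤
        δ * (u x ^ (p + 1) * θ x ^ (2 * k + 4)) :=
      mul_le_of_le_one_left (by positivity) ((div_le_one (by positivity)).2 (by linarith))
    linarith

end ComparisonEnergy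

section ComparisonFlux

variable {N : ℕ} {Ω K E : Set (Euc N)} {A B u v θ : Euc N → ℝ} {p q : ℝ} {x : Euc N}

lemma comparable_energy_arith {γ α M w z g V U C1 C2 C3 E1 E2 F d d1 d3 δ1 : ℝ} (hγ : 0 < γ)
    (hα : 0 ≤ α) (hM : M = α + 1 + γ / 4) (hC1 : 0 ≤ C1) (hC2 : 0 ≤ C2) (hC3 : 0 ≤ C3)
    (hδ1 : δ1 = γ / (4 * (C1 + 1))) (hw : 0 ≤ w) (hz : 0 ≤ z)
    (h1 : γ * z + d ≤ α * w + (δ1 * g + 1 / δ1 * (C2 * V)) + C3 * U)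
    (h2 : g ≤ C1 * (1 + z) + d1) (h3 : V ≤ δ1 / (C2 + 1) * w + E1)
    (h4 : U ≤ γ / (4 * (C3 + 1)) * (w + z) + E2) (h5 : w ≤ γ / (4 * M) * z + F + d3) :
    γ / 8 * (w + z) ≤ γ / 4 + C2 * E1 / δ1 + C3 * E2 + 3 / 2 * M * F +
      (δ1 * d1 + (-1) * d + 3 / 2 * M * d3) := by
  have hM0 : 0 < M := by rw [hM]; positivity
  have hδ : 0 < δ1 := by rw [hδ1]; positivity
  have frac : ∀ {C : ℝ}, 0 ≤ C → C / (C + 1) ≤ 1 := fun {C} hC =>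
    (div_le_one (by linarith)).2 (by linarith)
  have k2 := mul_le_mul_of_nonneg_left h2 hδ.le
  have k3 := mul_le_mul_of_nonneg_left h3 (by positivity : 0 ≤ 1 / δ1 * C2)
  have k4 := mul_le_mul_of_nonneg_left h4 hC3
  have k5 := mul_le_mul_of_nonneg_left h5 (by positivity : 0 ≤ 3 / 2 * M)
  have e1 : δ1 * (C1 * (1 + z)) ≤ γ / 4 * (1 + z) := by
    have e : δ1 * (C1 * (1 + z)) = C1 / (C1 + 1) * (γ / 4 * (1 + z)) := by
      rw [hδ1]; field_simp
    rw [e]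
    exact mul_le_of_le_one_left (by positivity) (frac hC1)
  have e2 : 1 / δ1 * C2 * (δ1 / (C2 + 1) * w) ≤ w := by
    have e : 1 / δ1 * C2 * (δ1 / (C2 + 1) * w) = C2 / (C2 + 1) * w := by field_simp
    rw [e]
    exact mul_le_of_le_one_left hw (frac hC2)
  have e3 : C3 * (γ / (4 * (C3 + 1)) * (w + z)) ≤ γ / 4 * (w + z) := by
    have e : C3 * (γ / (4 * (C3 + 1)) * (w + z)) = C3 / (C3 + 1) * (γ / 4 * (w + z)) := by
      field_simp
    rw [e]
    exact mul_le_of_le_one_left (by positivity) (frac hC3)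
  have e4 : 3 / 2 * M * (γ / (4 * M) * z) = 3 / 8 * γ * z := by field_simp; ring
  have e5 : 1 / δ1 * C2 * E1 = C2 * E1 / δ1 := by ring
  have e6 : M * w = α * w + w + γ / 4 * w := by rw [hM]; ring
  have e7 : 0 ≤ α * w := by positivity
  linarith

lemma IsComparable.energy_le (hΩ : IsOpen Ω) (hK : IsCompact K) (hKΩ : K ⊆ Ω)
    (hθ : IsCutoff K θ) (hA : ContinuousOn A K) (hB : ContinuousOn B K)
    (hA0 : ∀ x ∈ K, 0 < A x) (hB0 : ∀ x ∈ K, 0 < B x) (hp : 1 < p) (hq : 1 ≤ q) (hqp : q ≤ p) :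
    ∃ (k : ℕ) (C : ℝ), 0 ≤ C ∧ ∀ u v, IsComparable Ω A B p q u v →
      LeMod K (fun x => (v x ^ (p + 1) + u x ^ (q + 1)) * θ x ^ (2 * k + 4)) fun _ => C := by
  obtain ⟨γ, hγ, hγB⟩ := exists_pos_lower_bound hK hB hB0
  obtain ⟨α, hα, hαA⟩ := exists_upper_bound hK hA
  have hs1 : 2 / (p + 1) < 1 := (div_lt_one (by linarith)).2 (by linarith)
  have hs2 : 1 / (p + 1) + 1 / (q + 1) < 1 := by
    rw [div_add_div _ _ (by positivity) (by positivity), div_lt_one (by positivity)]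
    nlinarith
  have hk₀ : ∃ k₀ : ℕ, ∀ k ≥ k₀, ∀ δ > 0, ∃ C, 0 ≤ C ∧ ∀ u v, IsComparable Ω A B p q u v →
      LeMod K (fun x => v x ^ (p + 1) * θ x ^ (2 * k + 4)) fun x =>
        δ * (u x ^ (q + 1) * θ x ^ (2 * k + 4)) + C := by
    rcases hqp.eq_or_lt with rfl | h
    · exact IsComparable.rpow_integral_le_of_eq hΩ hK hKΩ hθ hA hB hA0 hp
    · exact IsComparable.rpow_integral_le_of_lt hΩ hK hKΩ hθ hA hB hA0 hp hq h
  obtain ⟨k₀, hk₀⟩ := hk₀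
  obtain ⟨k₁, hk₁⟩ := exists_nat_mul_le hs1 4
  obtain ⟨k₂, hk₂⟩ := exists_nat_mul_le hs2 4
  set k := k₀ + k₁ + k₂ with hk
  have hk₁ := hk₁ k (by omega)
  have hk₂ := hk₂ k (by omega)
  obtain ⟨C1, hC1, h1⟩ := IsComparable.grad_le hΩ hK hKΩ hθ hp hq (k + 2)
  obtain ⟨C2, hC2, h2⟩ := hθ.pow_bound (2 * k + 3)
  obtain ⟨C3, hC3, h3⟩ := hθ.pow_bound (2 * k + 2)
  set δ1 := γ / (4 * (C1 + 1)) with hδ1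
  have hδ1' : 0 < δ1 := by positivity
  obtain ⟨E1, hE1, y1⟩ := rpow_mul_pow_le (k := 2 * k + 4) (k' := 2 * k) (δ := δ1 / (C2 + 1))
    (by positivity) hs1 (by positivity) (by push_cast; exact hk₁)
  obtain ⟨E2, hE2, y2⟩ := young_uv (k := 2 * k + 4) (k' := 2 * k + 2) (δ := γ / (4 * (C3 + 1)))
    (by linarith) (by linarith) zero_le_one zero_le_one hs2 (by positivity)
    (by push_cast; linarith)
  set M := α + 1 + γ / 4 with hM
  have hM0 : 0 < M := by positivity
  obtain ⟨F, hF, y3⟩ := hk₀ k (by omega) (γ / (4 * M)) (by positivity)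
  refine ⟨k, 8 / γ * (γ / 4 + C2 * E1 / δ1 + C3 * E2 + 3 / 2 * M * F), by positivity,
    fun u v h => ?_⟩
  obtain ⟨d1, hd1, g1⟩ := h1 A B u v h
  obtain ⟨d3, hd3, g3⟩ := y3 u v h
  obtain ⟨d, hd, g⟩ := h.1.cross_identity hK hKΩ (η := fun x => θ x ^ (2 * k + 4))
    (hθ.contDiff.pow _).contDiffOn (fun x hx => by simp [hθ.eq_zero x hx])
  have main : LeMod K (fun x => γ / 8 * (v x ^ (p + 1) * θ x ^ (2 * k + 4) +
      u x ^ (q + 1) * θ x ^ (2 * k + 4)))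
      fun _ => γ / 4 + C2 * E1 / δ1 + C3 * E2 + 3 / 2 * M * F := by
    refine ⟨_, ((hd1.const_mul δ1).add hK (hd.const_mul (-1))).add hK (hd3.const_mul (3 / 2 * M)),
      fun x hx => ?_⟩
    have hu := h.1.u_pos x (hKΩ hx)
    have hv := h.1.v_pos x (hKΩ hx)
    have t0 := hθ.nonneg x
    have t1 := hθ.le_one x
    have hW : 0 < v x ^ (p + 1) := Real.rpow_pos_of_pos hv _
    have hZ : 0 < u x ^ (q + 1) := Real.rpow_pos_of_pos hu _
    have i1 := g1 x hx
    have i2 := y1 (v x ^ (p + 1)) (θ x) hW.le t0 t1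
    rw [← Real.rpow_mul hv.le, mul_div_cancel₀ _ (by linarith : p + 1 ≠ 0), Real.rpow_two] at i2
    have i3 := y2 (u x) (v x) (θ x) hu hv t0 t1
    rw [Real.rpow_one, Real.rpow_one] at i3
    have i4 := g3 x hx
    have i5 := g x hx
    have gg := gdot_self_nonneg u x
    have s1 := mul_le_add_of_sq_le (s := v x * gdot u (fun x => θ x ^ (2 * k + 4)) x) (c := 2)
      (ε := δ1) (α := gdot u u x * θ x ^ (2 * k + 6)) (β := C2 * (v x ^ 2 * θ x ^ (2 * k)))
      (by positivity) (by positivity) hδ1' (by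
        have a1 := gdot_sq_le u (fun x => θ x ^ (2 * k + 4)) x
        have a2 := mul_le_mul_of_nonneg_left (h2 x).1 gg
        have a3 := mul_le_mul_of_nonneg_left (a1.trans a2) (sq_nonneg (v x))
        calc _ = v x ^ 2 * gdot u (fun x => θ x ^ (2 * k + 4)) x ^ 2 := by ring
          _ ≤ _ := a3
          _ = _ := by ring)
    have s2 : |u x * v x * lap (fun x => θ x ^ (2 * k + 4)) x| ≤
        C3 * (v x * u x * θ x ^ (2 * k + 2)) := by
      rw [abs_mul, abs_of_pos (mul_pos hu hv)]
      have := mul_le_mul_of_nonneg_left (h3 x).2 (mul_pos hu hv).le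
      refine this.trans (le_of_eq ?_)
      ring
    have s3 := mul_le_mul_of_nonneg_right (hγB x hx)
      (by positivity : 0 ≤ u x ^ (q + 1) * θ x ^ (2 * k + 4))
    have s4 := mul_le_mul_of_nonneg_right ((le_abs_self _).trans (hαA x hx))
      (by positivity : 0 ≤ v x ^ (p + 1) * θ x ^ (2 * k + 4))
    refine comparable_energy_arith (α := α) (V := v x ^ 2 * θ x ^ (2 * k))
      (U := v x * u x * θ x ^ (2 * k + 2)) (g := gdot u u x * θ x ^ (2 * k + 6)) hγ hα hM hC1
      hC2 hC3 hδ1 (by positivity) (by positivity) ?_ ?_ i2 (by linarith only [i3])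
      (by linarith only [i4])
    · have e : (2 : ℝ) ^ 2 / (4 * δ1) = 1 / δ1 := by field_simp; norm_num
      rw [e] at s1
      have b1 := neg_abs_le (2 * (v x * gdot u (fun x => θ x ^ (2 * k + 4)) x))
      have b2 := neg_abs_le (u x * v x * lap (fun x => θ x ^ (2 * k + 4)) x)
      linarith only [s1, s2, s3, s4, i5, b1, b2]
    · have e1 : 2 * (k + 2) + 2 = 2 * k + 6 := by ring
      have e2 : 2 * (k + 2) = 2 * k + 4 := by ring
      rw [e1, e2] at i1
      refine i1.trans (add_le_add_left (mul_le_mul_of_nonneg_left ?_ hC1) _)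
      have c1 := rpow_le_one_add_rpow hu.le zero_le_two (by linarith : 2 ≤ q + 1)
      rw [Real.rpow_two] at c1
      have c2 := mul_le_mul_of_nonneg_right c1 (pow_nonneg t0 (2 * k + 4))
      have c3 := pow_le_one₀ t0 t1 (n := 2 * k + 4)
      linarith only [c2, c3]
  refine (main.const_mul (by positivity : 0 ≤ 8 / γ)).of_le (fun x _ => le_of_eq ?_)
    fun x _ => le_rfl
  field_simp

/-- The flux bounds for stable solutions with comparable components. -/
lemma IsComparable.fluxBdd (hΩ : IsOpen Ω) (hK : IsCompact K) (hKΩ : K ⊆ Ω) (hE : IsClosed E)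
    (hEK : E ⊆ K) (hθ : IsCutoff K θ) (hθE : ∀ x ∈ E, θ x = 1) (hA : ContinuousOn A K)
    (hB : ContinuousOn B K) (hA0 : ∀ x ∈ K, 0 < A x) (hB0 : ∀ x ∈ K, 0 < B x)
    (hp : 1 < p) (hq : 1 ≤ q) (hqp : q ≤ p) : FluxBdd K E p q (IsComparable Ω A B p q) := by
  obtain ⟨k, C, hC, h⟩ := IsComparable.energy_le hΩ hK hKΩ hθ hA hB hA0 hB0 hp hq hqp
  obtain ⟨β, hβ, hβB⟩ := exists_upper_bound hK hB
  obtain ⟨C1, hC1, h1⟩ := IsComparable.grad_le hΩ hK hKΩ hθ hp hq (k + 2)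
  obtain ⟨C2, hC2, h2⟩ := IsSys.grad_le (Ω := Ω) hK hKΩ hθ (k + 2)
  have hs : 1 / (p + 1) + q / (q + 1) ≤ 1 := by
    rw [div_add_div _ _ (by positivity) (by positivity), div_le_one (by positivity)]
    nlinarith
  have nn : ∀ u v, IsComparable Ω A B p q u v → ∀ x ∈ K, 0 < u x ∧ 0 < v x ∧
      0 < u x ^ (q + 1) ∧ 0 < v x ^ (p + 1) := fun u v hc x hx =>
    ⟨hc.1.u_pos x (hKΩ hx), hc.1.v_pos x (hKΩ hx),
      Real.rpow_pos_of_pos (hc.1.u_pos x (hKΩ hx)) _,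
      Real.rpow_pos_of_pos (hc.1.v_pos x (hKΩ hx)) _⟩
  have sq_u : ∀ u v, IsComparable Ω A B p q u v → ∀ x ∈ K, u x ^ 2 ≤ 1 + u x ^ (q + 1) ∧
      v x ^ 2 ≤ 1 + v x ^ (p + 1) := fun u v hc x hx => by
    obtain ⟨hu, hv, -, -⟩ := nn u v hc x hx
    rw [← Real.rpow_two, ← Real.rpow_two]
    exact ⟨rpow_le_one_add_rpow hu.le zero_le_two (by linarith),
      rpow_le_one_add_rpow hv.le zero_le_two (by linarith)⟩
  refine FluxBdd.of_gradient (En := fun u v x =>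
    2 + ((v x ^ (p + 1) + u x ^ (q + 1)) * θ x ^ (2 * k + 4) +
      (gdot u u x * θ x ^ (2 * (k + 2) + 2) + 1 * gdot v v x * θ x ^ (2 * (k + 2) + 2))))
    (C := 2 + (C + (C1 * (1 + C) + (2 * β + C2) * (1 + C)))) hΩ hK hKΩ hE hEK
    (fun u v hc => ⟨hc.1.cu.of_le one_le_two, hc.1.cv.of_le one_le_two, hc.1.u_pos,
      hc.1.v_pos⟩) fun u v hc => ?_
  have one : LeMod K (fun x => 1 + (v x ^ (p + 1) + u x ^ (q + 1)) * θ x ^ (2 * k + 4))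
      fun _ => 1 + C :=
    LeMod.add hK ⟨_, NullOn.zero, fun x _ => by simp⟩ (h u v hc)
  refine ⟨LeMod.add hK ⟨_, NullOn.zero, fun x _ => by simp⟩ ((h u v hc).add hK (LeMod.add hK
    ((h1 A B u v hc).trans hK ((one.const_mul hC1).of_le (fun x hx => ?_) fun x _ => le_rfl))
    ((h2 B A v u (fun _ => 1) q p hc.1.swap contDiffOn_const (fun _ _ => one_pos)
      fun x _ => by rw [lap_const]).trans hK
      ((one.const_mul (by positivity : 0 ≤ 2 * β + C2)).of_le (fun x hx => ?_)
        fun x _ => le_rfl)))), fun x hx => ?_, fun x hx hxE => ?_⟩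
  · obtain ⟨hu, hv, hZ, hW⟩ := nn u v hc x hx
    have t0 := hθ.nonneg x
    have t1 := pow_le_one₀ t0 (hθ.le_one x) (n := 2 * k + 4)
    have e2 : 2 * (k + 2) = 2 * k + 4 := by ring
    rw [e2]
    refine mul_le_mul_of_nonneg_left ?_ hC1
    have c2 := mul_le_mul_of_nonneg_right (sq_u u v hc x hx).1 (pow_nonneg t0 (2 * k + 4))
    have := mul_nonneg hW.le (pow_nonneg t0 (2 * k + 4))
    linarith
  · obtain ⟨hu, hv, hZ, hW⟩ := nn u v hc x hx
    have t0 := hθ.nonneg x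
    have t4 := pow_nonneg t0 (2 * k + 4)
    have t1 := pow_le_one₀ t0 (hθ.le_one x) (n := 2 * k + 4)
    have e1 : 2 * (k + 2) + 2 = 2 * k + 4 + 2 := by ring
    have e2 : 2 * (k + 2) = 2 * k + 4 := by ring
    have t2 : θ x ^ (2 * k + 4 + 2) ≤ θ x ^ (2 * k + 4) :=
      pow_le_pow_of_le_one t0 (hθ.le_one x) (by omega)
    have c1 := rpow_mul_rpow_le (p := p) (q := q) (c := 1) (d := q) (by linarith) (by linarith)
      zero_le_one (by linarith) hu hv
    have c2 := rpow_le_one_add_rpow (t := v x ^ (p + 1) + u x ^ (q + 1)) (by positivity)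
      (by positivity) hs
    rw [Real.rpow_one] at c1 c2
    have hB' : B x ≤ β := (le_abs_self _).trans (hβB x hx)
    have huq : 0 < u x ^ q := Real.rpow_pos_of_pos hu _
    have c3 : B x * (1 * v x * u x ^ q) * θ x ^ (2 * k + 4 + 2) ≤
        β * (1 + (v x ^ (p + 1) + u x ^ (q + 1))) * θ x ^ (2 * k + 4) := by
      rw [one_mul]
      gcongr
      exact c1.trans c2
    have c4 := mul_le_mul_of_nonneg_left
      (mul_le_mul_of_nonneg_right (sq_u u v hc x hx).2 t4) hC2
    have c5 := mul_nonneg hC2 (mul_nonneg hZ.le t4)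
    have c6 := mul_le_mul_of_nonneg_left t1 (by positivity : 0 ≤ 2 * β + C2)
    rw [e1, e2]
    linarith
  · obtain ⟨hu, hv, hZ, hW⟩ := nn u v hc x hx
    have t0 := hθ.nonneg x
    have := gdot_self_nonneg u x
    have := gdot_self_nonneg v x
    positivity
  · obtain ⟨hu, hv, hZ, hW⟩ := nn u v hc x hx
    obtain ⟨a1, a2⟩ := sq_u u v hc x hx
    have := gdot_self_nonneg u x
    have := gdot_self_nonneg v x
    simp only [hθE x hxE, one_pow, mul_one, one_mul]
    refine ⟨?_, ?_, ?_, ?_, ?_, ?_⟩ <;> linarith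

end ComparisonFlux

section Nonexistence

variable {N : ℕ} {K E : Set (Euc N)} {u v : Euc N → ℝ} {p q a b α β : ℝ}

lemma FluxBdd.mono {S S' : (Euc N → ℝ) → (Euc N → ℝ) → Prop} (h : FluxBdd K E p q S')
    (hS : ∀ u v, S u v → S' u v) : FluxBdd K E p q S :=
  ⟨fun χ c0 hχ => (h.1 χ c0 hχ).imp fun _ hC u v huv => hC u v (hS u v huv),
    fun χ c0 hχ => (h.2 χ c0 hχ).imp fun _ hC u v huv => hC u v (hS u v huv)⟩

lemma HLEStableOutside.swap (h : HLEStableOutside p q a b u v K) :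
    HLEStableOutside q p b a v u K :=
  ⟨h.1, fun Ω hΩ hc hK => by
    obtain ⟨ξ, ζ, cξ, cζ, hξ, hζ, h1, h2⟩ := h.2 Ω hΩ hc hK
    exact ⟨ζ, ξ, cζ, cξ, hζ, hξ, h2, h1⟩⟩

lemma HLEStableOutside.eventually_isStab (h : HLEStableOutside p q a b u v K)
    (hu : ∀ x, 0 < u x) (hv : ∀ x, 0 < v x) (hα : p * β = α + 2 + a) (hβ : q * α = β + 2 + b) :
    ∀ᶠ R : ℝ in atTop, IsStab (collar N) (fun x => ‖x‖ ^ a) (fun x => ‖x‖ ^ b) p q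
      (fun x => R ^ α * u (R • x)) fun x => R ^ β * v (R • x) := by
  obtain ⟨hK, hst⟩ := h
  obtain ⟨R₀, hR₀⟩ := hK.isBounded.subset_closedBall 0
  filter_upwards [eventually_gt_atTop 0, eventually_gt_atTop (2 * R₀)] with R hR hR'
  have hΩ : IsOpen {x : Euc N | R / 2 < ‖x‖ ∧ ‖x‖ < 3 * R} :=
    (isOpen_lt continuous_const continuous_norm).inter
      (isOpen_lt continuous_norm continuous_const)
  have hsub : closure {x : Euc N | R / 2 < ‖x‖ ∧ ‖x‖ < 3 * R} ⊆ shell N (R / 2) (3 * R) :=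
    closure_minimal (fun x hx => ⟨hx.1.le, hx.2.le⟩) (isCompact_shell _ _).isClosed
  refine (hst _ hΩ ((isCompact_shell _ _).of_isClosed_subset isClosed_closure hsub)
    fun x hx hxK => ?_).scale hΩ hu hv hR hα hβ fun x hx => ?_
  · have h1 := (hsub hx).1
    have h2 := hR₀ hxK
    rw [mem_closedBall_zero_iff] at h2
    linarith
  · refine ⟨?_, ?_⟩ <;> rw [norm_smul, Real.norm_of_nonneg hR.le]
    · nlinarith [hx.1]
    · nlinarith [hx.2]

lemma integrableOn_shell_weight (hv : Continuous v) (hv0 : ∀ x, 0 < v x) {r s : ℝ} (hr : 0 < r) :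
    IntegrableOn (fun x => ‖x‖ ^ a * v x ^ (p + 1)) (shell N r s) :=
  (((contDiffOn_norm_rpow a).continuousOn.mono (shell_subset_ne_zero hr)).mul
    (hv.continuousOn.rpow_const fun x _ => Or.inl (hv0 x).ne')).integrableOn_compact
    (isCompact_shell r s)

lemma setIntegral_shell_weight_pos (hN : 0 < N) (hv : Continuous v) (hv0 : ∀ x, 0 < v x) :
    0 < ∫ x in shell N 1 2, ‖x‖ ^ a * v x ^ (p + 1) := by
  have pos : ∀ x ∈ shell N 1 2, 0 < ‖x‖ ^ a * v x ^ (p + 1) := fun x hx =>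
    mul_pos (Real.rpow_pos_of_pos (one_pos.trans_le hx.1) _) (Real.rpow_pos_of_pos (hv0 x) _)
  have hm := (isCompact_shell (N := N) 1 2).measurableSet
  rw [setIntegral_pos_iff_support_of_nonneg_ae
    (ae_restrict_of_forall_mem hm fun x hx => (pos x hx).le)
    (integrableOn_shell_weight hv hv0 one_pos)]
  refine lt_of_lt_of_le ?_ (measure_mono (s := shell N 1 2) fun x hx => ⟨(pos x hx).ne', hx⟩)
  set y : Euc N := (3 / 2 : ℝ) • EuclideanSpace.single ⟨0, hN⟩ 1 with hy
  have hy1 : ‖y‖ = 3 / 2 := by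
    rw [hy, norm_smul, PiLp.norm_single]; norm_num
  refine Measure.measure_pos_of_mem_nhds volume (x := y) ?_
  filter_upwards [(isOpen_lt continuous_const continuous_norm).mem_nhds
    (show (1 : ℝ) < ‖y‖ by rw [hy1]; norm_num),
    (isOpen_lt continuous_norm continuous_const).mem_nhds
    (show ‖y‖ < (2 : ℝ) by rw [hy1]; norm_num)] with x h1 h2
  exact ⟨h1.le, h2.le⟩

lemma rpow_mul_setIntegral_shell_le (hv : Continuous v) (hv0 : ∀ x, 0 < v x) {R : ℝ}
    (hR : 2 ≤ R) :
    R ^ (β * (p + 1) - N - a) * ∫ x in shell N 1 2, ‖x‖ ^ a * v x ^ (p + 1) ≤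
      ∫ x in shell N R⁻¹ 1, ‖x‖ ^ a * (R ^ β * v (R • x)) ^ (p + 1) := by
  have hR0 : 0 < R := by linarith
  have c0 : Continuous fun x : Euc N => R ^ β * v (R • x) :=
    (hv.comp (continuous_const_smul R)).const_mul _
  have p0 : ∀ x : Euc N, 0 < R ^ β * v (R • x) := fun x =>
    mul_pos (Real.rpow_pos_of_pos hR0 _) (hv0 _)
  have hi : 0 < R⁻¹ := inv_pos.2 hR0
  have hsub : shell N (R⁻¹ * 1) (R⁻¹ * 2) ⊆ shell N R⁻¹ 1 := fun x hx => by
    refine ⟨by simpa using hx.1, hx.2.trans ?_⟩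
    rw [inv_mul_le_iff₀ hR0]
    linarith
  refine le_trans (le_of_eq ?_) (setIntegral_mono_set (integrableOn_shell_weight c0 p0 hi)
    (Eventually.of_forall fun x => mul_nonneg (Real.rpow_nonneg (norm_nonneg x) _)
      (Real.rpow_pos_of_pos (p0 x) _).le) hsub.eventuallyLE)
  rw [setIntegral_shell_smul hi, ← integral_const_mul, ← integral_const_mul]
  refine integral_congr_ae (Eventually.of_forall fun x => ?_)
  beta_reduce
  rw [norm_smul_rpow hi, smul_inv_smul₀ hR0.ne', Real.mul_rpow (Real.rpow_nonneg hR0.le _)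
    (hv0 x).le, ← Real.rpow_mul hR0.le, Real.inv_rpow hR0.le, Real.rpow_sub hR0,
    Real.rpow_sub hR0, Real.rpow_natCast, inv_pow]
  field_simp

lemma scaling_exponents (hpq : p * q - 1 ≠ 0) (hα : α = (2 * (p + 1) + a + p * b) / (p * q - 1))
    (hβ : β = (2 * (q + 1) + b + q * a) / (p * q - 1)) :
    p * β = α + 2 + a ∧ q * α = β + 2 + b := by
  rw [eq_div_iff hpq] at hα hβ
  exact ⟨mul_right_cancel₀ hpq (by linear_combination p * hβ - hα),
    mul_right_cancel₀ hpq (by linear_combination q * hα - hβ)⟩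

/-- A solution stable outside a compact set violates the energy bounds that follow from the flux
bounds. -/
lemma PosSol.not_stableOutside_of_fluxBdd
    (hF : FluxBdd (shell N 1 2) (edge N) p q fun u v => PosSol p q a b u v ∧
      IsStab (collar N) (fun x => ‖x‖ ^ a) (fun x => ‖x‖ ^ b) p q u v)
    (hN : 3 ≤ N) (hp : 0 < p) (hq : 0 < q) (hpq : 1 < p * q) (ha : -2 < a) (hb : -2 < b)
    (hsub : ((N : ℝ) + a) / (p + 1) + ((N : ℝ) + b) / (q + 1) > (N : ℝ) - 2)
    (h : PosSol p q a b u v) : ¬HLEStableOutside p q a b u v K := by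
  intro hst
  have hd : 0 < p * q - 1 := by linarith
  set α := (2 * (p + 1) + a + p * b) / (p * q - 1) with hα
  set β := (2 * (q + 1) + b + q * a) / (p * q - 1) with hβ
  obtain ⟨eα, eβ⟩ := scaling_exponents hd.ne' hα hβ
  obtain ⟨C, hC⟩ := energy_le_of_fluxBdd hF (fun _ _ h => h.1) hN hp hq ha hb rfl rfl rfl
    (by linarith)
  set c := (N + a) / (p + 1) - (N - 2 - (N + b) / (q + 1)) with hc
  have hc0 : 0 < c := by linarith
  have he : 0 < β * (p + 1) - N - a := by
    have e : β * (p + 1) - N - a = c * (p + 1) * (q + 1) / (p * q - 1) := by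
      have e1 : c * (p + 1) * (q + 1) = (N + a) * (q + 1) + (N + b) * (p + 1) -
          (N - 2) * (p + 1) * (q + 1) := by rw [hc]; field_simp; ring
      rw [eq_div_iff hd.ne'] at hβ ⊢
      rw [e1]
      linear_combination (p + 1) * hβ
    rw [e]
    positivity
  have hJ := setIntegral_shell_weight_pos (a := a) (p := p) (by omega) h.cont_v h.v_pos
  have ht := ((tendsto_rpow_atTop he).atTop_mul_const hJ).const_mul_atTop hc0
  obtain ⟨R, h1, h2, h3⟩ := ((ht.eventually_gt_atTop C).and ((eventually_ge_atTop 2).and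
    (hst.eventually_isStab h.u_pos h.v_pos eα eβ))).exists
  have hR : 0 < R := by linarith
  have h4 := hC _ _ ⟨h.scale hR eα eβ, h3⟩ R⁻¹ (inv_pos.2 hR)
    (inv_le_one_of_one_le₀ (by linarith))
  have h5 := mul_le_mul_of_nonneg_left
    (rpow_mul_setIntegral_shell_le (a := a) (β := β) (p := p) h.cont_v h.v_pos h2) hc0.le
  linarith

lemma PosSol.not_stableOutside_of_lt_one (hN : 3 ≤ N) (hp : 0 < p) (hq : 0 < q)
    (hpq : 1 < p * q) (ha : -2 < a) (hb : -2 < b)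
    (hsub : ((N : ℝ) + a) / (p + 1) + ((N : ℝ) + b) / (q + 1) > (N : ℝ) - 2) (hp1 : p < 1)
    (h : PosSol p q a b u v) : ¬HLEStableOutside p q a b u v K := by
  have pos : ∀ c : ℝ, ∀ x ∈ shell N 1 2, 0 < ‖x‖ ^ c := fun c x hx =>
    Real.rpow_pos_of_pos (one_pos.trans_le hx.1) _
  have hF := fluxBdd_of_lt_one (isOpen_collar (N := N)) (isCompact_shell 1 2) shell_subset_collar
    isClosed_edge edge_subset_shell shellCutoff_isCutoff shellCutoff_eq_one_of_mem_edge
    ((contDiffOn_norm_rpow a).mono collar_subset_ne_zero)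
    ((contDiffOn_norm_rpow b).mono collar_subset_ne_zero) (pos a) (pos b) hp hq hp1 hpq
  exact h.not_stableOutside_of_fluxBdd
    (hF.mono fun u v h => ⟨h.1.isSys isOpen_collar collar_subset_ne_zero, h.2⟩)
    hN hp hq hpq ha hb hsub

lemma PosSol.not_stableOutside_of_one_le (hN : 3 ≤ N) (hp : 1 < p) (hq : 1 ≤ q) (hqp : q ≤ p)
    (ha : -2 < a) (hb : -2 < b)
    (hsub : ((N : ℝ) + a) / (p + 1) + ((N : ℝ) + b) / (q + 1) > (N : ℝ) - 2) (hab : b ≤ a)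
    (hab' : a - b ≤ ((N : ℝ) - 2) * (p - q))
    (h : PosSol p q a b u v) : ¬HLEStableOutside p q a b u v K := by
  have hpq : 1 < p * q := one_lt_mul_of_lt_of_le hp hq
  have hd : 0 < p * q - 1 := by linarith
  have pos : ∀ c : ℝ, ∀ x ∈ shell N 1 2, 0 < ‖x‖ ^ c := fun c x hx =>
    Real.rpow_pos_of_pos (one_pos.trans_le hx.1) _
  have cn : ∀ c : ℝ, ContinuousOn (fun x : Euc N => ‖x‖ ^ c) (shell N 1 2) := fun c =>
    (contDiffOn_norm_rpow c).continuousOn.mono (shell_subset_ne_zero one_pos)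
  have hF := IsComparable.fluxBdd (isOpen_collar (N := N)) (isCompact_shell 1 2)
    shell_subset_collar isClosed_edge edge_subset_shell shellCutoff_isCutoff
    shellCutoff_eq_one_of_mem_edge (cn a) (cn b) (pos a) (pos b) hp hq hqp
  refine h.not_stableOutside_of_fluxBdd (hF.mono fun u v h =>
    ⟨h.1.isSys isOpen_collar collar_subset_ne_zero, h.2, fun x hx => ?_⟩)
    hN (by linarith) (by linarith) hpq ha hb hsub
  obtain ⟨eα, eβ⟩ := scaling_exponents (a := a) (b := b) hd.ne' rfl rfl
  have := mul_pos (by linarith : 0 < q) (by linarith : 0 < a + 2)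
  exact h.1.comparison hN hp hq hqp hab hab' eα eβ (div_pos (by linarith) hd)
    (collar_subset_ne_zero hx)

end Nonexistence

/-- Theorem 1.4 (i): subcritical Hénon–Lane–Emden conjecture for solutions stable
outside a compact set, under `min{p,q} < 1` or `0 ≤ a - b ≤ (N-2)(p-q)`. -/
theorem stmt_0 (N : ℕ) (hN : 3 ≤ N) (p q a b : ℝ)
    (hp : 0 < p) (hq : 0 < q) (hpq : 1 < p * q)
    (ha : -2 < a) (hb : -2 < b)
    (hsub : ((N : ℝ) + a) / (p + 1) + ((N : ℝ) + b) / (q + 1) > (N : ℝ) - 2)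
    (hcond : min p q < 1 ∨ (0 ≤ a - b ∧ a - b ≤ ((N : ℝ) - 2) * (p - q))) :
    ¬ ∃ (u v : Euc N → ℝ) (K : Set (Euc N)),
        IsHLESol p q a b u v ∧ (∀ x, 0 < u x) ∧ (∀ x, 0 < v x) ∧
        HLEStableOutside p q a b u v K := by
  rintro ⟨u, v, K, hs, hu, hv, hst⟩
  have h := hs.posSol hu hv
  by_cases hp1 : p < 1
  · exact h.not_stableOutside_of_lt_one hN hp hq hpq ha hb hsub hp1 hst
  by_cases hq1 : q < 1
  · exact h.swap.not_stableOutside_of_lt_one hN hq hp (by linarith) hb ha (by linarith) hq1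
      hst.swap
  push Not at hp1 hq1
  rcases hcond with hc | ⟨h1, h2⟩
  · exact absurd hc (not_lt.2 (le_min hp1 hq1))
  · have hN' : (3 : ℝ) ≤ N := by exact_mod_cast hN
    have hqp : q ≤ p := by nlinarith
    have hp2 : 1 < p := by nlinarith
    exact h.not_stableOutside_of_one_le hN hp2 hq1 hqp ha hb hsub (by linarith) h2 hst
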